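/- arXiv:1909.12202 — 5 statements merged into one kernel-verified Lean document; each statement's English description precedes it below -/
import Mathlib

section
/- Let A ∈ ℝ^{n×n}, B ∈ ℝ^{n×1}, C ∈ ℝ^{1×n}, D ∈ ℝ, λ ∈ ℝ, γ > 0, ε ≥ 0, and let P ∈ ℝ^{n×n} be symmetric. Suppose the (n+1)×(n+1) symmetric matrix M = [[AᵀP + PA + 2λP + εI + CᵀC , PB + CᵀD],[BᵀP + DC , D² - γ²]] is negative semidefinite. Then for every ω ∈ ℝ such that (-λ + iω)I - A is invertible, the transfer function value G(-λ + iω) = C((-λ + iω)I - A)^{-1}B + D satisfies |G(-λ + iω)| ≤ γ. -/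
open Matrix
open scoped ComplexOrder

namespace Matrix

theorem PosSemidef.map_ofReal {m : Type*} [Fintype m] {M : Matrix m m ℝ}
    (hM : M.PosSemidef) : (M.map Complex.ofReal).PosSemidef := by
  classical
  obtain ⟨L, rfl⟩ : ∃ L : Matrix m m ℝ, M = Lᴴ * L := by
    open scoped MatrixOrder in
    exact CStarAlgebra.nonneg_iff_eq_star_mul_self.mp hM.nonneg
  have h : (Lᴴ * L).map Complex.ofReal = (L.map Complex.ofReal)ᴴ * L.map Complex.ofReal := by
    ext i j
    simp [mul_apply]
  rw [h]
  exact posSemidef_conjTranspose_mul_self _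

/-- The quadratic form of the dissipation inequality along solutions of `A X + B = s X`. -/
theorem conjTranspose_mul_dissipation_mul {n m : Type*} [Fintype n] [Fintype m] [DecidableEq n]
    [DecidableEq m] (A P : Matrix n n ℂ) (B X : Matrix n m ℂ) (C : Matrix m n ℂ) (D lam γ ε : ℝ)
    (s : ℂ) (hs : star s + s = -(2 * lam)) (hX : A * X + B = s • X) :
    (fromRows X (1 : Matrix m m ℂ))ᴴ * fromBlocks
        (Aᴴ * P + P * A + (2 * lam : ℂ) • P + (ε : ℂ) • (1 : Matrix n n ℂ) + Cᴴ * C)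
        (P * B + (D : ℂ) • Cᴴ) (Bᴴ * P + (D : ℂ) • C)
        ((D ^ 2 - γ ^ 2 : ℂ) • (1 : Matrix m m ℂ)) * fromRows X (1 : Matrix m m ℂ) =
      (ε : ℂ) • (Xᴴ * X) + (C * X + (D : ℂ) • 1)ᴴ * (C * X + (D : ℂ) • 1) -
        (γ ^ 2 : ℂ) • (1 : Matrix m m ℂ) := by
  obtain rfl : B = s • X - A * X := by rw [← hX]; abel
  have hs' : (2 * lam : ℂ) = -(star s + s) := by rw [hs, neg_neg]
  rw [hs', conjTranspose_fromRows_eq_fromCols_conjTranspose, fromCols_mul_fromBlocks,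
    fromCols_mul_fromRows]
  simp only [conjTranspose_add, conjTranspose_sub, conjTranspose_mul, conjTranspose_smul,
    conjTranspose_one, Matrix.mul_add, Matrix.add_mul, Matrix.mul_sub, Matrix.sub_mul,
    Matrix.mul_smul, Matrix.smul_mul, Matrix.mul_one, Matrix.one_mul, Matrix.mul_assoc,
    Complex.star_def, Complex.conj_ofReal]
  module

end Matrix

/-- KYP-type direction (LMI (20) of the paper ⇒ frequency-domain bound): if the
dominance LMI is negative semidefinite, then `|G(-λ+iω)| ≤ γ` on the shifted line. -/
theorem lmi_implies_frequency_bound (n : ℕ)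
    (A : Matrix (Fin n) (Fin n) ℝ) (B : Matrix (Fin n) (Fin 1) ℝ)
    (C : Matrix (Fin 1) (Fin n) ℝ) (D : ℝ) (lam γ ε : ℝ)
    (hγ : 0 < γ) (hε : 0 ≤ ε)
    (P : Matrix (Fin n) (Fin n) ℝ) (hP : P.IsSymm)
    (hLMI : (-(Matrix.fromBlocks
        (Aᵀ * P + P * A + (2 * lam) • P + ε • (1 : Matrix (Fin n) (Fin n) ℝ) + Cᵀ * C)
        (P * B + D • Cᵀ)
        (Bᵀ * P + D • C)
        ((D ^ 2 - γ ^ 2) • (1 : Matrix (Fin 1) (Fin 1) ℝ)))).PosSemidef) :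
    ∀ ω : ℝ,
      IsUnit (((-lam : ℂ) + ω * Complex.I) • (1 : Matrix (Fin n) (Fin n) ℂ) -
          A.map (Complex.ofReal)) →
      ‖(C.map (Complex.ofReal) *
            (((-lam : ℂ) + ω * Complex.I) • (1 : Matrix (Fin n) (Fin n) ℂ) -
              A.map (Complex.ofReal))⁻¹ *
          B.map (Complex.ofReal)) 0 0 + (D : ℂ)‖ ≤ γ := by
  intro ω hω
  set s : ℂ := (-lam : ℂ) + ω * Complex.I with hs
  set A' := A.map Complex.ofReal
  set B' := B.map Complex.ofReal
  set C' := C.map Complex.ofReal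
  set X := (s • (1 : Matrix (Fin n) (Fin n) ℂ) - A')⁻¹ * B' with hXdef
  have hX : A' * X + B' = s • X := by
    have h : (s • (1 : Matrix (Fin n) (Fin n) ℂ) - A') * X = B' :=
      mul_nonsing_inv_cancel_left _ _ ((isUnit_iff_isUnit_det _).mp hω)
    rw [← h, Matrix.sub_mul, Matrix.smul_mul, Matrix.one_mul, add_sub_cancel]
  have hsum : star s + s = -(2 * lam) := by
    simp only [hs, Complex.star_def, map_add, map_neg, map_mul, Complex.conj_ofReal,
      Complex.conj_I]
    ring
  have hform := hLMI.map_ofReal.conjTranspose_mul_mul_same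
    (fromRows X (1 : Matrix (Fin 1) (Fin 1) ℂ))
  have hmap : (-(Matrix.fromBlocks
        (Aᵀ * P + P * A + (2 * lam) • P + ε • (1 : Matrix (Fin n) (Fin n) ℝ) + Cᵀ * C)
        (P * B + D • Cᵀ)
        (Bᵀ * P + D • C)
        ((D ^ 2 - γ ^ 2) • (1 : Matrix (Fin 1) (Fin 1) ℝ)))).map Complex.ofReal =
      -(Matrix.fromBlocks
        (A'ᴴ * P.map Complex.ofReal + P.map Complex.ofReal * A' +
          (2 * lam : ℂ) • P.map Complex.ofReal + (ε : ℂ) • (1 : Matrix (Fin n) (Fin n) ℂ) +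
          C'ᴴ * C')
        (P.map Complex.ofReal * B' + (D : ℂ) • C'ᴴ)
        (B'ᴴ * P.map Complex.ofReal + (D : ℂ) • C')
        ((D ^ 2 - γ ^ 2 : ℂ) • (1 : Matrix (Fin 1) (Fin 1) ℂ))) := by
    ext (i | i) (j | j) <;>
      simp [A', B', C', mul_apply, one_apply, apply_ite Complex.ofReal]
  rw [hmap, Matrix.mul_neg, Matrix.neg_mul,
    conjTranspose_mul_dissipation_mul A' (P.map Complex.ofReal) B' X C' D lam γ ε s hsum hX]
    at hform
  have hentry := (Complex.le_def.mp (hform.diag_nonneg (i := 0))).1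
  have hXX : 0 ≤ ((Xᴴ * X) 0 0).re :=
    (Complex.le_def.mp ((posSemidef_conjTranspose_mul_self X).diag_nonneg (i := 0))).1
  have hsq : ((C' * X + (D : ℂ) • (1 : Matrix (Fin 1) (Fin 1) ℂ))ᴴ *
      (C' * X + (D : ℂ) • (1 : Matrix (Fin 1) (Fin 1) ℂ))) 0 0 =
      ((‖(C' * X) 0 0 + D‖ ^ 2 : ℝ) : ℂ) := by
    rw [mul_apply, Fin.sum_univ_one, conjTranspose_apply, Complex.star_def, Complex.conj_mul']
    simp
  have hγre : ((γ : ℂ) ^ 2).re = γ ^ 2 := by rw [← Complex.ofReal_pow, Complex.ofReal_re]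
  rw [Matrix.neg_apply, Matrix.sub_apply, Matrix.add_apply, hsq] at hentry
  simp only [Matrix.smul_apply, one_apply_eq, smul_eq_mul, mul_one, Complex.neg_re, Complex.sub_re,
    Complex.add_re, Complex.re_ofReal_mul, Complex.ofReal_re, Complex.zero_re, hγre] at hentry
  rw [Matrix.mul_assoc, ← hXdef]
  refine (sq_le_sq₀ (norm_nonneg _) hγ.le).mp ?_
  linarith [mul_nonneg hε hXX]
end

section
/- Let A ∈ ℝ^{n×n}, λ ∈ ℝ, ε > 0, and let P ∈ ℝ^{n×n} be symmetric with exactly p negative eigenvalues, exactly n - p positive eigenvalues, and no zero eigenvalue. If AᵀP + PA + 2λP + εI is negative semidefinite, then exactly p eigenvalues of A (counted with algebraic multiplicity) satisfy Re(μ) > -λ, exactly n - p eigenvalues satisfy Re(μ) < -λ, and no eigenvalue satisfies Re(μ) = -λ. -/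
open Matrix

open Polynomial in
/-- If `v` is an eigenvector of `T` and `W` is a complement of the line through `v`, the
characteristic polynomial of `T` is that of its compression to `W` times a linear factor. -/
theorem LinearMap.charpoly_eq_X_sub_C_mul_of_compression {K V : Type*} [Field K]
    [AddCommGroup V] [Module K V] [FiniteDimensional K V] {T : Module.End K V} {μ : K} {v : V}
    (hTv : T v = μ • v) {W : Submodule K V} {T' : Module.End K W} (hvW : v ∉ W)
    (hsp : ∀ z : V, ∃ c : K, z + c • v ∈ W)
    (hT' : ∀ w : W, ∃ c : K, T w = c • v + T' w) :
    T.charpoly = (X - C μ) * T'.charpoly := by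
  have hli : ∀ (c : K), ∀ x ∈ W, c • v + x = 0 → c = 0 := by
    intro c x hx h
    by_contra hc
    apply hvW
    rw [← W.smul_mem_iff hc, eq_neg_of_add_eq_zero_left h]
    exact W.neg_mem hx
  set b' := Module.finBasis K W
  set b := Module.Basis.mkFinCons v b' hli hsp
  have hb0 : b 0 = v := by simp [b]
  have hbs (j) : b (Fin.succ j) = b' j := by simp [b]
  have hrepr (w : W) (i) : b.repr w (Fin.succ i) = b'.repr w i := by
    have : (Finsupp.lapply (Fin.succ i)).comp (b.repr.toLinearMap.comp W.subtype) =
        (Finsupp.lapply i).comp b'.repr.toLinearMap := by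
      refine b'.ext fun j => ?_
      simp [← hbs, Finsupp.single_apply]
    exact LinearMap.congr_fun this w
  have hcol (i) : LinearMap.toMatrix b b T i 0 = if i = 0 then μ else 0 := by
    rw [LinearMap.toMatrix_apply, hb0, hTv, ← hb0]
    simp [Finsupp.single_apply, eq_comm]
  have hblock (i j) : LinearMap.toMatrix b b T (Fin.succ i) (Fin.succ j) =
      LinearMap.toMatrix b' b' T' i j := by
    rw [LinearMap.toMatrix_apply, LinearMap.toMatrix_apply, hbs]
    obtain ⟨c, hc⟩ := hT' (b' j)
    rw [hc, ← hb0, ← hrepr]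
    simp
  rw [← T.charpoly_toMatrix b, ← T'.charpoly_toMatrix b', Matrix.charpoly,
    Matrix.det_succ_column_zero, Fin.sum_univ_succ, Finset.sum_eq_zero]
  · have hsub : (LinearMap.toMatrix b b T).charmatrix.submatrix (Fin.succAbove 0) Fin.succ =
        (LinearMap.toMatrix b' b' T').charmatrix := by
      ext1 i j
      simp [Matrix.charmatrix_apply, hblock, Matrix.diagonal_apply]
    rw [hsub]
    simp [hcol, Matrix.charpoly]
  · intro i _
    simp [hcol]

section Orthogonal

variable {V : Type*} [AddCommGroup V] [Module ℂ V] {B : V →ₗ⋆[ℂ] V →ₗ[ℂ] ℂ}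

open Polynomial in
/-- If `re B(x, T x) + lam * re B(x, x) < 0` for all nonzero `x`, there is a `B`-orthogonal family
indexed by the eigenvalues of `T` along which the sign of `B` is opposite to that of the real parts
of the eigenvalues, relative to the line `re s = -lam`. -/
theorem LinearMap.IsSymm.exists_isOrtho_charpoly_eq_prod (n : ℕ) [FiniteDimensional ℂ V]
    (hn : Module.finrank ℂ V = n) (T : Module.End ℂ V) (lam : ℝ) (hB : B.IsSymm)
    (hneg : ∀ x, x ≠ 0 → (B x (T x)).re + lam * (B x x).re < 0) :
    ∃ (b : Fin n → V) (μ : Fin n → ℂ), B.IsOrthoᵢ b ∧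
      (∀ i, (B (b i) (b i)).re * ((μ i).re + lam) < 0) ∧ T.charpoly = ∏ i, (X - C (μ i)) := by
  induction n generalizing V with
  | zero =>
    refine ⟨Fin.elim0, Fin.elim0, fun i => i.elim0, fun i => i.elim0, ?_⟩
    rw [Finset.univ_eq_empty, Finset.prod_empty]
    exact T.charpoly_monic.natDegree_eq_zero.mp (by rw [T.charpoly_natDegree, hn])
  | succ n ih =>
    have : Nontrivial V := Module.nontrivial_of_finrank_pos (R := ℂ) (by omega)
    obtain ⟨μ, hμ⟩ := Module.End.exists_eigenvalue T
    obtain ⟨v, hv⟩ := hμ.exists_hasEigenvector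
    have hTv : T v = μ • v := hv.apply_eq_smul
    have him : (B v v).im = 0 := Complex.conj_eq_iff_im.mp (hB.eq v v)
    have hvv : (B v v).re * (μ.re + lam) < 0 := by
      have := hneg v hv.2
      rw [hTv, map_smul, smul_eq_mul, Complex.mul_re, him] at this
      linarith
    have hv0 : B v v ≠ 0 := fun h => by simp [h] at hvv
    set W := LinearMap.ker (B v)
    have hW : Module.finrank ℂ W = n := by
      have := Module.Dual.finrank_ker_add_one_of_ne_zero (K := ℂ) (f := B v)
        (fun h => hv0 (by rw [h]; rfl))
      rw [hn] at this
      exact Nat.succ_injective this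
    let π : V →ₗ[ℂ] W := LinearMap.codRestrict W
      (LinearMap.id - ((B v v)⁻¹ • B v).smulRight v) (fun x => by
        simp [W, mul_right_comm, inv_mul_cancel₀ hv0])
    have hπ (x : V) : (π x : V) = x - ((B v v)⁻¹ * B v x) • v := rfl
    have hvW (w : W) : B v w = 0 := w.2
    have hWv (w : W) : B w v = 0 := by rw [← hB.eq, hvW, map_zero]
    let T' : Module.End ℂ W := π ∘ₗ T ∘ₗ W.subtype
    have hT' (w : W) : T w = ((B v v)⁻¹ * B v (T w)) • v + T' w := by simp [T', hπ]
    obtain ⟨b, ν, hb, hbν, hchar⟩ := ih (B := B.domRestrict₁₂ W W) hW T'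
      ⟨fun x y => hB.eq x y⟩ (fun w hw => by
        have h := hneg w (by simpa using hw)
        rw [hT' w, map_add, map_smul, hWv, smul_zero, zero_add] at h
        exact h)
    refine ⟨Fin.cons v (fun i => b i), Fin.cons μ ν, ?_, ?_, ?_⟩
    · rw [LinearMap.isOrthoᵢ_def] at hb ⊢
      intro i j hij
      cases i using Fin.cases <;> cases j using Fin.cases
      · exact absurd rfl hij
      · simp [hvW]
      · simp [hWv]
      · exact hb _ _ (fun h => hij (congrArg Fin.succ h))
    · intro i
      cases i using Fin.cases
      · simpa using hvv
      · exact hbν _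
    · rw [Fin.prod_univ_succ]
      simp only [Fin.cons_zero, Fin.cons_succ, ← hchar]
      exact LinearMap.charpoly_eq_X_sub_C_mul_of_compression hTv hv0
        (fun z => ⟨-((B v v)⁻¹ * B v z), by
          simp [W, mul_right_comm, inv_mul_cancel₀ hv0]⟩) (fun w => ⟨_, hT' w⟩)

theorem LinearMap.IsOrthoᵢ.apply_sum_smul_self {ι : Type*} [Fintype ι] {u : ι → V}
    (hu : B.IsOrthoᵢ u) (a : ι → ℂ) :
    (B (∑ i, a i • u i) (∑ i, a i • u i)).re =
      ∑ i, Complex.normSq (a i) * (B (u i) (u i)).re := by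
  rw [LinearMap.isOrthoᵢ_def] at hu
  simp only [map_sum, LinearMap.sum_apply, map_smulₛₗ, LinearMap.smul_apply, smul_eq_mul,
    Complex.re_sum, RingHom.id_apply]
  refine Finset.sum_congr rfl fun i _ => ?_
  rw [Finset.sum_eq_single i]
  · rw [← Complex.re_ofReal_mul, ← Complex.mul_conj]
    ring_nf
  · intro j _ hj
    simp [hu _ _ hj]
  · simp

/-- A `B`-positive and a `B`-negative orthogonal family are jointly linearly independent. -/
theorem LinearMap.IsOrthoᵢ.card_add_card_le_finrank [FiniteDimensional ℂ V] {ι κ : Type*}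
    [Fintype ι] [Fintype κ] {u : ι → V} {w : κ → V} (hu : B.IsOrthoᵢ u) (hw : B.IsOrthoᵢ w)
    (hpos : ∀ i, 0 < (B (u i) (u i)).re) (hneg : ∀ j, (B (w j) (w j)).re < 0) :
    Fintype.card ι + Fintype.card κ ≤ Module.finrank ℂ V := by
  rw [← Fintype.card_sum]
  refine LinearIndependent.fintype_card_le_finrank (b := Sum.elim u w) (R := ℂ) ?_
  have hindu : LinearIndependent ℂ u := LinearMap.linearIndependent_of_isOrthoᵢ hu
    fun i h => by simpa [h] using hpos i
  have hindw : LinearIndependent ℂ w := LinearMap.linearIndependent_of_isOrthoᵢ hw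
    fun i h => by simpa [h] using hneg i
  refine hindu.sum_type hindw ?_
  rw [Submodule.disjoint_def]
  intro x hxu hxw
  obtain ⟨a, rfl⟩ := (Submodule.mem_span_range_iff_exists_fun ℂ).mp hxu
  obtain ⟨c, hc⟩ := (Submodule.mem_span_range_iff_exists_fun ℂ).mp hxw
  have hle : (B (∑ i, a i • u i) (∑ i, a i • u i)).re ≤ 0 := by
    rw [← hc, hw.apply_sum_smul_self]
    exact Finset.sum_nonpos fun j _ =>
      mul_nonpos_of_nonneg_of_nonpos (Complex.normSq_nonneg _) (hneg j).le
  have hterm : ∀ i ∈ Finset.univ, 0 ≤ Complex.normSq (a i) * (B (u i) (u i)).re :=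
    fun i _ => mul_nonneg (Complex.normSq_nonneg _) (hpos i).le
  rw [hu.apply_sum_smul_self] at hle
  have hzero := (Finset.sum_eq_zero_iff_of_nonneg hterm).mp
    (le_antisymm hle (Finset.sum_nonneg hterm))
  refine Finset.sum_eq_zero fun i hi => ?_
  rw [Complex.normSq_eq_zero.mp ((mul_eq_zero.mp (hzero i hi)).resolve_right (hpos i).ne'),
    zero_smul]

theorem LinearMap.IsOrthoᵢ.card_pos_add_card_neg_le_finrank [FiniteDimensional ℂ V]
    {ι κ : Type*} [Fintype ι] [Fintype κ] {u : ι → V} {w : κ → V}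
    (hu : B.IsOrthoᵢ u) (hw : B.IsOrthoᵢ w) :
    (Finset.univ.filter fun i => 0 < (B (u i) (u i)).re).card +
      (Finset.univ.filter fun j => (B (w j) (w j)).re < 0).card ≤ Module.finrank ℂ V := by
  rw [← Fintype.card_subtype, ← Fintype.card_subtype]
  rw [LinearMap.isOrthoᵢ_def] at hu hw
  exact LinearMap.IsOrthoᵢ.card_add_card_le_finrank (B := B)
    (u := fun i : {i // 0 < (B (u i) (u i)).re} => u i)
    (w := fun j : {j // (B (w j) (w j)).re < 0} => w j)
    (LinearMap.isOrthoᵢ_def.mpr fun i j hij => hu _ _ (Subtype.coe_ne_coe.mpr hij))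
    (LinearMap.isOrthoᵢ_def.mpr fun i j hij => hw _ _ (Subtype.coe_ne_coe.mpr hij))
    (fun i => i.2) (fun j => j.2)

end Orthogonal

theorem Finset.card_filter_pos_add_card_filter_neg {ι : Type*} [Fintype ι] {d : ι → ℝ}
    (hd : ∀ i, d i ≠ 0) :
    (Finset.univ.filter fun i => 0 < d i).card + (Finset.univ.filter fun i => d i < 0).card =
      Fintype.card ι := by
  rw [← Finset.card_univ, ← Finset.card_filter_add_card_filter_not (s := Finset.univ) (fun i => 0 < d i)]
  congr 2
  refine Finset.filter_congr fun i _ => ⟨fun h => not_lt.mpr h.le, fun h => lt_of_le_of_ne (not_lt.mp h) (hd i)⟩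

/-- Sylvester's law of inertia for orthogonal families of maximal size. -/
theorem LinearMap.IsOrthoᵢ.card_filter_eq {V : Type*} [AddCommGroup V] [Module ℂ V]
    [FiniteDimensional ℂ V] {B : V →ₗ⋆[ℂ] V →ₗ[ℂ] ℂ} {ι κ : Type*} [Fintype ι] [Fintype κ]
    {u : ι → V} {w : κ → V} (hu : B.IsOrthoᵢ u) (hw : B.IsOrthoᵢ w)
    (hι : Fintype.card ι = Module.finrank ℂ V) (hκ : Fintype.card κ = Module.finrank ℂ V)
    (hu0 : ∀ i, (B (u i) (u i)).re ≠ 0) (hw0 : ∀ j, (B (w j) (w j)).re ≠ 0) :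
    (Finset.univ.filter fun i => 0 < (B (u i) (u i)).re).card =
        (Finset.univ.filter fun j => 0 < (B (w j) (w j)).re).card ∧
      (Finset.univ.filter fun i => (B (u i) (u i)).re < 0).card =
        (Finset.univ.filter fun j => (B (w j) (w j)).re < 0).card := by
  have h₁ := hu.card_pos_add_card_neg_le_finrank hw
  have h₂ := hw.card_pos_add_card_neg_le_finrank hu
  have h₃ := Finset.card_filter_pos_add_card_filter_neg hu0
  have h₄ := Finset.card_filter_pos_add_card_filter_neg hw0
  omega

namespace Matrix

variable {m : Type*} [Fintype m]

/-- The sesquilinear form on complex vectors defined by a real matrix. -/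
noncomputable def complexForm (P : Matrix m m ℝ) : (m → ℂ) →ₗ⋆[ℂ] (m → ℂ) →ₗ[ℂ] ℂ :=
  LinearMap.mk₂'ₛₗ _ _ (fun x y => star x ⬝ᵥ P.map Complex.ofReal *ᵥ y)
    (fun _ _ _ => by simp [add_dotProduct]) (fun _ _ _ => by simp)
    (fun _ _ _ => by simp [mulVec_add]) (fun _ _ _ => by simp [mulVec_smul])

theorem complexForm_apply (P : Matrix m m ℝ) (x y : m → ℂ) :
    P.complexForm x y = star x ⬝ᵥ P.map Complex.ofReal *ᵥ y := rfl

theorem complexForm_isSymm {P : Matrix m m ℝ} (hP : P.IsHermitian) : P.complexForm.IsSymm := by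
  refine ⟨fun x y => ?_⟩
  have h : (P.map Complex.ofReal)ᴴ = P.map Complex.ofReal := by
    ext i j
    simpa using congrArg Complex.ofReal (hP.apply i j)
  rw [complexForm_apply, complexForm_apply, starRingEnd_apply, ← star_dotProduct, star_mulVec,
    h, dotProduct_mulVec]

theorem re_complexForm_self (P : Matrix m m ℝ) (x : m → ℂ) :
    (P.complexForm x x).re =
      (fun i => (x i).re) ⬝ᵥ P *ᵥ (fun i => (x i).re) +
        (fun i => (x i).im) ⬝ᵥ P *ᵥ (fun i => (x i).im) := by
  simp only [complexForm_apply, dotProduct, mulVec, Complex.re_sum, Complex.im_sum,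
    ← Finset.sum_add_distrib, Pi.star_apply, Complex.mul_re, Complex.star_def, Complex.conj_re,
    Complex.conj_im, Matrix.map_apply, Complex.ofReal_re, Complex.ofReal_im, Complex.mul_im,
    zero_mul, sub_zero, add_zero, neg_mul, sub_neg_eq_add]

theorem complexForm_ofReal (P : Matrix m m ℝ) (x y : m → ℝ) :
    P.complexForm (fun i => (x i : ℂ)) (fun i => (y i : ℂ)) = ((x ⬝ᵥ P *ᵥ y : ℝ) : ℂ) := by
  simp [complexForm_apply, dotProduct, mulVec]

theorem complexForm_mulVec_right (P A : Matrix m m ℝ) (x y : m → ℂ) :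
    P.complexForm x (A.map Complex.ofReal *ᵥ y) = (P * A).complexForm x y := by
  rw [complexForm_apply, complexForm_apply, mulVec_mulVec]
  congr 2
  ext i j
  simp [Matrix.mul_apply]

variable [DecidableEq m]

theorem IsHermitian.eigenvectorBasis_dotProduct_mulVec {P : Matrix m m ℝ} (hP : P.IsHermitian)
    (i j : m) : (hP.eigenvectorBasis i).ofLp ⬝ᵥ P *ᵥ (hP.eigenvectorBasis j).ofLp =
      if i = j then hP.eigenvalues j else 0 := by
  have h := orthonormal_iff_ite.mp hP.eigenvectorBasis.orthonormal i j
  rw [EuclideanSpace.inner_eq_star_dotProduct, star_trivial, dotProduct_comm] at h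
  rw [hP.mulVec_eigenvectorBasis, dotProduct_smul, h]
  simp

/-- The dominance LMI makes `P * A + lam * P` negative definite as a real quadratic form. -/
theorem dotProduct_mulVec_neg_of_dominance {A P : Matrix m m ℝ} {lam ε : ℝ} (hε : 0 < ε)
    (hP : P.IsHermitian)
    (hLMI : (-(Aᵀ * P + P * A + (2 * lam) • P + ε • (1 : Matrix m m ℝ))).PosSemidef)
    {x : m → ℝ} (hx : x ≠ 0) : x ⬝ᵥ (P * A) *ᵥ x + lam * (x ⬝ᵥ P *ᵥ x) < 0 := by
  have h := hLMI.dotProduct_mulVec_nonneg x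
  have hT : x ⬝ᵥ (Aᵀ * P) *ᵥ x = x ⬝ᵥ (P * A) *ᵥ x := by
    have : Aᵀ * P = (P * A)ᵀ := by
      rw [transpose_mul, ← conjTranspose_eq_transpose_of_trivial P, hP.eq]
    rw [this, mulVec_transpose, dotProduct_comm, ← dotProduct_mulVec]
  have hxx : 0 < x ⬝ᵥ x := by simpa using dotProduct_star_self_pos_iff.mpr hx
  simp only [star_trivial, neg_mulVec, add_mulVec, smul_mulVec, one_mulVec, dotProduct_neg,
    dotProduct_add, dotProduct_smul, smul_eq_mul, hT] at h
  nlinarith [mul_pos hε hxx]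

theorem re_complexForm_neg_of_dominance {A P : Matrix m m ℝ} {lam ε : ℝ} (hε : 0 < ε)
    (hP : P.IsHermitian)
    (hLMI : (-(Aᵀ * P + P * A + (2 * lam) • P + ε • (1 : Matrix m m ℝ))).PosSemidef)
    {x : m → ℂ} (hx : x ≠ 0) :
    (P.complexForm x (A.map Complex.ofReal *ᵥ x)).re + lam * (P.complexForm x x).re < 0 := by
  have hneg {y : m → ℝ} := dotProduct_mulVec_neg_of_dominance hε hP hLMI (x := y)
  have hnonpos (y : m → ℝ) : y ⬝ᵥ (P * A) *ᵥ y + lam * (y ⬝ᵥ P *ᵥ y) ≤ 0 := by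
    rcases eq_or_ne y 0 with rfl | hy
    · simp
    · exact (hneg hy).le
  rw [complexForm_mulVec_right, re_complexForm_self, re_complexForm_self]
  have hre := hnonpos fun i => (x i).re
  have him := hnonpos fun i => (x i).im
  by_cases h : (fun i => (x i).re) = 0
  · have : (fun i => (x i).im) ≠ 0 := fun h' =>
      hx (funext fun i => Complex.ext (congrFun h i) (congrFun h' i))
    linarith [hneg this]
  · linarith [hneg h]

end Matrix


/-- Inertia theorem for the strict `p`-dominance LMI (21) of the paper: if
`AᵀP + PA + 2λP + εI ⪯ 0` with `P` symmetric of inertia `(p, 0, n-p)`, then `A` has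
exactly `p` eigenvalues with `Re μ > -λ`, exactly `n-p` with `Re μ < -λ`, and none
with `Re μ = -λ`. -/
theorem dominance_lmi_inertia (n p : ℕ)
    (A : Matrix (Fin n) (Fin n) ℝ) (lam ε : ℝ) (hε : 0 < ε)
    (P : Matrix (Fin n) (Fin n) ℝ) (hP : P.IsHermitian)
    (hPneg : (Finset.univ.filter fun i => hP.eigenvalues i < 0).card = p)
    (hPpos : (Finset.univ.filter fun i => 0 < hP.eigenvalues i).card = n - p)
    (hPzero : ∀ i, hP.eigenvalues i ≠ 0)
    (hLMI : (-(Aᵀ * P + P * A + (2 * lam) • P +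
        ε • (1 : Matrix (Fin n) (Fin n) ℝ))).PosSemidef) :
    (((A.map (Complex.ofReal)).charpoly.roots.filter fun μ => -lam < μ.re).card = p) ∧
    (((A.map (Complex.ofReal)).charpoly.roots.filter fun μ => μ.re < -lam).card = n - p) ∧
    (∀ μ ∈ (A.map (Complex.ofReal)).charpoly.roots, μ.re ≠ -lam) := by
  have hsymm := complexForm_isSymm hP
  obtain ⟨b, μ, hb, hbμ, hchar⟩ := hsymm.exists_isOrtho_charpoly_eq_prod n (by simp)
    (toLin' (A.map Complex.ofReal)) lam fun x hx => by
      simpa using re_complexForm_neg_of_dominance hε hP hLMI hx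
  let u (j : Fin n) : Fin n → ℂ := fun i => (hP.eigenvectorBasis j i : ℂ)
  have huu (i j) : P.complexForm (u i) (u j) =
      ((if i = j then hP.eigenvalues j else 0 : ℝ) : ℂ) := by
    rw [← hP.eigenvectorBasis_dotProduct_mulVec, ← complexForm_ofReal]
  have hu : P.complexForm.IsOrthoᵢ u :=
    LinearMap.isOrthoᵢ_def.mpr fun i j hij => by simp [huu, hij]
  have hud (i) : (P.complexForm (u i) (u i)).re = hP.eigenvalues i := by simp [huu]
  obtain ⟨hpos, hneg⟩ := hb.card_filter_eq hu (by simp) (by simp)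
    (fun i h => by simpa [h] using hbμ i) (fun i => by rw [hud]; exact hPzero i)
  simp only [hud] at hpos hneg
  rw [hPpos] at hpos
  rw [hPneg] at hneg
  have hroots : (A.map Complex.ofReal).charpoly.roots = Finset.univ.val.map μ := by
    rw [← charpoly_toLin', hchar, Finset.prod_eq_multiset_prod]
    rw [← Polynomial.roots_multiset_prod_X_sub_C (Finset.univ.val.map μ), Multiset.map_map]
    rfl
  have hgt (i) : -lam < (μ i).re ↔ (P.complexForm (b i) (b i)).re < 0 := by
    constructor <;> intro h <;> by_contra! <;> nlinarith [hbμ i]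
  have hlt (i) : (μ i).re < -lam ↔ 0 < (P.complexForm (b i) (b i)).re := by
    constructor <;> intro h <;> by_contra! <;> nlinarith [hbμ i]
  rw [hroots]
  refine ⟨?_, ?_, ?_⟩
  · rw [Multiset.filter_map, Multiset.card_map, ← hneg]
    simp only [Function.comp_def, hgt]
    rfl
  · rw [Multiset.filter_map, Multiset.card_map, ← hpos]
    simp only [Function.comp_def, hlt]
    rfl
  · intro ν hν h
    obtain ⟨i, -, rfl⟩ := Multiset.mem_map.mp hν
    simpa [h] using hbμ i
end

section
/- Let A ∈ ℝ^{n×n}, B ∈ ℝ^{n×1}, C ∈ ℝ^{1×n}, D ∈ ℝ, λ ∈ ℝ, and γ > 0. Assume that exactly p eigenvalues of A (with algebraic multiplicity) satisfy Re(μ) > -λ, exactly n - p satisfy Re(μ) < -λ, no eigenvalue satisfies Re(μ) = -λ, and that sup_{ω∈ℝ} |C((-λ+iω)I - A)^{-1}B + D| < γ. Then there exist ε > 0 and a symmetric matrix P ∈ ℝ^{n×n} with exactly p negative eigenvalues, exactly n - p positive eigenvalues and no zero eigenvalue, such that the (n+1)×(n+1) symmetric matrix [[AᵀP + PA + 2λP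 + εI + CᵀC , PB + CᵀD],[BᵀP + DC , D² - γ²]] is negative semidefinite. -/
open Matrix

universe u

/-- The positive semidefinite matrices of unit trace form a compact set. -/
theorem isCompact_posSemidef_trace_one (m : Type*) [Fintype m] :
    IsCompact {W : Matrix m m ℝ | W.PosSemidef ∧ W.trace = 1} := by
  classical
  have hbox : IsCompact {W : Matrix m m ℝ | ∀ i j, W i j ∈ Set.Icc (-1 : ℝ) 1} := by
    have := isCompact_univ_pi (fun i : m => isCompact_univ_pi
      (fun j : m => isCompact_Icc (a := (-1 : ℝ)) (b := 1)))
    have heq : {W : Matrix m m ℝ | ∀ i j, W i j ∈ Set.Icc (-1 : ℝ) 1} =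
        Set.univ.pi fun _ : m => Set.univ.pi fun _ : m => Set.Icc (-1 : ℝ) 1 :=
      Set.ext fun W => ⟨fun h i _ j _ => h i j, fun h i j => h i trivial j trivial⟩
    rw [heq]
    exact this
  refine hbox.of_isClosed_subset ?_ ?_
  · have : {W : Matrix m m ℝ | W.PosSemidef ∧ W.trace = 1} =
        {W | Wᵀ = W} ∩ (⋂ v : m → ℝ, {W | 0 ≤ v ⬝ᵥ W *ᵥ v}) ∩ {W | W.trace = 1} := by
      ext W
      simp [posSemidef_iff_dotProduct_mulVec, IsHermitian]
    rw [this]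
    refine ((isClosed_eq (by fun_prop) (by fun_prop)).inter
      (isClosed_iInter fun v => isClosed_le (by fun_prop) ?_)).inter
      (isClosed_eq (by fun_prop) (by fun_prop))
    exact Continuous.dotProduct continuous_const (Continuous.matrix_mulVec continuous_id continuous_const)
  · rintro W ⟨hW, htr⟩ i j
    have hd : ∀ i, 0 ≤ W i i := fun i => hW.diag_nonneg
    have hle : ∀ i, W i i ≤ 1 := fun i => by
      rw [← htr]
      exact Finset.single_le_sum (f := fun i => W i i) (fun i _ => hd i) (Finset.mem_univ i)
    have hs : W j i = W i j := by simpa using hW.1.apply i j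
    have hpm : ∀ t : ℝ, 0 ≤ W i i + t * W i j + t * W j i + t * t * W j j := fun t => by
      have := hW.dotProduct_mulVec_nonneg (Pi.single i 1 + t • Pi.single j 1)
      simp [mulVec_add, mulVec_smul, dotProduct_add, add_dotProduct] at this
      linarith
    have h1 := hpm 1
    have h2 := hpm (-1)
    have := hle i
    have := hle j
    constructor <;> linarith

theorem convex_posSemidef_trace_one (m : Type*) [Fintype m] :
    Convex ℝ {W : Matrix m m ℝ | W.PosSemidef ∧ W.trace = 1} := by
  rintro W ⟨hW, hW1⟩ Z ⟨hZ, hZ1⟩ s t hs ht hst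
  exact ⟨(hW.smul hs).add (hZ.smul ht), by simp [hW1, hZ1, hst]⟩

open scoped MatrixOrder in
theorem Matrix.PosSemidef.exists_eq_mul_transpose {m : Type*} [Fintype m] {W : Matrix m m ℝ}
    (hW : W.PosSemidef) : ∃ V : Matrix m m ℝ, W = V * Vᵀ := by
  classical
  obtain ⟨V, hV⟩ := CStarAlgebra.nonneg_iff_eq_mul_star_self.mp hW.nonneg
  exact ⟨V, by simpa [star_eq_conjTranspose] using hV⟩

/-- Theorem of the alternative for the linear matrix inequality
`Q + Jᵀ P K + Kᵀ P J < 0` in the symmetric unknown `P`. -/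
theorem exists_symm_strict_lmi {n m : Type*} [Fintype n] [Fintype m] [DecidableEq n] [DecidableEq m]
    (J K : Matrix n m ℝ) (Q : Matrix m m ℝ) (e : m) (hKe : K.col e = 0) (hQe : Q e e < 0)
    (hdual : ∀ V : Matrix m m ℝ, (J * V) * (K * V)ᵀ + (K * V) * (J * V)ᵀ = 0 →
      0 ≤ (Vᵀ * Q * V).trace → V = 0) :
    ∃ ε : ℝ, 0 < ε ∧ ∃ P : Matrix n n ℝ, Pᵀ = P ∧
      ∀ v : m → ℝ, v ⬝ᵥ (Q + Jᵀ * P * K + Kᵀ * P * J) *ᵥ v ≤ -ε * (v ⬝ᵥ v) := by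
  let Φ : Matrix m m ℝ →ₗ[ℝ] (n → n → ℝ) × ℝ :=
    { toFun := fun W => (Matrix.of.symm (J * W * Kᵀ + K * W * Jᵀ), (Q * W).trace)
      map_add' := fun W Z => by
        ext <;> simp [Matrix.mul_add, Matrix.add_mul]; ring
      map_smul' := fun c W => by
        ext <;> simp; ring }
  have hΦ : Continuous Φ := by
    refine Continuous.prodMk ?_ ?_
    · change Continuous fun W : Matrix m m ℝ => J * W * Kᵀ + K * W * Jᵀ
      fun_prop
    · fun_prop
  set S := {W : Matrix m m ℝ | W.PosSemidef ∧ W.trace = 1} with hS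
  have hdisj : Disjoint (Φ '' S) ({0} ×ˢ Set.Ici 0) := by
    rw [Set.disjoint_left]
    rintro _ ⟨W, ⟨hW, htr⟩, rfl⟩ ⟨h1, h2⟩
    obtain ⟨V, rfl⟩ := hW.exists_eq_mul_transpose
    have hV : V = 0 := by
      apply hdual
      · have : J * (V * Vᵀ) * Kᵀ + K * (V * Vᵀ) * Jᵀ = 0 := h1
        rw [← this]
        simp only [transpose_mul, Matrix.mul_assoc]
      · have : 0 ≤ (Q * (V * Vᵀ)).trace := h2
        rwa [trace_mul_comm, Matrix.mul_assoc, trace_mul_comm V] at this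
    simp [hV] at htr
  obtain ⟨f, u, v, hfu, huv, hfv⟩ := geometric_hahn_banach_compact_closed
    ((convex_posSemidef_trace_one m).linear_image Φ) ((isCompact_posSemidef_trace_one m).image hΦ)
    ((convex_singleton (0 : n → n → ℝ)).prod (convex_Ici (0 : ℝ)))
    (isClosed_singleton.prod isClosed_Ici) hdisj
  set c := f (0, 1) with hc
  set R : Matrix n n ℝ := Matrix.of fun i j => f (Pi.single i (Pi.single j 1), 0) with hR
  have hf : ∀ L t, f (L, t) = (Rᵀ * Matrix.of L).trace + c * t := by
    intro L t
    have h1 : (L, t) = (∑ i, ∑ j, L i j • ((Pi.single i (Pi.single j 1), 0) :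
        (n → n → ℝ) × ℝ)) + t • ((0, 1) : (n → n → ℝ) × ℝ) := by
      ext
      · simp [Finset.sum_apply, Pi.single_apply, Prod.fst_sum]
      · simp [Prod.snd_sum]
    rw [h1, map_add, map_smul, map_sum]
    simp only [map_sum, map_smul, ← hc]
    simp only [Matrix.trace, Matrix.mul_apply, diag_apply, transpose_apply, hR, of_apply,
      smul_eq_mul]
    rw [Finset.sum_comm]
    simp only [mul_comm]
  have hv : v < 0 := by
    have h0 := hfv (0, 0) (by simp)
    rwa [Prod.mk_zero_zero, map_zero] at h0
  have hu : u < 0 := huv.trans hv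
  have hquad : ∀ x : m → ℝ, c * (x ⬝ᵥ Q *ᵥ x) + x ⬝ᵥ (Kᵀ * Rᵀ * J + Jᵀ * Rᵀ * K) *ᵥ x ≤
      u * (x ⬝ᵥ x) := by
    intro x
    obtain rfl | hx := eq_or_ne x 0
    · simp
    have hpos : 0 < x ⬝ᵥ x := by simpa using dotProduct_star_self_pos_iff.mpr hx
    have h1 := hfu _ ⟨(x ⬝ᵥ x)⁻¹ • vecMulVec x x,
      ⟨(posSemidef_vecMulVec_self_star x).smul (by positivity), by
        rw [trace_smul, trace_vecMulVec, smul_eq_mul, inv_mul_cancel₀ hpos.ne']⟩, rfl⟩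
    rw [map_smul, map_smul, smul_eq_mul, inv_mul_lt_iff₀ hpos] at h1
    have h2 : Φ (vecMulVec x x) =
        (Matrix.of.symm (J * vecMulVec x x * Kᵀ + K * vecMulVec x x * Jᵀ),
          (Q * vecMulVec x x).trace) := rfl
    rw [h2, hf, Equiv.apply_symm_apply, mul_vecMulVec, mul_vecMulVec, mul_vecMulVec,
      vecMulVec_mul, vecMulVec_mul, Matrix.mul_add, mul_vecMulVec, mul_vecMulVec, trace_add,
      trace_vecMulVec, trace_vecMulVec, trace_vecMulVec, vecMul_transpose, vecMul_transpose] at h1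
    have h3 : ∀ L M : Matrix n m ℝ, x ⬝ᵥ (Lᵀ * Rᵀ * M) *ᵥ x = (Rᵀ *ᵥ M *ᵥ x) ⬝ᵥ (L *ᵥ x) := by
      intro L M
      rw [← mulVec_mulVec, ← mulVec_mulVec, dotProduct_mulVec, vecMul_transpose, dotProduct_comm]
    rw [add_mulVec, dotProduct_add, h3, h3, dotProduct_comm x (Q *ᵥ x)]
    linarith
  have hcpos : 0 < c := by
    have := hquad (Pi.single e 1)
    have h0 : K *ᵥ Pi.single e 1 = 0 := by simpa using hKe
    rw [add_mulVec, ← mulVec_mulVec, ← mulVec_mulVec, ← mulVec_mulVec, h0,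
      dotProduct_add, dotProduct_mulVec _ Kᵀ, vecMul_transpose, h0] at this
    simp at this
    nlinarith
  have hflip : ∀ x : m → ℝ, x ⬝ᵥ (Kᵀ * Rᵀ * J + Jᵀ * Rᵀ * K) *ᵥ x =
      x ⬝ᵥ (Kᵀ * R * J + Jᵀ * R * K) *ᵥ x := by
    intro x
    rw [← dotProduct_transpose_mulVec]
    congr 2
    simp [Matrix.mul_assoc, add_comm]
  refine ⟨-u / c, by apply div_pos <;> linarith, (1 / (2 * c) : ℝ) • (R + Rᵀ), ?_, ?_⟩
  · simp [add_comm]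
  · intro x
    have h1 := hquad x
    have h2 := hflip x
    have h3 : x ⬝ᵥ (Q + Jᵀ * ((1 / (2 * c) : ℝ) • (R + Rᵀ)) * K + Kᵀ * ((1 / (2 * c) : ℝ) • (R + Rᵀ)) * J) *ᵥ x
        = x ⬝ᵥ Q *ᵥ x + (1 / (2 * c)) * (x ⬝ᵥ (Kᵀ * Rᵀ * J + Jᵀ * Rᵀ * K) *ᵥ x +
          x ⬝ᵥ (Kᵀ * R * J + Jᵀ * R * K) *ᵥ x) := by
      rw [← dotProduct_add, ← smul_eq_mul (1 / (2 * c)), ← dotProduct_smul, ← add_mulVec, ← smul_mulVec,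
        ← dotProduct_add, ← add_mulVec]
      congr 2
      simp only [Matrix.mul_add, Matrix.add_mul, Matrix.mul_smul, Matrix.smul_mul, smul_add]
      abel
    rw [h3, ← h2]
    have : -(-u / c) * (x ⬝ᵥ x) = (1 / c) * (u * (x ⬝ᵥ x)) := by field_simp
    rw [this]
    calc _ = (1 / c) * (c * (x ⬝ᵥ Q *ᵥ x) + x ⬝ᵥ (Kᵀ * Rᵀ * J + Jᵀ * Rᵀ * K) *ᵥ x) := by
          field_simp; ring
      _ ≤ _ := by gcongr

attribute [local instance] Matrix.linftyOpNormedRing Matrix.linftyOpNormedAlgebra in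
theorem Matrix.tendsto_inv_smul_one_sub_apply {n : Type*} [Fintype n] [DecidableEq n]
    (M : Matrix n n ℂ) (i j : n) :
    Filter.Tendsto (fun z : ℂ => (z • (1 : Matrix n n ℂ) - M)⁻¹ i j) (Bornology.cobounded ℂ)
      (nhds 0) := by
  have h := spectrum.resolvent_tendsto_cobounded (𝕜 := ℂ) M
  have h1 : resolvent M = fun z : ℂ => (z • (1 : Matrix n n ℂ) - M)⁻¹ := by
    ext1 z
    rw [resolvent, ← nonsing_inv_eq_ringInverse, Algebra.algebraMap_eq_smul_one]
  rw [h1] at h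
  have hc : Continuous fun N : Matrix n n ℂ => N i j :=
    (LinearMap.continuous_of_finiteDimensional (Matrix.entryLinearMap ℂ ℂ i j))
  exact (hc.tendsto' 0 0 rfl).comp h

/-- A proper transfer function without poles on a vertical line is bounded on it, and its value at
infinity obeys the same bound. -/
theorem transfer_function_le_iSup {n : Type*} [Fintype n] [DecidableEq n]
    (A : Matrix n n ℂ) (B : Matrix n (Fin 1) ℂ) (C : Matrix (Fin 1) n ℂ) (D c : ℂ)
    (h : ∀ w : ℝ, ((c + w * Complex.I) • (1 : Matrix n n ℂ) - A).det ≠ 0) :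
    (∀ w : ℝ, ‖(C * ((c + w * Complex.I) • (1 : Matrix n n ℂ) - A)⁻¹ * B) 0 0 + D‖ ≤
      ⨆ w : ℝ, ‖(C * ((c + w * Complex.I) • (1 : Matrix n n ℂ) - A)⁻¹ * B) 0 0 + D‖) ∧
    ‖D‖ ≤ ⨆ w : ℝ, ‖(C * ((c + w * Complex.I) • (1 : Matrix n n ℂ) - A)⁻¹ * B) 0 0 + D‖ := by
  set g : ℝ → ℝ := fun w => ‖(C * ((c + w * Complex.I) • (1 : Matrix n n ℂ) - A)⁻¹ * B) 0 0 + D‖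
    with hg
  have hline : Filter.Tendsto (fun w : ℝ => c + w * Complex.I) (Filter.cocompact ℝ)
      (Bornology.cobounded ℂ) := by
    rw [← Metric.cobounded_eq_cocompact, ← tendsto_norm_atTop_iff_cobounded]
    refine Filter.tendsto_atTop_mono (f := fun w : ℝ => ‖w‖ - ‖c‖) (fun w => ?_)
      (Filter.tendsto_atTop_add_const_right _ _ tendsto_norm_cobounded_atTop)
    have := norm_sub_le (c + w * Complex.I) c
    simp at this ⊢
    linarith
  have hlim : Filter.Tendsto g (Filter.cocompact ℝ) (nhds ‖D‖) := by
    have h1 : Filter.Tendsto (fun w : ℝ =>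
        (C * ((c + w * Complex.I) • (1 : Matrix n n ℂ) - A)⁻¹ * B) 0 0) (Filter.cocompact ℝ)
        (nhds 0) := by
      simp only [mul_apply, Finset.sum_mul]
      rw [show (0 : ℂ) = ∑ j : n, ∑ i : n, C 0 i * 0 * B j 0 by simp]
      exact tendsto_finsetSum _ fun j _ => tendsto_finsetSum _ fun i _ =>
        (((A.tendsto_inv_smul_one_sub_apply i j).comp hline).const_mul _).mul_const _
    simpa using (h1.add_const D).norm
  have hcont : Continuous g := by
    have h0 : Continuous fun w : ℝ => (c + w * Complex.I) • (1 : Matrix n n ℂ) - A := by fun_prop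
    have h1 : Continuous fun w : ℝ => ((c + w * Complex.I) • (1 : Matrix n n ℂ) - A)⁻¹ := by
      simp only [Matrix.inv_def, Ring.inverse_eq_inv']
      exact (h0.matrix_det.inv₀ h).smul h0.matrix_adjugate
    exact ((((continuous_const.matrix_mul h1).matrix_mul continuous_const).matrix_elem 0 0).add
      continuous_const).norm
  have hbdd : BddAbove (Set.range g) := by
    have h1 := hlim.eventually (eventually_le_nhds (lt_add_one ‖D‖))
    obtain ⟨K, hK, hK'⟩ := Filter.mem_cocompact.mp h1
    obtain ⟨M, hM⟩ := (hK.image hcont).bddAbove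
    refine ⟨max M (‖D‖ + 1), ?_⟩
    rintro _ ⟨w, rfl⟩
    by_cases hw : w ∈ K
    · exact le_max_of_le_left (hM ⟨w, hw, rfl⟩)
    · exact le_max_of_le_right (hK' hw)
  exact ⟨le_ciSup hbdd, le_of_tendsto' hlim (le_ciSup hbdd)⟩

/-- Shifting a matrix by a scalar shifts the roots of its characteristic polynomial. -/
theorem Matrix.roots_charpoly_add_scalar {n : Type*} [Fintype n] [DecidableEq n]
    (A : Matrix n n ℂ) (c : ℂ) :
    (A + c • (1 : Matrix n n ℂ)).charpoly.roots = A.charpoly.roots.map (· + c) := by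
  have h1 : A + c • (1 : Matrix n n ℂ) = A - scalar n (-c) := by
    rw [map_neg, sub_neg_eq_add, scalar_apply, smul_one_eq_diagonal]
  have h2 := Polynomial.roots_comp_C_mul_X_add_C A.charpoly 1 (-c) isUnit_one
  rw [h1, charpoly_sub_scalar]
  simpa using h2

section ComplexOrder

open scoped ComplexOrder

/-- A positive semidefinite matrix has a Hermitian square root which, together with its
pseudoinverse, satisfies the expected commutation identities. -/
theorem Matrix.PosSemidef.exists_sqrt_pinv {n : Type*} [Fintype n] [DecidableEq n]
    {X : Matrix n n ℂ} (hX : X.PosSemidef) :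
    ∃ R T : Matrix n n ℂ, R.IsHermitian ∧ T.IsHermitian ∧ R * R = X ∧ R * T = T * R ∧
      R * T * R = R := by
  have key : ∀ f g : n → ℝ,
      ((hX.1.eigenvectorUnitary : Matrix n n ℂ) * diagonal (fun i => (f i : ℂ)) *
        star (hX.1.eigenvectorUnitary : Matrix n n ℂ)) *
      ((hX.1.eigenvectorUnitary : Matrix n n ℂ) * diagonal (fun i => (g i : ℂ)) *
        star (hX.1.eigenvectorUnitary : Matrix n n ℂ)) =
      ((hX.1.eigenvectorUnitary : Matrix n n ℂ) * diagonal (fun i => ((f i * g i : ℝ) : ℂ)) *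
        star (hX.1.eigenvectorUnitary : Matrix n n ℂ)) := by
    intro f g
    have h := Unitary.coe_star_mul_self hX.1.eigenvectorUnitary
    set U := (hX.1.eigenvectorUnitary : Matrix n n ℂ)
    calc _ = U * diagonal (fun i => (f i : ℂ)) * (star U * U) * diagonal (fun i => (g i : ℂ)) *
        star U := by simp only [Matrix.mul_assoc]
      _ = _ := by
        rw [h, Matrix.mul_one, Matrix.mul_assoc U, diagonal_mul_diagonal]
        simp
  have herm : ∀ f : n → ℝ,
      ((hX.1.eigenvectorUnitary : Matrix n n ℂ) * diagonal (fun i => (f i : ℂ)) *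
        star (hX.1.eigenvectorUnitary : Matrix n n ℂ)).IsHermitian := by
    intro f
    rw [star_eq_conjTranspose]
    refine isHermitian_mul_mul_conjTranspose _ ?_
    rw [isHermitian_diagonal_iff]
    intro i
    simp [IsSelfAdjoint]
  refine ⟨_, _, herm (fun i => √(hX.1.eigenvalues i)), herm (fun i => (√(hX.1.eigenvalues i))⁻¹),
    ?_, ?_, ?_⟩
  · rw [key]
    conv_rhs => rw [hX.1.spectral_theorem, Unitary.conjStarAlgAut_apply]
    simp [Real.mul_self_sqrt (hX.eigenvalues_nonneg _), Function.comp_def]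
  · simp only [key, mul_comm]
  · simp only [key]
    congr! 5 with i
    exact mul_inv_mul_cancel _

/-- If `A X + X Aᴴ = 0` with `X` positive semidefinite, then `X = V Vᴴ` where the
columns of `V` are eigenvectors of `A` (or zero) for imaginary eigenvalues. -/
theorem Matrix.PosSemidef.exists_factor_imaginary_eigenvectors {n : Type*} [Fintype n]
    [DecidableEq n] {X A : Matrix n n ℂ} (hX : X.PosSemidef) (h : A * X + X * Aᴴ = 0) :
    ∃ (V : Matrix n n ℂ) (w : n → ℝ), X = V * Vᴴ ∧
      A * V = V * diagonal (fun i => (w i : ℂ) * Complex.I) := by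
  obtain ⟨R, T, hR, hT, hRR, hRT, hRTR⟩ := hX.exists_sqrt_pinv
  have h1 : A * X = - (X * Aᴴ) := eq_neg_of_add_eq_zero_left h
  set S := T * (A * X) * T with hS
  have hSH : Sᴴ = -S := by
    have : Xᴴ = X := hX.1
    rw [hS, conjTranspose_mul, conjTranspose_mul, conjTranspose_mul, hT.eq, this, h1]
    simp [Matrix.mul_assoc]
  have hRTX : R * T * X = X := by rw [← hRR, ← Matrix.mul_assoc, hRTR]
  have hRS : R * S = A * R := by
    calc R * S = - (R * T * X) * Aᴴ * T := by rw [hS, h1]; simp [Matrix.mul_assoc]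
      _ = A * X * T := by rw [hRTX, h1]; simp
      _ = A * (R * T * R) := by
        rw [← hRR, Matrix.mul_assoc R T R, ← hRT]; simp [Matrix.mul_assoc]
      _ = A * R := by rw [hRTR]
  have hH : (Complex.I • S).IsHermitian := by
    rw [IsHermitian, conjTranspose_smul, hSH]; simp
  have hU : (hH.eigenvectorUnitary : Matrix n n ℂ) * star (hH.eigenvectorUnitary : Matrix n n ℂ)
      = 1 := Unitary.coe_mul_star_self hH.eigenvectorUnitary
  have hU' := Unitary.coe_star_mul_self hH.eigenvectorUnitary
  have hsp := hH.spectral_theorem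
  rw [Unitary.conjStarAlgAut_apply] at hsp
  set U := (hH.eigenvectorUnitary : Matrix n n ℂ)
  refine ⟨R * U, fun i => - hH.eigenvalues i, ?_, ?_⟩
  · rw [conjTranspose_mul, ← star_eq_conjTranspose U, hR.eq, Matrix.mul_assoc, ← Matrix.mul_assoc U, hU,
      Matrix.one_mul, hRR]
  · have hSU : S * U = U * diagonal (fun i => ((- hH.eigenvalues i : ℝ) : ℂ) * Complex.I) := by
      have : Complex.I • (S * U) = U * diagonal (RCLike.ofReal ∘ hH.eigenvalues) := by
        calc _ = U * diagonal (RCLike.ofReal ∘ hH.eigenvalues) * star U * U := by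
              rw [← hsp, Matrix.smul_mul]
          _ = _ := by rw [Matrix.mul_assoc, hU', Matrix.mul_one]
      have h2 : S * U = (-Complex.I) • (Complex.I • (S * U)) := by
        rw [smul_smul]; simp
      rw [h2, this, ← Matrix.mul_smul, ← diagonal_smul]
      congr 2
      ext i
      simp [mul_comm]
    rw [← Matrix.mul_assoc, ← hRS, Matrix.mul_assoc, hSU, Matrix.mul_assoc]

theorem trace_mul_conjTranspose_fin_one {n : Type*} [Fintype n] (M : Matrix (Fin 1) n ℂ) :
    (M * Mᴴ).trace = ((∑ k, ‖M 0 k‖ ^ 2 : ℝ) : ℂ) := by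
  simp [Matrix.trace, Matrix.mul_apply, Complex.mul_conj, Complex.normSq_eq_norm_sq]

/-- A matrix pair `(G, H)` whose state part is stationary and whose output energy is at least `γ ^ 2`
times its input energy vanishes, if the gain on the imaginary axis is strictly below `γ`. -/
theorem eq_zero_of_frequency_bound {n κ : Type*} [Fintype n] [DecidableEq n] [Fintype κ]
    {A : Matrix n n ℂ} {B : Matrix n (Fin 1) ℂ} {C : Matrix (Fin 1) n ℂ} {D : ℂ} {γ : ℝ}
    (hD : ‖D‖ < γ) (hγ : 0 < γ)
    (hf : ∀ (w : ℝ) (x : n → ℂ) (u : ℂ), (A *ᵥ x + u • B.col 0 = ((w : ℂ) * Complex.I) • x) →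
      ‖(C *ᵥ x) 0 + D * u‖ ≤ γ * ‖u‖ ∧
      (‖(C *ᵥ x) 0 + D * u‖ = γ * ‖u‖ → x = 0))
    {G : Matrix n κ ℂ} {H : Matrix (Fin 1) κ ℂ}
    (hGH : (A * G + B * H) * Gᴴ + G * (A * G + B * H)ᴴ = 0)
    (hq : γ ^ 2 * (H * Hᴴ).trace.re ≤ ((C * G + D • H) * (C * G + D • H)ᴴ).trace.re) :
    G = 0 ∧ H = 0 := by
  have hX : (G * Gᴴ).PosSemidef := posSemidef_self_mul_conjTranspose G
  obtain ⟨K, hK⟩ : ∃ K : Matrix (Fin 1) n ℂ, G * (H - K * G)ᴴ = 0 := by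
    obtain ⟨R, T, hR, hT, hRR, hRT, hRTR⟩ := hX.exists_sqrt_pinv
    have hG : R * T * G = G := by
      have h1 : (R * T - 1) * (G * Gᴴ) = 0 := by
        rw [← hRR, ← Matrix.mul_assoc, Matrix.sub_mul, hRTR]; simp
      rw [mul_self_mul_conjTranspose_eq_zero, Matrix.sub_mul, Matrix.one_mul] at h1
      exact sub_eq_zero.mp h1
    refine ⟨H * Gᴴ * T * T, ?_⟩
    have h2 : G * Gᴴ * T * T * G = G := by
      rw [← hRR]
      calc _ = R * (R * T) * T * G := by simp [Matrix.mul_assoc]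
        _ = R * (T * R) * T * G := by rw [hRT]
        _ = R * T * (R * T * G) := by simp only [Matrix.mul_assoc]
        _ = G := by rw [hG, hG]
    have h3 : G * (H * Gᴴ * T * T * G)ᴴ = G * Gᴴ * T * T * G * Hᴴ := by
      simp [conjTranspose_mul, hT.eq, Matrix.mul_assoc]
    rw [conjTranspose_sub, Matrix.mul_sub, h3, h2, sub_self]
  set E := H - K * G with hE
  have hH : H = K * G + E := by simp [hE]
  have hK' : E * Gᴴ = 0 := by
    have := congrArg conjTranspose hK
    simpa [conjTranspose_mul] using this
  have hlyap : (A + B * K) * (G * Gᴴ) + (G * Gᴴ) * (A + B * K)ᴴ = 0 := by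
    rw [← hGH]
    have h1 : (A * G + B * H) * Gᴴ = (A + B * K) * (G * Gᴴ) := by
      rw [hH]
      calc _ = A * G * Gᴴ + B * K * G * Gᴴ + B * (E * Gᴴ) := by
            simp only [Matrix.add_mul, Matrix.mul_add, Matrix.mul_assoc, add_assoc]
        _ = _ := by
          rw [hK']
          simp only [Matrix.mul_zero, add_zero, Matrix.add_mul, Matrix.mul_assoc]
    have h2 := congrArg conjTranspose h1
    simp only [conjTranspose_mul, conjTranspose_conjTranspose] at h2
    rw [h1, h2]
  obtain ⟨V, w, hV, hAV⟩ := hX.exists_factor_imaginary_eigenvectors hlyap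
  have hcol : ∀ k, A *ᵥ V.col k + (K * V) 0 k • B.col 0 = ((w k : ℂ) * Complex.I) • V.col k := by
    intro k
    ext i
    have := congrFun (congrFun hAV i) k
    rw [mul_diagonal, Matrix.add_mul, Matrix.mul_assoc B] at this
    simp [Matrix.mul_apply, mulVec, dotProduct] at this ⊢
    linear_combination this
  have hC : ∀ k, (C *ᵥ V.col k) 0 + D * (K * V) 0 k = ((C + D • K) * V) 0 k := by
    intro k
    rw [Matrix.add_mul, Matrix.smul_mul]
    simp [Matrix.mul_apply, mulVec, dotProduct]
  have hbd := fun k => hf (w k) (V.col k) ((K * V) 0 k) (hcol k)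
  simp only [hC] at hbd
  have e1 : (H * Hᴴ).trace = ((K * V) * (K * V)ᴴ).trace + (E * Eᴴ).trace := by
    rw [← trace_add]
    congr 1
    calc H * Hᴴ = K * (G * Gᴴ) * Kᴴ + K * (G * Eᴴ) + (E * Gᴴ) * Kᴴ + E * Eᴴ := by
          rw [hH]; simp only [conjTranspose_add, conjTranspose_mul, Matrix.add_mul,
            Matrix.mul_add, Matrix.mul_assoc]
          abel
      _ = _ := by rw [hK, hK', hV]; simp [Matrix.mul_assoc]
  have e2 : ((C * G + D • H) * (C * G + D • H)ᴴ).trace =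
      (((C + D • K) * V) * ((C + D • K) * V)ᴴ).trace + D * star D * (E * Eᴴ).trace := by
    rw [← smul_eq_mul, ← trace_smul, ← trace_add]
    congr 1
    have h1 : C * G + D • H = (C + D • K) * G + D • E := by
      rw [hH]; simp [Matrix.add_mul, add_assoc]
    rw [h1]
    set L := C + D • K
    calc _ = L * (G * Gᴴ) * Lᴴ + star D • (L * (G * Eᴴ)) + D • ((E * Gᴴ) * Lᴴ)
          + (D * star D) • (E * Eᴴ) := by
          simp only [conjTranspose_add, conjTranspose_mul, conjTranspose_smul, Matrix.add_mul,
            Matrix.mul_add, Matrix.smul_mul, Matrix.mul_smul, smul_add, Matrix.mul_assoc]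
          rw [smul_smul, mul_comm (star D) D]
          abel
      _ = _ := by rw [hK, hK', hV]; simp [Matrix.mul_assoc]
  rw [e1, e2, trace_mul_conjTranspose_fin_one, trace_mul_conjTranspose_fin_one,
    trace_mul_conjTranspose_fin_one] at hq
  have hDD : D * star D = ((‖D‖ ^ 2 : ℝ) : ℂ) := by
    rw [← Complex.normSq_eq_norm_sq]; exact Complex.mul_conj D
  rw [hDD, ← Complex.ofReal_add, ← Complex.ofReal_mul, ← Complex.ofReal_add, Complex.ofReal_re,
    Complex.ofReal_re] at hq
  have hle : ∀ k, ‖((C + D • K) * V) 0 k‖ ^ 2 ≤ γ ^ 2 * ‖(K * V) 0 k‖ ^ 2 := fun k => by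
    rw [← mul_pow]; exact pow_le_pow_left₀ (norm_nonneg _) (hbd k).1 2
  have hsum : ∑ k, ‖((C + D • K) * V) 0 k‖ ^ 2 ≤ ∑ k, γ ^ 2 * ‖(K * V) 0 k‖ ^ 2 :=
    Finset.sum_le_sum fun k _ => hle k
  rw [mul_add, Finset.mul_sum] at hq
  have hE0 : 0 ≤ ∑ k, ‖E 0 k‖ ^ 2 := Finset.sum_nonneg fun _ _ => by positivity
  have hDγ : ‖D‖ ^ 2 < γ ^ 2 := pow_lt_pow_left₀ hD (norm_nonneg _) two_ne_zero
  have hEz : ∑ k, ‖E 0 k‖ ^ 2 = 0 := by nlinarith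
  rw [hEz] at hq
  have hEzero : E = 0 := by
    rw [Finset.sum_eq_zero_iff_of_nonneg (fun _ _ => by positivity)] at hEz
    ext i k
    have := hEz k (Finset.mem_univ _)
    rw [Fin.fin_one_eq_zero i]
    simpa using this
  have heq : ∑ k, ‖((C + D • K) * V) 0 k‖ ^ 2 = ∑ k, γ ^ 2 * ‖(K * V) 0 k‖ ^ 2 := by linarith
  rw [Finset.sum_eq_sum_iff_of_le fun k _ => hle k] at heq
  have hV0 : V = 0 := by
    ext i k
    have h1 := heq k (Finset.mem_univ _)
    rw [← mul_pow] at h1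
    have h2 := (pow_left_inj₀ (norm_nonneg _) (by positivity) two_ne_zero).mp h1
    exact congrFun ((hbd k).2 h2) i
  have hG0 : G = 0 := by
    rw [hV0] at hV
    simpa using hV
  exact ⟨hG0, by rw [hH, hEzero, hG0]; simp⟩

/-- If `f` is strictly dissipative for a Hermitian form `h`, then `V` has an `h`-orthogonal basis in
which the sign of `h` is opposite to the sign of the real part of the matching eigenvalue. -/
theorem exists_basis_of_lyapunov (n : ℕ) : ∀ (V : Type u) [AddCommGroup V] [Module ℂ V]
    [FiniteDimensional ℂ V], Module.finrank ℂ V = n → ∀ (f : V →ₗ[ℂ] V) (h : V → V → ℂ),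
    (∀ x y z, h x (y + z) = h x y + h x z) → (∀ x (c : ℂ) y, h x (c • y) = c * h x y) →
    (∀ x y, star (h x y) = h y x) → (∀ x, x ≠ 0 → (h x (f x)).re < 0) →
    ∃ (b : Module.Basis (Fin n) ℂ V) (μ : Fin n → ℂ),
      f.charpoly = ∏ i, (Polynomial.X - Polynomial.C (μ i)) ∧
      (∀ i j, i ≠ j → h (b i) (b j) = 0) ∧ ∀ i, (μ i).re * (h (b i) (b i)).re < 0 := by
  induction n with
  | zero =>
    intro V _ _ _ hV f h _ _ _ _
    refine ⟨Module.finBasisOfFinrankEq ℂ V hV, 0, ?_, fun i => i.elim0, fun i => i.elim0⟩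
    rw [← LinearMap.charpoly_toMatrix f (Module.finBasisOfFinrankEq ℂ V hV)]
    simp
  | succ n ih =>
    intro V _ _ _ hV f h hadd hsmul hconj hneg
    have : Nontrivial V := Module.nontrivial_of_finrank_pos (R := ℂ) (by omega)
    obtain ⟨μ₀, hμ₀⟩ := Module.End.exists_eigenvalue f
    obtain ⟨v, hv⟩ := hμ₀.exists_hasEigenvector
    have hfv : f v = μ₀ • v := hv.apply_eq_smul
    have him : (h v v).im = 0 := Complex.conj_eq_iff_im.mp (hconj v v)
    have hvneg : μ₀.re * (h v v).re < 0 := by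
      have := hneg v hv.2
      rwa [hfv, hsmul, Complex.mul_re, him, mul_zero, sub_zero] at this
    have hvv : h v v ≠ 0 := fun h0 => by simp [h0] at hvneg
    let φ : V →ₗ[ℂ] ℂ := { toFun := h v, map_add' := hadd v, map_smul' := hsmul v }
    have hφ : ∀ x, φ x = h v x := fun _ => rfl
    have hN : Module.finrank ℂ (LinearMap.ker φ) = n := by
      have h1 := φ.finrank_range_add_finrank_ker
      have h2 : LinearMap.range φ = ⊤ := LinearMap.range_eq_top.mpr
        (LinearMap.surjective (f := φ) fun h0 => hvv (by rw [← hφ, h0]; rfl))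
      rw [h2, finrank_top, Module.finrank_self, hV] at h1
      omega
    let f' : LinearMap.ker φ →ₗ[ℂ] LinearMap.ker φ := LinearMap.codRestrict _
      ((LinearMap.id - (h v v)⁻¹ • φ.smulRight v) ∘ₗ f ∘ₗ (LinearMap.ker φ).subtype) (by
        intro x
        change φ (f x - (h v v)⁻¹ • h v (f x) • v) = 0
        rw [map_sub, map_smul, map_smul, hφ, hφ, smul_eq_mul, smul_eq_mul]
        rw [mul_comm (h v (f x)), inv_mul_cancel_left₀ hvv, sub_self])
    have hf' : ∀ x : LinearMap.ker φ, f x = (f' x : V) + ((h v v)⁻¹ * h v (f x)) • v := by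
      intro x
      simp [f', hφ, smul_smul]
    obtain ⟨b', μ, hμ, horth, hsgn⟩ := ih (LinearMap.ker φ) hN f' (fun x y => h x y)
      (fun x y z => hadd _ _ _) (fun x c y => hsmul _ _ _) (fun x y => hconj _ _) (by
        intro x hx
        have h1 := hneg x (by simpa using hx)
        have h2 : h x v = 0 := by rw [← hconj, ← hφ, LinearMap.mem_ker.mp x.2, star_zero]
        rwa [hf', hadd, hsmul, h2, mul_zero, add_zero] at h1)
    let b : Module.Basis (Fin (n + 1)) ℂ V := Module.Basis.mkFinCons v b'
      (by
        intro c x hx hc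
        have := congrArg φ hc
        rw [map_add, map_smul, LinearMap.mem_ker.mp hx, hφ] at this
        simpa [hvv] using this)
      (by
        intro z
        refine ⟨-(h v z / h v v), ?_⟩
        rw [LinearMap.mem_ker, map_add, map_smul, hφ, hφ]
        simp [hvv])
    have hb0 : b 0 = v := by simp [b]
    have hbs : ∀ i : Fin n, b i.succ = b' i := fun i => by simp [b]
    have hrepr : ∀ (x : LinearMap.ker φ) i, b.repr x (Fin.succ i) = b'.repr x i := by
      intro x i
      have h1 : (x : V) = ∑ j, b'.repr x j • b j.succ := by
        conv_lhs => rw [← b'.sum_repr x]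
        simp only [hbs, AddSubmonoidClass.coe_finsetSum, SetLike.val_smul]
      rw [h1, map_sum]
      simp [Finsupp.single_apply]
    refine ⟨b, Fin.cons μ₀ μ, ?_, ?_, ?_⟩
    · rw [← LinearMap.charpoly_toMatrix f b, Matrix.charpoly, det_succ_column_zero,
        Fin.sum_univ_succ, Fin.prod_univ_succ, Finset.sum_eq_zero]
      · have h1 : (charmatrix (LinearMap.toMatrix b b f)).submatrix (Fin.succAbove 0) Fin.succ =
            charmatrix (LinearMap.toMatrix b' b' f') := by
          ext1 i j
          have : LinearMap.toMatrix b b f i.succ j.succ = LinearMap.toMatrix b' b' f' i j := by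
            rw [LinearMap.toMatrix_apply, LinearMap.toMatrix_apply, hbs, hf', map_add, map_smul,
              ← hb0]
            simp [hrepr]
          simp [charmatrix_apply, this, diagonal_apply]
        rw [h1, ← Matrix.charpoly, LinearMap.charpoly_toMatrix, hμ]
        simp [LinearMap.toMatrix_apply, hb0, hfv]
        left
        rw [← hb0]; simp
      · intro i _
        have : LinearMap.toMatrix b b f i.succ 0 = 0 := by
          rw [LinearMap.toMatrix_apply, hb0, hfv, ← hb0]
          simp
        simp [this]
    · have hker : ∀ i, h v (b' i) = 0 := fun i => LinearMap.mem_ker.mp (b' i).2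
      intro i j hij
      refine Fin.cases (fun hij => ?_) (fun i hij => ?_) i hij <;>
      refine Fin.cases (fun hij => ?_) (fun j hij => ?_) j hij
      · exact absurd rfl hij
      · rw [hb0, hbs, hker]
      · rw [hb0, hbs, ← hconj, hker, star_zero]
      · rw [hbs, hbs]
        exact horth i j fun h => hij (by rw [h])
    · intro i
      refine Fin.cases ?_ (fun i => ?_) i
      · simpa [hb0] using hvneg
      · simpa [hbs] using hsgn i

theorem dotProduct_mulVec_map_ofReal_eq_sum {n : Type*} [Fintype n] [DecidableEq n]
    {P : Matrix n n ℝ} (hP : P.IsHermitian) (x : n → ℂ) :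
    star x ⬝ᵥ P.map Complex.ofReal *ᵥ x = ((∑ i, hP.eigenvalues i *
      ‖(((hP.eigenvectorUnitary : Matrix n n ℝ).map Complex.ofReal)ᴴ *ᵥ x) i‖ ^ 2 : ℝ) : ℂ) := by
  have h1 : P.map Complex.ofReal = (hP.eigenvectorUnitary : Matrix n n ℝ).map Complex.ofReal *
      diagonal (fun i => (hP.eigenvalues i : ℂ)) *
      ((hP.eigenvectorUnitary : Matrix n n ℝ).map Complex.ofReal)ᴴ := by
    conv_lhs => rw [hP.spectral_theorem, Unitary.conjStarAlgAut_apply]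
    have hm : ∀ M N : Matrix n n ℝ, (M * N).map Complex.ofReal =
        M.map Complex.ofReal * N.map Complex.ofReal := fun M N =>
      Matrix.map_mul (f := Complex.ofRealHom)
    rw [hm, hm, diagonal_map Complex.ofReal_zero, star_eq_conjTranspose, conjTranspose_map]
    · rfl
    · intro r
      simp
  rw [h1, ← mulVec_mulVec, ← mulVec_mulVec, dotProduct_mulVec]
  set U := (hP.eigenvectorUnitary : Matrix n n ℝ).map Complex.ofReal
  have h2 : star x ᵥ* U = star (Uᴴ *ᵥ x) := by rw [star_mulVec, conjTranspose_conjTranspose]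
  rw [h2]
  simp only [dotProduct, mulVec_diagonal, Pi.star_apply]
  push_cast
  refine Finset.sum_congr rfl fun i _ => ?_
  rw [← Complex.conj_mul', starRingEnd_apply]
  ring

/-- A subspace on which a Hermitian form has a strict sign bounds the number of eigenvalues of
this sign from below. -/
theorem card_le_card_eigenvalues {n : Type*} [Fintype n] [DecidableEq n] {P : Matrix n n ℝ}
    (hP : P.IsHermitian) (s : ℝ) (b : n → n → ℂ) (S : Finset n)
    (horth : ∀ i j, i ≠ j → star (b i) ⬝ᵥ P.map Complex.ofReal *ᵥ b j = 0)
    (hS : ∀ i ∈ S, s * (star (b i) ⬝ᵥ P.map Complex.ofReal *ᵥ b i).re < 0) :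
    S.card ≤ (Finset.univ.filter fun i => s * hP.eigenvalues i < 0).card := by
  set U := ((hP.eigenvectorUnitary : Matrix n n ℝ).map Complex.ofReal)ᴴ with hU
  let T : (S → ℂ) →ₗ[ℂ] ({i // s * hP.eigenvalues i < 0} → ℂ) :=
    LinearMap.funLeft ℂ ℂ Subtype.val ∘ₗ U.mulVecLin ∘ₗ Fintype.linearCombination ℂ (fun j : S => b j)
  have hT : Function.Injective T := by
    rw [← LinearMap.ker_eq_bot, LinearMap.ker_eq_bot']
    intro c hc
    set x : n → ℂ := ∑ j : S, c j • b j with hx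
    have hc' : ∀ i, s * hP.eigenvalues i < 0 → (U *ᵥ x) i = 0 := fun i hi =>
      congrFun hc ⟨i, hi⟩
    have h1 : 0 ≤ s * (star x ⬝ᵥ P.map Complex.ofReal *ᵥ x).re := by
      rw [dotProduct_mulVec_map_ofReal_eq_sum hP, Complex.ofReal_re, Finset.mul_sum]
      refine Finset.sum_nonneg fun i _ => ?_
      by_cases hi : s * hP.eigenvalues i < 0
      · rw [← hU, hc' i hi]; simp
      · rw [← mul_assoc]
        exact mul_nonneg (not_lt.mp hi) (by positivity)
    have h2 : star x ⬝ᵥ P.map Complex.ofReal *ᵥ x =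
        ∑ j : S, ((‖c j‖ ^ 2 : ℝ) : ℂ) * (star (b j) ⬝ᵥ P.map Complex.ofReal *ᵥ b j) := by
      rw [hx, star_sum, sum_dotProduct]
      refine Finset.sum_congr rfl fun i _ => ?_
      rw [mulVec_sum, dotProduct_sum, Finset.sum_eq_single i]
      · rw [mulVec_smul, dotProduct_smul, star_smul, smul_dotProduct, smul_eq_mul, smul_eq_mul,
          ← mul_assoc, ← Complex.normSq_eq_norm_sq]
        congr 1
        exact Complex.mul_conj _
      · intro j _ hij
        rw [mulVec_smul, dotProduct_smul, star_smul, smul_dotProduct,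
          horth i j fun h => hij (Subtype.ext h.symm)]
        simp
      · simp
    rw [h2, Complex.re_sum, Finset.mul_sum] at h1
    have h3 : ∀ j ∈ (Finset.univ : Finset S), s * (((‖c j‖ ^ 2 : ℝ) : ℂ) *
        (star (b j) ⬝ᵥ P.map Complex.ofReal *ᵥ b j)).re ≤ 0 := by
      intro j _
      rw [Complex.re_ofReal_mul]
      nlinarith [hS j j.2, sq_nonneg ‖c j‖]
    have h4 := (Finset.sum_eq_zero_iff_of_nonpos h3).mp (le_antisymm (Finset.sum_nonpos h3) h1)
    ext j
    have h5 := h4 j (Finset.mem_univ j)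
    rw [Complex.re_ofReal_mul, mul_left_comm] at h5
    simpa using (mul_eq_zero.mp h5).resolve_right (hS j j.2).ne
  have := LinearMap.finrank_le_finrank_of_injective hT
  simpa [Fintype.card_subtype] using this

/-- Main inertia theorem (Ostrowski–Schneider): if `Aᵀ P + P A` is negative definite, then the
inertia of `P` is opposite to the inertia of `A` with respect to the imaginary axis. -/
theorem card_eigenvalues_of_lyapunov {n : ℕ} {A P : Matrix (Fin n) (Fin n) ℝ} (hP : P.IsHermitian)
    (hAP : (-((A.map Complex.ofReal)ᴴ * P.map Complex.ofReal +
      P.map Complex.ofReal * A.map Complex.ofReal)).PosDef) :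
    (Finset.univ.filter fun i => hP.eigenvalues i < 0).card =
      ((A.map Complex.ofReal).charpoly.roots.filter fun μ => 0 < μ.re).card ∧
    (Finset.univ.filter fun i => 0 < hP.eigenvalues i).card =
      ((A.map Complex.ofReal).charpoly.roots.filter fun μ => μ.re < 0).card ∧
    ∀ i, hP.eigenvalues i ≠ 0 := by
  set Ac := A.map Complex.ofReal
  set Pc := P.map Complex.ofReal with hPc
  have hPcH : Pcᴴ = Pc := by
    rw [hPc, ← conjTranspose_map, hP.eq]
    intro r
    simp
  have hstar : ∀ x y, star (star x ⬝ᵥ Pc *ᵥ y) = star y ⬝ᵥ Pc *ᵥ x := fun x y => by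
    rw [star_dotProduct, star_star, star_mulVec, hPcH, dotProduct_mulVec]
  obtain ⟨b, μ, hμ, horth, hsgn⟩ := exists_basis_of_lyapunov n (Fin n → ℂ) (by simp) (toLin' Ac)
    (fun x y => star x ⬝ᵥ Pc *ᵥ y) (fun x y z => by rw [mulVec_add, dotProduct_add])
    (fun x c y => by rw [mulVec_smul, dotProduct_smul, smul_eq_mul]) hstar (by
      intro x hx
      have h1 := hAP.re_dotProduct_pos hx
      have h2 : star x ⬝ᵥ (Acᴴ * Pc) *ᵥ x = star (star x ⬝ᵥ Pc *ᵥ (Ac *ᵥ x)) := by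
        rw [hstar, star_mulVec, ← mulVec_mulVec, dotProduct_mulVec]
      rw [neg_mulVec, dotProduct_neg, add_mulVec, dotProduct_add, h2, ← mulVec_mulVec] at h1
      simp at h1 ⊢
      linarith)
  rw [charpoly_toLin'] at hμ
  have hroots : Ac.charpoly.roots = Finset.univ.val.map μ := by
    rw [hμ, Finset.prod_eq_multiset_prod]
    simpa [Multiset.map_map, Function.comp_def] using
      Polynomial.roots_multiset_prod_X_sub_C (Finset.univ.val.map μ)
  have hcount : ∀ (p : ℂ → Prop) [DecidablePred p], (Ac.charpoly.roots.filter p).card =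
      (Finset.univ.filter fun i => p (μ i)).card := by
    intro p _
    rw [hroots, Multiset.filter_map, Multiset.card_map]
    rfl
  rw [hcount, hcount]
  have hneg := card_le_card_eigenvalues hP 1 b (Finset.univ.filter fun i => 0 < (μ i).re) horth
    fun i hi => by
      have := hsgn i
      simp only [Finset.mem_filter, Finset.mem_univ, true_and] at hi
      rw [one_mul]
      exact neg_of_mul_neg_right this hi.le
  have hpos := card_le_card_eigenvalues hP (-1) b (Finset.univ.filter fun i => (μ i).re < 0) horth
    fun i hi => by
      have := hsgn i
      simp only [Finset.mem_filter, Finset.mem_univ, true_and] at hi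
      nlinarith
  simp only [one_mul, neg_one_mul, Left.neg_neg_iff] at hneg hpos
  have hμn : (Finset.univ.filter fun i => 0 < (μ i).re).card +
      (Finset.univ.filter fun i => (μ i).re < 0).card = n := by
    rw [← Finset.card_union_of_disjoint, ← Finset.filter_or, Finset.filter_true_of_mem]
    · simp
    · intro i _
      have h0 : (μ i).re ≠ 0 := fun h0 => by simpa [h0] using hsgn i
      exact h0.lt_or_gt.symm
    · exact Finset.disjoint_filter.mpr fun i _ h1 h2 => lt_asymm h1 h2
  have hun := Finset.card_union_of_disjoint (Finset.disjoint_filter (s := Finset.univ)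
    (p := fun i => hP.eigenvalues i < 0) (q := fun i => 0 < hP.eigenvalues i) |>.mpr
      fun i _ h1 h2 => lt_asymm h1 h2)
  have hle := Finset.card_le_univ ((Finset.univ.filter fun i => hP.eigenvalues i < 0) ∪
    Finset.univ.filter fun i => 0 < hP.eigenvalues i)
  rw [Fintype.card_fin] at hle
  refine ⟨by omega, by omega, fun i => ?_⟩
  have huniv := Finset.eq_univ_of_card ((Finset.univ.filter fun i => hP.eigenvalues i < 0) ∪
    Finset.univ.filter fun i => 0 < hP.eigenvalues i) (by rw [Fintype.card_fin]; omega)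
  have := huniv ▸ Finset.mem_univ i
  rw [← Finset.filter_or] at this
  rcases (Finset.mem_filter.mp this).2 with h | h
  exacts [h.ne, ne_of_gt h]

/-- Harmonic trajectories of a system inherit the gain bound of its transfer function. -/
theorem norm_transfer_le_of_mulVec_eq {n : Type*} [Fintype n] [DecidableEq n]
    {A : Matrix n n ℂ} {B : Matrix n (Fin 1) ℂ} {C : Matrix (Fin 1) n ℂ} {D c : ℂ} {σ γ : ℝ}
    (hσγ : σ < γ) {w : ℝ} (h : ((c + w * Complex.I) • (1 : Matrix n n ℂ) - A).det ≠ 0)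
    (hσ : ‖(C * ((c + w * Complex.I) • (1 : Matrix n n ℂ) - A)⁻¹ * B) 0 0 + D‖ ≤ σ)
    {x : n → ℂ} {u : ℂ}
    (hx : (A - c • (1 : Matrix n n ℂ)) *ᵥ x + u • B.col 0 = ((w : ℂ) * Complex.I) • x) :
    ‖(C *ᵥ x) 0 + D * u‖ ≤ γ * ‖u‖ ∧ (‖(C *ᵥ x) 0 + D * u‖ = γ * ‖u‖ → x = 0) := by
  set R := (c + w * Complex.I) • (1 : Matrix n n ℂ) - A with hR
  have hRx : R *ᵥ x = u • B.col 0 := by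
    rw [sub_mulVec, smul_mulVec, one_mulVec] at hx
    rw [hR, sub_mulVec, smul_mulVec, one_mulVec, add_smul, ← hx]
    abel
  have hxR : x = u • (R⁻¹ *ᵥ B.col 0) := by
    rw [← mulVec_smul, ← hRx, mulVec_mulVec, nonsing_inv_mul _ (isUnit_iff_ne_zero.mpr h),
      one_mulVec]
  have hCx : (C *ᵥ x) 0 + D * u = ((C * R⁻¹ * B) 0 0 + D) * u := by
    have : (C * R⁻¹ * B) 0 0 = (C *ᵥ R⁻¹ *ᵥ B.col 0) 0 := by
      rw [mulVec_mulVec]; rfl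
    rw [this]
    conv_lhs => rw [hxR]
    rw [mulVec_smul, Pi.smul_apply, smul_eq_mul]
    ring
  rw [hCx, norm_mul]
  refine ⟨by gcongr; exact hσ.trans hσγ.le, fun he => ?_⟩
  have hu : u = 0 := by
    by_contra hu
    exact ((hσ.trans_lt hσγ).ne (mul_right_cancel₀ (norm_ne_zero_iff.mpr hu) he))
  rw [hxR, hu, zero_smul]

theorem Matrix.map_ofReal_mul {l m n : Type*} [Fintype m] (M : Matrix l m ℝ) (N : Matrix m n ℝ) :
    (M * N).map Complex.ofReal = M.map Complex.ofReal * N.map Complex.ofReal :=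
  Matrix.map_mul (f := Complex.ofRealHom)

theorem Matrix.conjTranspose_map_ofReal {m n : Type*} (M : Matrix m n ℝ) :
    (M.map Complex.ofReal)ᴴ = Mᵀ.map Complex.ofReal := by
  ext i j
  simp

theorem Matrix.PosDef.map_ofReal {m : Type*} [Fintype m] [DecidableEq m] {M : Matrix m m ℝ}
    (hM : M.PosDef) : (M.map Complex.ofReal).PosDef := by
  obtain ⟨V, rfl⟩ := hM.posSemidef.exists_eq_mul_transpose
  have h1 : ((V * Vᵀ).map Complex.ofReal).PosSemidef := by
    rw [map_ofReal_mul, ← conjTranspose_map_ofReal]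
    exact posSemidef_self_mul_conjTranspose _
  refine h1.posDef_iff_isUnit.mpr ?_
  rw [isUnit_iff_isUnit_det]
  have : ((V * Vᵀ).map Complex.ofReal).det = (((V * Vᵀ).det : ℝ) : ℂ) :=
    (Complex.ofRealHom.map_det _).symm
  rw [this]
  exact isUnit_iff_ne_zero.mpr (Complex.ofReal_ne_zero.mpr hM.det_pos.ne')

end ComplexOrder

theorem Matrix.map_ofReal_add {m n : Type*} (M N : Matrix m n ℝ) :
    (M + N).map Complex.ofReal = M.map Complex.ofReal + N.map Complex.ofReal :=
  Matrix.map_add _ Complex.ofReal_add M N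

/-- Bounded-real lemma: a strict frequency bound on the imaginary axis yields a solution of the
strict bounded-real matrix inequality. -/
theorem exists_strict_bounded_real_lmi {n : Type*} [Fintype n] [DecidableEq n]
    {A : Matrix n n ℝ} {B : Matrix n (Fin 1) ℝ} {C : Matrix (Fin 1) n ℝ} {D γ : ℝ}
    (hD : |D| < γ)
    (hf : ∀ (w : ℝ) (x : n → ℂ) (u : ℂ), (A.map Complex.ofReal *ᵥ x +
        u • (B.map Complex.ofReal).col 0 = ((w : ℂ) * Complex.I) • x) →
      ‖(C.map Complex.ofReal *ᵥ x) 0 + (D : ℂ) * u‖ ≤ γ * ‖u‖ ∧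
      (‖(C.map Complex.ofReal *ᵥ x) 0 + (D : ℂ) * u‖ = γ * ‖u‖ → x = 0)) :
    ∃ ε : ℝ, 0 < ε ∧ ∃ P : Matrix n n ℝ, P.IsHermitian ∧
      (-fromBlocks (Aᵀ * P + P * A + Cᵀ * C) (P * B + D • Cᵀ) (Bᵀ * P + D • C)
        ((D ^ 2 - γ ^ 2) • (1 : Matrix (Fin 1) (Fin 1) ℝ)) -
        ε • (1 : Matrix (n ⊕ Fin 1) (n ⊕ Fin 1) ℝ)).PosSemidef := by
  have hγ : 0 < γ := (abs_nonneg D).trans_lt hD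
  obtain ⟨ε, hε, P, hP, hv⟩ := exists_symm_strict_lmi (fromCols A B)
    (fromCols (1 : Matrix n n ℝ) (0 : Matrix n (Fin 1) ℝ))
    (fromBlocks (Cᵀ * C) (D • Cᵀ) (D • C) ((D ^ 2 - γ ^ 2) • (1 : Matrix (Fin 1) (Fin 1) ℝ)))
    (Sum.inr 0) (by ext i; simp) (by
      have := sq_lt_sq' (neg_lt_of_abs_lt hD) (lt_of_abs_lt hD)
      simpa using this) (by
      intro V h1 h2
      obtain ⟨G, H, rfl⟩ : ∃ G H, V = fromRows G H := ⟨_, _, (fromRows_toRows V).symm⟩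
      simp only [fromCols_mul_fromRows, Matrix.one_mul, Matrix.zero_mul, add_zero] at h1
      have h3 : ((fromRows G H)ᵀ * fromBlocks (Cᵀ * C) (D • Cᵀ) (D • C)
          ((D ^ 2 - γ ^ 2) • (1 : Matrix (Fin 1) (Fin 1) ℝ)) * fromRows G H).trace =
          ((C * G + D • H) * (C * G + D • H)ᵀ).trace - γ ^ 2 * (H * Hᵀ).trace := by
        rw [trace_mul_comm (C * G + D • H), trace_mul_comm H, transpose_fromRows,
          Matrix.mul_assoc, fromBlocks_mul_fromRows, fromCols_mul_fromRows, ← smul_eq_mul,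
          ← trace_smul, ← trace_sub]
        congr 1
        simp only [transpose_add, transpose_mul, transpose_smul, Matrix.mul_add, Matrix.add_mul,
          Matrix.mul_assoc, Matrix.smul_mul, Matrix.mul_smul, Matrix.one_mul, sub_smul, sq,
          smul_smul, smul_add, Matrix.sub_mul, Matrix.mul_sub]
        abel
      rw [h3, sub_nonneg] at h2
      have htr : ∀ M : Matrix (Fin 1) (n ⊕ Fin 1) ℝ,
          (M.map Complex.ofReal * (M.map Complex.ofReal)ᴴ).trace.re = (M * Mᵀ).trace := by
        intro M
        rw [conjTranspose_map_ofReal, ← map_ofReal_mul]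
        simp [Matrix.trace]
      have hz := eq_zero_of_frequency_bound (D := (D : ℂ)) (by simpa using hD) hγ hf
        (G := G.map Complex.ofReal) (H := H.map Complex.ofReal) (by
          rw [← map_ofReal_mul, ← map_ofReal_mul, ← map_ofReal_add, conjTranspose_map_ofReal,
            conjTranspose_map_ofReal, ← map_ofReal_mul, ← map_ofReal_mul, ← map_ofReal_add, h1]
          ext
          simp) (by
          have h5 : C.map Complex.ofReal * G.map Complex.ofReal + (D : ℂ) • H.map Complex.ofReal =
              (C * G + D • H).map Complex.ofReal := by
            rw [map_ofReal_add, map_ofReal_mul]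
            congr 1
            ext
            simp
          rw [h5, htr, htr]
          exact h2)
      have h6 : G = 0 := by
        ext i j
        simpa using congrFun (congrFun hz.1 i) j
      have h7 : H = 0 := by
        ext i j
        simpa using congrFun (congrFun hz.2 i) j
      rw [h6, h7, fromRows_zero])
  refine ⟨ε, hε, P, by simpa [IsHermitian, conjTranspose_eq_transpose_of_trivial] using hP, ?_⟩
  have hQ : fromBlocks (Cᵀ * C) (D • Cᵀ) (D • C)
        ((D ^ 2 - γ ^ 2) • (1 : Matrix (Fin 1) (Fin 1) ℝ)) +
      (fromCols A B)ᵀ * P * fromCols (1 : Matrix n n ℝ) (0 : Matrix n (Fin 1) ℝ) +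
      (fromCols (1 : Matrix n n ℝ) (0 : Matrix n (Fin 1) ℝ))ᵀ * P * fromCols A B =
      fromBlocks (Aᵀ * P + P * A + Cᵀ * C) (P * B + D • Cᵀ) (Bᵀ * P + D • C)
        ((D ^ 2 - γ ^ 2) • (1 : Matrix (Fin 1) (Fin 1) ℝ)) := by
    rw [transpose_fromCols, transpose_fromCols, fromRows_mul, fromRows_mul_fromCols,
      fromRows_mul, fromRows_mul_fromCols, fromBlocks_add, fromBlocks_add]
    simp only [transpose_one, transpose_zero, Matrix.one_mul, Matrix.mul_one, Matrix.mul_zero,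
      Matrix.zero_mul, add_zero]
    congr 1 <;> abel
  rw [hQ] at hv
  refine posSemidef_iff_dotProduct_mulVec.mpr ⟨?_, fun v => ?_⟩
  · rw [IsHermitian, conjTranspose_eq_transpose_of_trivial]
    simp only [transpose_sub, transpose_neg, fromBlocks_transpose, transpose_smul, transpose_one,
      transpose_add, transpose_mul, transpose_transpose, hP]
    rw [add_comm (P * A)]
  · have := hv v
    rw [star_trivial, sub_mulVec, neg_mulVec, dotProduct_sub, dotProduct_neg, smul_mulVec,
      one_mulVec, dotProduct_smul, smul_eq_mul]
    linarith

/-- Converse KYP-type direction (bounded-real lemma for `p`-dominant systems,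
underlying Theorem 10 of the paper): a strict frequency-domain bound on the line
`Re s = -λ` together with the eigenvalue split of `A` implies feasibility of the
LMI (20) with a symmetric `P` of inertia `(p, 0, n-p)`. -/
theorem frequency_bound_implies_lmi (n p : ℕ)
    (A : Matrix (Fin n) (Fin n) ℝ) (B : Matrix (Fin n) (Fin 1) ℝ)
    (C : Matrix (Fin 1) (Fin n) ℝ) (D : ℝ) (lam γ : ℝ) (hγ : 0 < γ)
    (hsplit₁ : ((A.map (Complex.ofReal)).charpoly.roots.filter
        fun μ => -lam < μ.re).card = p)
    (hsplit₂ : ((A.map (Complex.ofReal)).charpoly.roots.filter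
        fun μ => μ.re < -lam).card = n - p)
    (hsplit₃ : ∀ μ ∈ (A.map (Complex.ofReal)).charpoly.roots, μ.re ≠ -lam)
    (hfreq : (⨆ ω : ℝ, ‖(C.map (Complex.ofReal) *
        (((-lam : ℂ) + ω * Complex.I) • (1 : Matrix (Fin n) (Fin n) ℂ) -
          A.map (Complex.ofReal))⁻¹ *
        B.map (Complex.ofReal)) 0 0 + (D : ℂ)‖) < γ) :
    ∃ ε : ℝ, 0 < ε ∧ ∃ P : Matrix (Fin n) (Fin n) ℝ, ∃ hP : P.IsHermitian,
      (Finset.univ.filter fun i => hP.eigenvalues i < 0).card = p ∧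
      (Finset.univ.filter fun i => 0 < hP.eigenvalues i).card = n - p ∧
      (∀ i, hP.eigenvalues i ≠ 0) ∧
      (-(Matrix.fromBlocks
          (Aᵀ * P + P * A + (2 * lam) • P + ε • (1 : Matrix (Fin n) (Fin n) ℝ) + Cᵀ * C)
          (P * B + D • Cᵀ)
          (Bᵀ * P + D • C)
          ((D ^ 2 - γ ^ 2) • (1 : Matrix (Fin 1) (Fin 1) ℝ)))).PosSemidef := by
  set Ac := A.map Complex.ofReal with hAc
  have hdet : ∀ w : ℝ,
      (((-lam : ℂ) + w * Complex.I) • (1 : Matrix (Fin n) (Fin n) ℂ) - Ac).det ≠ 0 := by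
    intro w h0
    refine hsplit₃ ((-lam : ℂ) + w * Complex.I) ?_ (by simp)
    rw [Polynomial.mem_roots Ac.charpoly_monic.ne_zero, Polynomial.IsRoot, eval_charpoly,
      scalar_apply, ← smul_one_eq_diagonal, h0]
  obtain ⟨hg, hD⟩ := transfer_function_le_iSup Ac (B.map Complex.ofReal) (C.map Complex.ofReal)
    (D : ℂ) (-lam : ℂ) hdet
  set a := A + lam • (1 : Matrix (Fin n) (Fin n) ℝ) with ha
  have hac : a.map Complex.ofReal = Ac + (lam : ℂ) • (1 : Matrix (Fin n) (Fin n) ℂ) := by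
    ext i j
    by_cases hij : i = j <;> simp [ha, hAc, hij]
  obtain ⟨ε, hε, P, hP, hLMI⟩ := exists_strict_bounded_real_lmi (A := a) (B := B) (C := C)
    (D := D) (γ := γ) (by simpa using hD.trans_lt hfreq) (by
      intro w x u hx
      refine norm_transfer_le_of_mulVec_eq hfreq (hdet w) (hg w) (B := B.map Complex.ofReal) ?_
      rwa [neg_smul, sub_neg_eq_add, ← hac])
  have haP : aᵀ * P + P * a = Aᵀ * P + P * A + (2 * lam) • P := by
    simp only [ha, transpose_add, transpose_smul, transpose_one, Matrix.add_mul, Matrix.mul_add,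
      Matrix.smul_mul, Matrix.mul_smul, Matrix.one_mul, Matrix.mul_one, two_mul, add_smul]
    abel
  have hlyap : (-(aᵀ * P + P * a)).PosDef := by
    have h1 := ((PosDef.one (n := Fin n) (R := ℝ)).smul hε).add_posSemidef
      ((hLMI.submatrix Sum.inl).add (posSemidef_conjTranspose_mul_self C))
    convert h1 using 1
    ext i j
    simp [one_apply]
    ring
  obtain ⟨hneg, hpos, hne⟩ := card_eigenvalues_of_lyapunov (A := a) hP (by
    have := hlyap.map_ofReal
    rw [conjTranspose_map_ofReal, ← map_ofReal_mul, ← map_ofReal_mul]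
    convert this using 1
    ext i j
    simp)
  rw [hac, roots_charpoly_add_scalar, Multiset.filter_map, Multiset.card_map] at hneg hpos
  refine ⟨ε, hε, P, hP, ?_, ?_, hne, ?_⟩
  · rw [hneg, ← hsplit₁]
    congr 2
    ext μ
    simp [neg_lt_iff_pos_add]
  · rw [hpos, ← hsplit₂]
    congr 2
    ext μ
    simp [lt_neg_iff_add_neg]
  · have h1 : (fromBlocks 0 0 0 (ε • (1 : Matrix (Fin 1) (Fin 1) ℝ)) :
        Matrix (Fin n ⊕ Fin 1) (Fin n ⊕ Fin 1) ℝ).PosSemidef := by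
      refine posSemidef_iff_dotProduct_mulVec.mpr ⟨?_, fun v => ?_⟩
      · rw [IsHermitian, conjTranspose_eq_transpose_of_trivial, fromBlocks_transpose]
        simp
      · rw [← Sum.elim_comp_inl_inr v, fromBlocks_mulVec]
        simp only [smul_mulVec, one_mulVec, zero_mulVec, zero_add, add_zero, star_trivial,
          sumElim_dotProduct_sumElim, dotProduct_zero, dotProduct_smul, smul_eq_mul]
        exact mul_nonneg hε.le (dotProduct_self_star_nonneg (v ∘ Sum.inr))
    convert hLMI.add h1 using 1
    rw [← haP, ← fromBlocks_one]
    simp only [fromBlocks_neg, fromBlocks_smul, sub_eq_add_neg, fromBlocks_add, smul_zero, neg_zero,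
      add_zero]
    congr 1 <;> abel
end

section
/- Let λ̲ < λ̄ be real numbers and let A ∈ ℝ^{n×n}, B ∈ ℝ^{n×1}, C ∈ ℝ^{1×n}, D ∈ ℝ. Assume exactly p eigenvalues of A (with algebraic multiplicity) satisfy Re(μ) > -λ̲ and the remaining n - p eigenvalues satisfy Re(μ) < -λ̄ (so A has no eigenvalue in the closed strip -λ̄ ≤ Re(μ) ≤ -λ̲). For each λ ∈ (λ̲, λ̄) let γ_λ be the infimum of all γ > 0 for which there exist ε ≥ 0 and a symmetric P ∈ ℝ^{n×n} with exactly p negative eigenvalues, n - p positive eigenvalues and no zero eigenvalue, such that [[AᵀP + PA + 2λP + εI + CᵀC , PB + CᵀD],[BᵀP + DC , D² - γ²]] is negative semidefinite. Then sup_{λ∈(λ̲,λ̄)} γ_λ = sup_{s∈S} |C(sI - A)^{-1}B + D|, where S = {s ∈ ℂ : -λ̄ < Re(s) < -λ̲}. -/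
open Matrix

/-- The open vertical strip `{s : ℂ | -λ̄ < Re s < -λ̲}`. -/
def strip (llo lhi : ℝ) : Set ℂ := {s : ℂ | -lhi < s.re ∧ s.re < -llo}

/-- The differential `L_{2,p}`-gain `γ_λ` with rate `λ`, characterized by the LMI (20)
of the paper: the infimum of all `γ > 0` for which the LMI is feasible with a
symmetric `P` of inertia `(p, 0, n-p)`. -/
noncomputable def gainRate (n p : ℕ)
    (A : Matrix (Fin n) (Fin n) ℝ) (B : Matrix (Fin n) (Fin 1) ℝ)
    (C : Matrix (Fin 1) (Fin n) ℝ) (D : ℝ) (lam : ℝ) : ℝ :=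
  sInf {γ : ℝ | 0 < γ ∧ ∃ ε : ℝ, 0 ≤ ε ∧ ∃ P : Matrix (Fin n) (Fin n) ℝ,
    ∃ hP : P.IsHermitian,
      (Finset.univ.filter fun i => hP.eigenvalues i < 0).card = p ∧
      (Finset.univ.filter fun i => 0 < hP.eigenvalues i).card = n - p ∧
      (∀ i, hP.eigenvalues i ≠ 0) ∧
      (-(Matrix.fromBlocks
          (Aᵀ * P + P * A + (2 * lam) • P + ε • (1 : Matrix (Fin n) (Fin n) ℝ) + Cᵀ * C)
          (P * B + D • Cᵀ)
          (Bᵀ * P + D • C)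
          ((D ^ 2 - γ ^ 2) • (1 : Matrix (Fin 1) (Fin 1) ℝ)))).PosSemidef}

theorem exists_orthonormalBasis_linearIsometry {V : Type*} [NormedAddCommGroup V]
    [InnerProductSpace ℂ V] [FiniteDimensional ℂ V] (U : V →ₗᵢ[ℂ] V) :
    ∃ b : OrthonormalBasis (Fin (Module.finrank ℂ V)) ℂ V,
      ∀ i, ∃ e : ℂ, ‖e‖ = 1 ∧ U (b i) = e • b i := by
  obtain ⟨c, hz1, hz⟩ : ∃ c : ℂ, ‖c‖ = 1 ∧ ¬ Module.End.HasEigenvalue U.toLinearMap c := by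
    by_contra! h
    have hfin := Module.End.finite_hasEigenvalue U.toLinearMap
    have hinf : (Metric.sphere (0 : ℂ) 1).Infinite := by
      refine (isPreconnected_sphere
        (by simp [Complex.rank_real_complex]) 0 1).infinite_of_nontrivial
        ⟨1, by simp, -1, by simp, fun h => ?_⟩
      simpa using congrArg Complex.re (eq_neg_iff_add_eq_zero.1 h)
    refine hinf (hfin.subset fun z hz => h z (by simpa using hz))
  let R : V →ₗ[ℂ] V := c • LinearMap.id - U.toLinearMap
  have hR : ∀ x, R x = c • x - U x := fun x => rfl
  have hinj : Function.Injective R := by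
    rw [← LinearMap.ker_eq_bot, LinearMap.ker_eq_bot']
    intro x hx
    by_contra hx0
    exact hz (Module.End.hasEigenvalue_of_hasEigenvector
      (Module.End.hasEigenvector_iff.2 ⟨Module.End.mem_eigenspace_iff.2
        (sub_eq_zero.1 ((hR x).symm.trans hx)).symm, hx0⟩))
  let E : V ≃ₗ[ℂ] V := LinearEquiv.ofInjectiveEndo R hinj
  have hE : ∀ x, E x = c • x - U x := fun x => rfl
  let H : V →ₗ[ℂ] V := (Complex.I • (c • LinearMap.id + U.toLinearMap)) ∘ₗ E.symm.toLinearMap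
  have hH : ∀ x, H (E x) = Complex.I • (c • x + U x) := fun x => by simp [H]
  have hc : (starRingEnd ℂ) c * c = 1 := by
    rw [mul_comm, Complex.mul_conj, Complex.normSq_eq_norm_sq, hz1]; simp
  have hsym : H.IsSymmetric := by
    intro x y
    obtain ⟨a, rfl⟩ := E.surjective x
    obtain ⟨b, rfl⟩ := E.surjective y
    rw [hH, hH, hE, hE]
    simp only [inner_sub_left, inner_sub_right, inner_add_left, inner_add_right, inner_smul_left,
      inner_smul_right, LinearIsometry.inner_map_map, Complex.conj_I]
    linear_combination (-2 * Complex.I * inner ℂ a b) * hc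
  refine ⟨hsym.eigenvectorBasis rfl, fun i => ?_⟩
  have h1 := hsym.apply_eigenvectorBasis rfl i
  have hn : ‖hsym.eigenvectorBasis rfl i‖ = 1 := (hsym.eigenvectorBasis rfl).norm_eq_one i
  suffices ∃ e : ℂ, U (hsym.eigenvectorBasis rfl i) = e • hsym.eigenvectorBasis rfl i by
    obtain ⟨e, he⟩ := this
    refine ⟨e, ?_, he⟩
    simpa [norm_smul, hn] using (congrArg norm he).symm
  set μ := hsym.eigenvalues rfl i
  obtain ⟨a, ha⟩ := E.surjective (hsym.eigenvectorBasis rfl i)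
  rw [← ha] at h1 ⊢
  rw [hH, hE] at h1
  have hμ : ((μ : ℂ) + Complex.I) ≠ 0 := by
    intro h
    simpa using congrArg Complex.im h
  obtain ⟨e, he⟩ : ∃ e : ℂ, U a = e • a := by
    refine ⟨((μ : ℂ) + Complex.I)⁻¹ * ((μ - Complex.I) * c), ?_⟩
    have : ((μ : ℂ) + Complex.I) • U a = ((μ - Complex.I) * c) • a := by
      have h1' : Complex.I • (c • a + U a) = (μ : ℂ) • (c • a - U a) := h1
      rw [← sub_eq_zero] at h1' ⊢
      rw [← h1']
      module
    rw [mul_smul, ← this, smul_smul, inv_mul_cancel₀ hμ, one_smul]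
  refine ⟨e, ?_⟩
  rw [hE, map_sub, map_smul, he, map_smul, he]
  module

theorem exists_orthonormalBasis_of_skew {ι κ : Type*} [Fintype ι] [Fintype κ]
    (N J : Matrix ι κ ℝ) (h : N * Jᵀ + J * Nᵀ = 0) :
    ∃ (r : ℕ) (b : OrthonormalBasis (Fin r) ℂ (EuclideanSpace ℂ κ)), ∀ k,
      (J.map Complex.ofReal *ᵥ (b k).ofLp = 0) ∨
        ∃ ω : ℝ, N.map Complex.ofReal *ᵥ (b k).ofLp =
          (Complex.I * ω) • (J.map Complex.ofReal *ᵥ (b k).ofLp) := by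
  classical
  let S (M : Matrix ι κ ℝ) : (ι → ℂ) →ₗ[ℂ] EuclideanSpace ℂ κ :=
    (WithLp.linearEquiv 2 ℂ (κ → ℂ)).symm.toLinearMap ∘ₗ ((M.map Complex.ofReal)ᵀ).mulVecLin
  have hS : ∀ M a, S M a = WithLp.toLp 2 ((M.map Complex.ofReal)ᵀ *ᵥ a) := fun M a => rfl
  have hinner : ∀ (M : Matrix ι κ ℝ) (v : EuclideanSpace ℂ κ) a,
      inner ℂ v (S M a) = a ⬝ᵥ star (M.map Complex.ofReal *ᵥ v.ofLp) := by
    intro M v a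
    have : star (M.map Complex.ofReal *ᵥ v.ofLp) = M.map Complex.ofReal *ᵥ star v.ofLp := by
      ext i
      simp [Matrix.mulVec, dotProduct]
    rw [this, hS, EuclideanSpace.inner_eq_star_dotProduct, Matrix.mulVec_transpose,
      ← Matrix.dotProduct_mulVec]
  have hMM : (N + J) * (N + J)ᵀ = (N - J) * (N - J)ᵀ := by
    rw [← sub_eq_zero, ← smul_zero (2 : ℝ), ← h]
    simp only [transpose_add, transpose_sub, Matrix.mul_add, Matrix.add_mul, Matrix.mul_sub,
      Matrix.sub_mul]
    module
  have hself : ∀ (M : Matrix ι κ ℝ) a, (‖S M a‖ : ℂ) ^ 2 =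
      a ⬝ᵥ star ((M * Mᵀ).map Complex.ofReal *ᵥ a) := by
    intro M a
    have := inner_self_eq_norm_sq_to_K (𝕜 := ℂ) (S M a)
    rw [hinner] at this
    refine (this.symm.trans ?_)
    have h2 : (M * Mᵀ).map Complex.ofReal = M.map Complex.ofReal * (M.map Complex.ofReal)ᵀ := by
      rw [← Matrix.transpose_map]
      exact Matrix.map_mul (f := Complex.ofRealHom)
    rw [h2, ← Matrix.mulVec_mulVec, hS]
  have hnorm : ∀ a, ‖S (N - J) a‖ = ‖S (N + J) a‖ := by
    intro a
    have := (hself (N - J) a).trans ((congrArg (fun M : Matrix ι ι ℝ =>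
      a ⬝ᵥ star (M.map Complex.ofReal *ᵥ a)) hMM.symm).trans (hself (N + J) a).symm)
    exact (sq_eq_sq₀ (norm_nonneg _) (norm_nonneg _)).1 (by exact_mod_cast this)
  obtain ⟨U, hU⟩ : ∃ U : EuclideanSpace ℂ κ →ₗᵢ[ℂ] EuclideanSpace ℂ κ,
      ∀ a, U (S (N + J) a) = S (N - J) a := by
    have hker : LinearMap.ker (S (N + J)) ≤ LinearMap.ker (S (N - J)) := by
      intro a ha
      rw [LinearMap.mem_ker] at ha ⊢
      rw [← norm_eq_zero, hnorm, ha, norm_zero]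
    let L₀ : LinearMap.range (S (N + J)) →ₗ[ℂ] EuclideanSpace ℂ κ :=
      ((LinearMap.ker (S (N + J))).liftQ _ hker) ∘ₗ (S (N + J)).quotKerEquivRange.symm.toLinearMap
    have hL₀ : ∀ a, L₀ ⟨S (N + J) a, LinearMap.mem_range_self _ a⟩ = S (N - J) a := by
      intro a
      have : (S (N + J)).quotKerEquivRange.symm ⟨S (N + J) a, LinearMap.mem_range_self _ a⟩ =
          (LinearMap.ker (S (N + J))).mkQ a := by
        rw [LinearEquiv.symm_apply_eq]; rfl
      simp [L₀, this]
    let L : LinearMap.range (S (N + J)) →ₗᵢ[ℂ] EuclideanSpace ℂ κ := ⟨L₀, by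
      rintro ⟨_, a, rfl⟩
      rw [hL₀, hnorm]; rfl⟩
    exact ⟨L.extend, fun a =>
      (L.extend_apply ⟨S (N + J) a, LinearMap.mem_range_self _ a⟩).trans (hL₀ a)⟩
  obtain ⟨b, hb⟩ := exists_orthonormalBasis_linearIsometry U
  refine ⟨_, b, fun k => ?_⟩
  obtain ⟨e, he, hbk⟩ := hb k
  have hee : e * (starRingEnd ℂ) e = 1 := by
    rw [Complex.mul_conj, Complex.normSq_eq_norm_sq, he]; simp
  have key : (N - J).map Complex.ofReal *ᵥ (b k).ofLp =
      (starRingEnd ℂ) e • ((N + J).map Complex.ofReal *ᵥ (b k).ofLp) := by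
    have h1 : ∀ a, inner ℂ (b k) (S (N - J) a) = e * inner ℂ (b k) (S (N + J) a) := by
      intro a
      have h2 := U.inner_map_map (b k) (S (N + J) a)
      rw [hbk, hU, inner_smul_left] at h2
      rw [← h2, ← mul_assoc, hee, one_mul]
    ext i
    have h2 := h1 (Pi.single i 1)
    rw [hinner, hinner, single_one_dotProduct, single_one_dotProduct] at h2
    simpa using congrArg (starRingEnd ℂ) h2
  have hsub : (N - J).map Complex.ofReal = N.map Complex.ofReal - J.map Complex.ofReal := by
    ext; simp
  have hadd : (N + J).map Complex.ofReal = N.map Complex.ofReal + J.map Complex.ofReal := by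
    ext; simp
  rw [hsub, hadd, Matrix.sub_mulVec, Matrix.add_mulVec] at key
  generalize N.map Complex.ofReal *ᵥ (b k).ofLp = f at key ⊢
  generalize J.map Complex.ofReal *ᵥ (b k).ofLp = x at key ⊢
  set d := (starRingEnd ℂ) e
  by_cases hd : d = 1
  · left
    rw [hd, one_smul] at key
    have : (2 : ℂ) • x = 0 := by
      rw [two_smul]
      have := sub_eq_zero.2 key
      rw [← neg_eq_zero, ← this]; abel
    simpa using this
  · right
    have hd' : 1 - d ≠ 0 := sub_ne_zero.2 (Ne.symm hd)
    have hdd : d * (starRingEnd ℂ) d = 1 := by simpa [d, mul_comm] using hee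
    have hd'' : 1 - (starRingEnd ℂ) d ≠ 0 := by
      simpa using (map_ne_zero (starRingEnd ℂ)).2 hd'
    obtain ⟨ω, hω⟩ : ∃ ω : ℝ, (ω : ℂ) = -Complex.I * ((1 + d) / (1 - d)) := by
      apply Complex.conj_eq_iff_real.1 _ |>.imp fun _ h => h.symm
      simp only [map_mul, map_neg, Complex.conj_I, map_div₀, map_add, map_sub, map_one, neg_neg]
      rw [mul_div_assoc', mul_div_assoc', div_eq_div_iff hd'' hd']
      linear_combination (-2 * Complex.I) * hdd
    refine ⟨ω, ?_⟩
    rw [hω, neg_mul, mul_neg, ← mul_assoc, Complex.I_mul_I, neg_mul, one_mul, neg_neg]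
    have : (1 - d) • f = (1 + d) • x := by
      rw [← sub_eq_zero] at key ⊢
      rw [← key]; module
    rw [div_eq_inv_mul, mul_smul, ← this, smul_smul, inv_mul_cancel₀ hd', one_smul]
open scoped MatrixOrder in
theorem Matrix.PosSemidef.exists_eq_conjTranspose_mul_self {κ : Type*} [Fintype κ]
    [DecidableEq κ] {W : Matrix κ κ ℝ} (hW : W.PosSemidef) : ∃ M : Matrix κ κ ℝ, W = Mᴴ * M := by
  obtain ⟨M, hM⟩ := CStarAlgebra.nonneg_iff_eq_star_mul_self.mp hW.nonneg
  exact ⟨M, hM⟩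

theorem isCompact_setOf_posSemidef_trace_eq_one (κ : Type*) [Fintype κ] [DecidableEq κ] :
    IsCompact {W : Matrix κ κ ℝ | W.PosSemidef ∧ W.trace = 1} := by
  have hK : IsCompact {H : Matrix κ κ ℝ | ∑ i, ∑ j, H i j ^ 2 = 1} := by
    refine (isCompact_univ_pi fun i : κ => isCompact_univ_pi fun j : κ =>
      isCompact_Icc (a := (-1 : ℝ)) (b := 1)).of_isClosed_subset ?_ ?_
    · refine isClosed_eq ?_ continuous_const
      fun_prop
    · intro H (hH : ∑ i, ∑ j, H i j ^ 2 = 1)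
      refine Set.mem_univ_pi.2 fun i => Set.mem_univ_pi.2 fun j => ?_
      rw [Set.mem_Icc, ← abs_le, ← sq_le_one_iff_abs_le_one, ← hH]
      calc H i j ^ 2 ≤ ∑ j, H i j ^ 2 :=
            Finset.single_le_sum (f := fun j => H i j ^ 2) (fun _ _ => sq_nonneg _)
              (Finset.mem_univ j)
        _ ≤ _ := Finset.single_le_sum (f := fun i => ∑ j, H i j ^ 2)
              (fun _ _ => Finset.sum_nonneg fun _ _ => sq_nonneg _) (Finset.mem_univ i)
  have htr : ∀ H : Matrix κ κ ℝ, (H * Hᵀ).trace = ∑ i, ∑ j, H i j ^ 2 := by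
    intro H
    simp [Matrix.trace, Matrix.mul_apply, sq]
  convert hK.image (f := fun H : Matrix κ κ ℝ => H * Hᵀ) (by fun_prop) using 1
  ext W
  constructor
  · rintro ⟨hW, hW1⟩
    obtain ⟨M, rfl⟩ := hW.exists_eq_conjTranspose_mul_self
    refine ⟨Mᵀ, ?_, by simp⟩
    rw [Set.mem_ofPred_eq, ← htr, ← hW1]
    simp
  · rintro ⟨H, hH, rfl⟩
    exact ⟨by simpa using Matrix.posSemidef_self_mul_conjTranspose H, (htr H).trans hH⟩

theorem convex_setOf_posSemidef_trace_eq_one (κ : Type*) [Fintype κ] :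
    Convex ℝ {W : Matrix κ κ ℝ | W.PosSemidef ∧ W.trace = 1} := by
  rintro W ⟨hW, hW1⟩ Z ⟨hZ, hZ1⟩ a b ha hb hab
  refine ⟨(hW.smul ha).add (hZ.smul hb), ?_⟩
  simp [hW1, hZ1, hab]

/-- A theorem of alternatives for a linear matrix inequality of Kalman–Yakubovich–Popov type. -/
theorem exists_symm_of_forall_skew {ι κ : Type*} [Fintype ι] [Fintype κ] [DecidableEq κ]
    (N J : Matrix ι κ ℝ) (Q : Matrix κ κ ℝ)
    (hQ : ∀ H : Matrix κ κ ℝ, H ≠ 0 → (N * H) * (J * H)ᵀ + (J * H) * (N * H)ᵀ = 0 →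
      (Hᵀ * Q * H).trace < 0)
    (e : κ → ℝ) (he : e ⬝ᵥ e = 1) (hJe : J *ᵥ e = 0) :
    ∃ P : Matrix ι ι ℝ, P.IsSymm ∧ ∃ ε : ℝ, 0 < ε ∧ ∀ h : κ → ℝ,
      2 * ((N *ᵥ h) ⬝ᵥ (P *ᵥ (J *ᵥ h))) + h ⬝ᵥ (Q *ᵥ h) ≤ -ε * (h ⬝ᵥ h) := by
  classical
  let Φ : Matrix κ κ ℝ →ₗ[ℝ] (ι → ι → ℝ) × ℝ :=
    { toFun := fun W => (N * W * Jᵀ + J * W * Nᵀ, (Q * W).trace)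
      map_add' := fun W Z => by
        refine Prod.ext ?_ ?_
        · change N * (W + Z) * Jᵀ + J * (W + Z) * Nᵀ =
            (N * W * Jᵀ + J * W * Nᵀ) + (N * Z * Jᵀ + J * Z * Nᵀ)
          simp only [Matrix.mul_add, Matrix.add_mul]; abel
        · simp [Matrix.mul_add]
      map_smul' := fun c W => by
        refine Prod.ext ?_ ?_
        · change N * (c • W) * Jᵀ + J * (c • W) * Nᵀ = c • (N * W * Jᵀ + J * W * Nᵀ)
          simp
        · simp }
  have hΦ1 : ∀ W i j, (Φ W).1 i j = (N * W * Jᵀ + J * W * Nᵀ) i j := fun W i j => rfl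
  have hΦ2 : ∀ W, (Φ W).2 = (Q * W).trace := fun W => rfl
  set K := {W : Matrix κ κ ℝ | W.PosSemidef ∧ W.trace = 1}
  have hKc : IsCompact (Φ '' K) := (isCompact_setOf_posSemidef_trace_eq_one κ).image
    (LinearMap.continuous_of_finiteDimensional Φ)
  have hKv : Convex ℝ (Φ '' K) := (convex_setOf_posSemidef_trace_eq_one κ).linear_image Φ
  let T : Set ((ι → ι → ℝ) × ℝ) := {0} ×ˢ Set.Ici 0
  have hTv : Convex ℝ T := (convex_singleton 0).prod (convex_Ici 0)
  have hTc : IsClosed T := isClosed_singleton.prod isClosed_Ici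
  have hdisj : Disjoint (Φ '' K) T := by
    rw [Set.disjoint_left]
    rintro _ ⟨W, ⟨hW, hW1⟩, rfl⟩ ⟨h0, h1⟩
    obtain ⟨M, rfl⟩ := hW.exists_eq_conjTranspose_mul_self
    rw [Set.mem_singleton_iff] at h0
    rw [Set.mem_Ici, hΦ2] at h1
    have hlt := hQ Mᵀ ?_ ?_
    · rw [transpose_transpose, Matrix.trace_mul_comm, ← Matrix.mul_assoc,
        Matrix.trace_mul_comm] at hlt
      simp only [conjTranspose_eq_transpose_of_trivial] at h1
      exact absurd h1 (not_le.2 hlt)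
    · intro h
      have : M = 0 := by simpa using h
      simp [this] at hW1
    · have h2 : N * (Mᴴ * M) * Jᵀ + J * (Mᴴ * M) * Nᵀ = 0 := h0
      rw [← h2]
      simp [Matrix.mul_assoc]
  obtain ⟨f, u, v, hfu, huv, hfv⟩ := geometric_hahn_banach_compact_closed hKv hKc hTv hTc hdisj
  have hvv : v < 0 := by simpa using hfv 0 ⟨rfl, Set.mem_Ici.2 le_rfl⟩
  have hu : u < 0 := huv.trans hvv
  set c := f (0, 1)
  have hsplit : ∀ M t, f (M, t) = f (M, 0) + t * c := by
    intro M t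
    have : (M, t) = (M, 0) + t • ((0 : ι → ι → ℝ), (1 : ℝ)) := by simp
    rw [this, map_add, map_smul]; rfl
  have hrank1 : ∀ h : κ → ℝ, h ⬝ᵥ h = 1 → vecMulVec h h ∈ K := fun h hh =>
    ⟨by simpa using Matrix.posSemidef_vecMulVec_self_star h, by rw [Matrix.trace_vecMulVec, hh]⟩
  have hmv : ∀ h : κ → ℝ, N * vecMulVec h h * Jᵀ + J * vecMulVec h h * Nᵀ =
      vecMulVec (N *ᵥ h) (J *ᵥ h) + vecMulVec (J *ᵥ h) (N *ᵥ h) := by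
    intro h
    simp only [Matrix.mul_vecMulVec, Matrix.vecMulVec_mul, Matrix.vecMul_transpose]
  have htr : ∀ h : κ → ℝ, (Q * vecMulVec h h).trace = h ⬝ᵥ (Q *ᵥ h) := by
    intro h
    rw [Matrix.mul_vecMulVec, Matrix.trace_vecMulVec, dotProduct_comm]
  have hc0 : 0 ≤ c := by
    by_contra! hc
    have := hfv (0, v / c) ⟨rfl, (div_pos_of_neg_of_neg hvv hc).le⟩
    rw [hsplit, div_mul_cancel₀ _ hc.ne] at this
    have h0 : f (0, 0) = 0 := map_zero f
    rw [h0] at this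
    linarith
  have hc : 0 < c := by
    refine lt_of_le_of_ne hc0 fun hc => ?_
    have h1 := hfu _ ⟨_, hrank1 e he, rfl⟩
    have h2 : (Φ (vecMulVec e e)).1 = 0 := by
      funext i j
      rw [hΦ1, hmv, hJe]
      simp
    have h3 : Φ (vecMulVec e e) = (0, (Φ (vecMulVec e e)).2) := Prod.ext h2 rfl
    rw [h3, hsplit, ← hc, mul_zero, add_zero] at h1
    have h0 : f (0, 0) = 0 := map_zero f
    linarith
  let G : Matrix ι ι ℝ := Matrix.of fun i j => f (Pi.single i (Pi.single j 1), 0)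
  have hG : ∀ M : ι → ι → ℝ, f (M, 0) = ∑ i, ∑ j, M i j * G i j := by
    intro M
    have h1 : (M, (0 : ℝ)) =
        ∑ i, ∑ j, M i j • ((Pi.single i (Pi.single j 1) : ι → ι → ℝ), (0 : ℝ)) := by
      refine Prod.ext ?_ ?_
      · funext a b
        simp [Prod.fst_sum, Finset.sum_apply, Pi.single_apply, Finset.sum_ite_eq, apply_ite,
          ite_apply]
      · simp [Prod.snd_sum]
    rw [h1, map_sum]
    refine Finset.sum_congr rfl fun i _ => ?_
    rw [map_sum]
    refine Finset.sum_congr rfl fun j _ => ?_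
    rw [map_smul]; rfl
  have hGv : ∀ x y : ι → ℝ, f (fun i j => x i * y j, 0) = x ⬝ᵥ (G *ᵥ y) := by
    intro x y
    rw [hG]
    simp only [dotProduct, mulVec, Finset.mul_sum]
    refine Finset.sum_congr rfl fun i _ => Finset.sum_congr rfl fun j _ => by ring
  refine ⟨(2 * c)⁻¹ • (G + Gᵀ), ?_, -u / c, by apply div_pos <;> linarith, ?_⟩
  · simp [Matrix.IsSymm, add_comm]
  have hunit : ∀ h : κ → ℝ, h ⬝ᵥ h = 1 →
      2 * ((N *ᵥ h) ⬝ᵥ (((2 * c)⁻¹ • (G + Gᵀ)) *ᵥ (J *ᵥ h))) + h ⬝ᵥ (Q *ᵥ h) ≤ u / c := by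
    intro h hh
    have h1 := hfu _ ⟨_, hrank1 h hh, rfl⟩
    have h3 : Φ (vecMulVec h h) = ((fun i j => (N *ᵥ h) i * (J *ᵥ h) j) +
        fun i j => (J *ᵥ h) i * (N *ᵥ h) j, h ⬝ᵥ (Q *ᵥ h)) := Prod.ext (hmv h) (htr h)
    have h4 : f ((fun i j => (N *ᵥ h) i * (J *ᵥ h) j) + fun i j => (J *ᵥ h) i * (N *ᵥ h) j, 0) =
        f (fun i j => (N *ᵥ h) i * (J *ᵥ h) j, 0) + f (fun i j => (J *ᵥ h) i * (N *ᵥ h) j, 0) := by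
      rw [← map_add, Prod.mk_add_mk, add_zero]
    rw [h3, hsplit, h4, hGv, hGv] at h1
    have h5 : (J *ᵥ h) ⬝ᵥ (G *ᵥ (N *ᵥ h)) = (N *ᵥ h) ⬝ᵥ (Gᵀ *ᵥ (J *ᵥ h)) := by
      rw [Matrix.mulVec_transpose, dotProduct_comm (N *ᵥ h), ← Matrix.dotProduct_mulVec]
    rw [h5] at h1
    rw [le_div_iff₀ hc, Matrix.smul_mulVec, dotProduct_smul, Matrix.add_mulVec, dotProduct_add,
      smul_eq_mul]
    have : (2 * c)⁻¹ * 2 * c = 1 := by field_simp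
    calc _ = (2 * c)⁻¹ * 2 * c * ((N *ᵥ h) ⬝ᵥ (G *ᵥ (J *ᵥ h)) + (N *ᵥ h) ⬝ᵥ (Gᵀ *ᵥ (J *ᵥ h))) +
          h ⬝ᵥ (Q *ᵥ h) * c := by ring
      _ ≤ u := by rw [this, one_mul]; exact h1.le
  intro h
  by_cases h0 : h = 0
  · simp [h0]
  have hpos : 0 < h ⬝ᵥ h := by
    have := (Matrix.dotProduct_star_self_pos_iff (v := h)).2 h0
    simpa using this
  set r := Real.sqrt (h ⬝ᵥ h)
  have hr : r * r = h ⬝ᵥ h := Real.mul_self_sqrt hpos.le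
  have hr0 : 0 < r := Real.sqrt_pos.2 hpos
  have h1 := hunit (r⁻¹ • h) (by
    rw [smul_dotProduct, dotProduct_smul, ← hr]; simp; field_simp)
  simp only [Matrix.mulVec_smul, dotProduct_smul, smul_dotProduct, smul_eq_mul] at h1
  rw [← hr]
  have h2 := mul_le_mul_of_nonneg_right h1 (mul_pos hr0 hr0).le
  have hi : r⁻¹ * r = 1 := inv_mul_cancel₀ hr0.ne'
  generalize ((N *ᵥ h) ⬝ᵥ (((2 * c)⁻¹ • (G + Gᵀ)) *ᵥ (J *ᵥ h))) = α at *
  generalize h ⬝ᵥ (Q *ᵥ h) = β at *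
  calc 2 * α + β = (2 * (r⁻¹ * (r⁻¹ * α)) + r⁻¹ * (r⁻¹ * β)) * (r * r) := by
        field_simp
    _ ≤ _ := h2
    _ = _ := by ring

theorem OrthonormalBasis.sum_norm_dotProduct_sq {κ ρ : Type*} [Fintype κ] [Fintype ρ]
    (b : OrthonormalBasis ρ ℂ (EuclideanSpace ℂ κ)) (w : κ → ℝ) :
    ∑ j, ‖(Complex.ofReal ∘ w) ⬝ᵥ (b j).ofLp‖ ^ 2 = w ⬝ᵥ w := by
  have h := b.sum_sq_norm_inner_left (WithLp.toLp 2 (Complex.ofReal ∘ w))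
  rw [EuclideanSpace.norm_sq_eq] at h
  calc _ = _ := Finset.sum_congr rfl fun j _ => ?_
    _ = _ := h
    _ = _ := by simp [dotProduct, sq]
  rw [EuclideanSpace.inner_eq_star_dotProduct]
  congr 2
  rw [dotProduct_comm]
  congr 1
  ext i
  simp

theorem ofReal_comp_vecMul_dotProduct {ι κ : Type*} [Fintype ι] [Fintype κ]
    (g : ι → ℝ) (H : Matrix ι κ ℝ) (v : κ → ℂ) :
    (Complex.ofReal ∘ (g ᵥ* H)) ⬝ᵥ v =
      (Complex.ofReal ∘ g) ⬝ᵥ (H.map Complex.ofReal *ᵥ v) := by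
  have : Complex.ofReal ∘ (g ᵥ* H) = (Complex.ofReal ∘ g) ᵥ* H.map Complex.ofReal := by
    ext i
    simp [vecMul, dotProduct]
  rw [this, dotProduct_mulVec]

/-- The strict bounded real lemma for a system without poles on the imaginary axis, with a
possibly indefinite storage matrix `P`. -/
theorem exists_symm_of_norm_transfer_lt {ι : Type*} [Fintype ι] [DecidableEq ι]
    (A : Matrix ι ι ℝ) (b c : ι → ℝ) (D γ : ℝ)
    (hA : ∀ ω : ℝ, IsUnit ((Complex.I * ω) • (1 : Matrix ι ι ℂ) - A.map Complex.ofReal))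
    (hG : ∀ ω : ℝ, ‖(Complex.ofReal ∘ c) ⬝ᵥ
      (((Complex.I * ω) • (1 : Matrix ι ι ℂ) - A.map Complex.ofReal)⁻¹ *ᵥ
        (Complex.ofReal ∘ b)) + D‖ < γ) (hD : |D| < γ) :
    ∃ P : Matrix ι ι ℝ, P.IsSymm ∧ ∃ ε : ℝ, 0 < ε ∧ ∀ (x : ι → ℝ) (u : ℝ),
      2 * ((A *ᵥ x + u • b) ⬝ᵥ (P *ᵥ x)) + (c ⬝ᵥ x + D * u) ^ 2 - γ ^ 2 * u ^ 2 ≤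
        -ε * (x ⬝ᵥ x + u ^ 2) := by
  classical
  let N : Matrix ι (ι ⊕ Unit) ℝ := Matrix.of fun i => Sum.elim (A i) (fun _ => b i)
  let J : Matrix ι (ι ⊕ Unit) ℝ := Matrix.of fun i =>
    Sum.elim ((1 : Matrix ι ι ℝ) i) (fun _ => 0)
  let g : ι ⊕ Unit → ℝ := Sum.elim c (fun _ => D)
  let e : ι ⊕ Unit → ℝ := Sum.elim 0 (fun _ => 1)
  have hγ : 0 < γ := (abs_nonneg D).trans_lt hD
  have hN : ∀ h, N *ᵥ h = A *ᵥ (h ∘ Sum.inl) + h (Sum.inr ()) • b := by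
    intro h; ext i; simp [N, mulVec, dotProduct, mul_comm]
  have hJ : ∀ h, J *ᵥ h = h ∘ Sum.inl := by
    intro h; ext i; simp [J, mulVec, dotProduct, Matrix.one_apply]
  have hg : ∀ h, g ⬝ᵥ h = c ⬝ᵥ (h ∘ Sum.inl) + D * h (Sum.inr ()) := by
    intro h; simp [g, dotProduct]
  have he : ∀ h, e ⬝ᵥ h = h (Sum.inr ()) := by
    intro h; simp [e, dotProduct]
  have hNc : ∀ h, N.map Complex.ofReal *ᵥ h =
      A.map Complex.ofReal *ᵥ (h ∘ Sum.inl) + h (Sum.inr ()) • (Complex.ofReal ∘ b) := by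
    intro h; ext i; simp [N, mulVec, dotProduct, mul_comm]
  have hJc : ∀ h, J.map Complex.ofReal *ᵥ h = h ∘ Sum.inl := by
    intro h; ext i
    simp [J, mulVec, dotProduct, Matrix.one_apply, apply_ite Complex.ofReal]
  have hgc : ∀ h, (Complex.ofReal ∘ g) ⬝ᵥ h =
      (Complex.ofReal ∘ c) ⬝ᵥ (h ∘ Sum.inl) + D * h (Sum.inr ()) := by
    intro h; simp [g, dotProduct]
  have hec : ∀ h, (Complex.ofReal ∘ e) ⬝ᵥ h = h (Sum.inr ()) := by
    intro h; simp [e, dotProduct]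
  have hskew : ∀ H : Matrix (ι ⊕ Unit) (ι ⊕ Unit) ℝ, H ≠ 0 →
      (N * H) * (J * H)ᵀ + (J * H) * (N * H)ᵀ = 0 →
      (Hᵀ * (vecMulVec g g - γ ^ 2 • vecMulVec e e) * H).trace < 0 := by
    intro H hH0 hskew
    obtain ⟨r, v, hv⟩ := exists_orthonormalBasis_of_skew _ _ hskew
    have htr : (Hᵀ * (vecMulVec g g - γ ^ 2 • vecMulVec e e) * H).trace =
        ∑ j, (‖(Complex.ofReal ∘ g) ⬝ᵥ (H.map Complex.ofReal *ᵥ (v j).ofLp)‖ ^ 2 -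
          γ ^ 2 * ‖(Complex.ofReal ∘ e) ⬝ᵥ (H.map Complex.ofReal *ᵥ (v j).ofLp)‖ ^ 2) := by
      simp only [← ofReal_comp_vecMul_dotProduct]
      rw [Finset.sum_sub_distrib, ← Finset.mul_sum, v.sum_norm_dotProduct_sq,
        v.sum_norm_dotProduct_sq, Matrix.mul_sub, Matrix.sub_mul, Matrix.trace_sub,
        Matrix.mul_smul, Matrix.smul_mul, Matrix.trace_smul]
      simp only [Matrix.mul_vecMulVec, Matrix.vecMulVec_mul, Matrix.trace_vecMulVec,
        Matrix.mulVec_transpose, smul_eq_mul]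
    rw [htr]
    set z : Fin r → (ι ⊕ Unit → ℂ) := fun j => H.map Complex.ofReal *ᵥ (v j).ofLp with hz
    have hmap : ∀ M : Matrix ι (ι ⊕ Unit) ℝ, ∀ j, (M * H).map Complex.ofReal *ᵥ (v j).ofLp =
        M.map Complex.ofReal *ᵥ z j := by
      intro M j
      rw [hz, Matrix.mulVec_mulVec]
      congr 1
      exact Matrix.map_mul (f := Complex.ofRealHom)
    have hcase : ∀ j, z j ∘ Sum.inl = 0 ∨ ∃ ω : ℝ, z j ∘ Sum.inl = z j (Sum.inr ()) •
        (((Complex.I * ω) • (1 : Matrix ι ι ℂ) - A.map Complex.ofReal)⁻¹ *ᵥ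
          (Complex.ofReal ∘ b)) := by
      intro j
      refine (hv j).imp (fun h => ?_) (fun ⟨ω, h⟩ => ⟨ω, ?_⟩)
      · rwa [hmap, hJc] at h
      · rw [hmap, hmap, hJc, hNc] at h
        have hdet := (Matrix.isUnit_iff_isUnit_det _).1 (hA ω)
        have : ((Complex.I * ω) • (1 : Matrix ι ι ℂ) - A.map Complex.ofReal) *ᵥ (z j ∘ Sum.inl) =
            z j (Sum.inr ()) • (Complex.ofReal ∘ b) := by
          rw [Matrix.sub_mulVec, Matrix.smul_mulVec, Matrix.one_mulVec, ← h]
          abel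
        rw [← Matrix.mulVec_smul, ← this, Matrix.mulVec_mulVec, Matrix.nonsing_inv_mul _ hdet,
          Matrix.one_mulVec]
    have hterm : ∀ j, ‖(Complex.ofReal ∘ g) ⬝ᵥ z j‖ ≤ γ * ‖(Complex.ofReal ∘ e) ⬝ᵥ z j‖ ∧
        (z j (Sum.inr ()) ≠ 0 →
          ‖(Complex.ofReal ∘ g) ⬝ᵥ z j‖ < γ * ‖(Complex.ofReal ∘ e) ⬝ᵥ z j‖) := by
      intro j
      obtain ⟨d, hd, hdz⟩ : ∃ d : ℂ, ‖d‖ < γ ∧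
          (Complex.ofReal ∘ g) ⬝ᵥ z j = d * z j (Sum.inr ()) := by
        rw [hgc]
        rcases hcase j with h | ⟨ω, h⟩
        · exact ⟨D, by simpa using hD, by simp [h]⟩
        · refine ⟨_, hG ω, ?_⟩
          rw [h, dotProduct_smul, smul_eq_mul]
          ring
      rw [hdz, hec, norm_mul]
      exact ⟨mul_le_mul_of_nonneg_right hd.le (norm_nonneg _),
        fun h0 => mul_lt_mul_of_pos_right hd (norm_pos_iff.2 h0)⟩
    have hsq : ∀ a t : ℝ, 0 ≤ a → 0 ≤ t → a ≤ γ * t → a ^ 2 - γ ^ 2 * t ^ 2 ≤ 0 := by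
      intro a t ha ht hat
      rw [← mul_pow, sub_nonpos]
      exact pow_le_pow_left₀ ha hat 2
    refine Finset.sum_neg' (fun j _ => hsq _ _ (norm_nonneg _) (norm_nonneg _) (hterm j).1) ?_
    by_contra! hall
    have hu : ∀ j, z j (Sum.inr ()) = 0 := by
      intro j
      by_contra h0
      have h1 := (hterm j).2 h0
      have h2 := pow_lt_pow_left₀ h1 (norm_nonneg _) two_ne_zero
      rw [mul_pow] at h2
      linarith [hall j (Finset.mem_univ j)]
    have hzj : ∀ j, z j = 0 := by
      intro j
      have hx : z j ∘ Sum.inl = 0 := by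
        rcases hcase j with h | ⟨ω, h⟩
        · exact h
        · rw [h, hu, zero_smul]
      ext (i | i)
      · exact congrFun hx i
      · exact hu j
    refine hH0 ?_
    ext i k
    have hrow := v.sum_norm_dotProduct_sq (H i)
    have hz0 : ∀ j, (Complex.ofReal ∘ H i) ⬝ᵥ (v j).ofLp = 0 := fun j => congrFun (hzj j) i
    simp only [hz0, norm_zero, ne_eq, OfNat.ofNat_ne_zero, not_false_eq_true, zero_pow,
      Finset.sum_const_zero] at hrow
    exact congrFun (dotProduct_self_eq_zero.1 hrow.symm) k
  obtain ⟨P, hP, ε, hε, hPε⟩ := exists_symm_of_forall_skew N J _ hskew e (by simp [he, e])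
    (by rw [hJ]; ext; simp [e])
  refine ⟨P, hP, ε, hε, fun x u => ?_⟩
  have h := hPε (Sum.elim x fun _ => u)
  rw [hN, hJ, Matrix.sub_mulVec, Matrix.smul_mulVec, dotProduct_sub, dotProduct_smul,
    Matrix.vecMulVec_mulVec, Matrix.vecMulVec_mulVec] at h
  simp only [op_smul_eq_smul, dotProduct_smul, hg, he, dotProduct_comm _ g, dotProduct_comm _ e,
    Sum.elim_comp_inl, Sum.elim_inr, smul_eq_mul] at h
  have h2 : (Sum.elim x fun _ : Unit => u) ⬝ᵥ (Sum.elim x fun _ => u) = x ⬝ᵥ x + u ^ 2 := by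
    simp [dotProduct, sq]
  rw [h2] at h
  linarith

theorem re_sesquilinear_self_neg_of_lyapunov {V : Type*} [AddCommGroup V] [Module ℂ V]
    [FiniteDimensional ℂ V] (f : Module.End ℂ V) (b : V →ₗ⋆[ℂ] V →ₗ[ℂ] ℂ)
    (hb : ∀ x y, star (b x y) = b y x) (hf : ∀ x, x ≠ 0 → (b x (f x)).re < 0)
    (hμ : ∀ μ, f.HasEigenvalue μ → 0 < μ.re) (x : V) (hx : x ≠ 0) : (b x x).re < 0 := by
  induction hd : Module.finrank ℂ V using Nat.strong_induction_on generalizing V with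
  | _ d ih =>
  have : Nontrivial V := ⟨x, 0, hx⟩
  obtain ⟨μ, hμf⟩ := Module.End.exists_eigenvalue f
  obtain ⟨v, hv⟩ := hμf.exists_hasEigenvector
  have hfv : f v = μ • v := hv.apply_eq_smul
  have him (y : V) : (b y y).im = 0 := Complex.conj_eq_iff_im.mp (hb y y)
  have hbv : (b v v).re < 0 := by
    have h1 := hf v hv.2
    rw [hfv, map_smul, smul_eq_mul, Complex.mul_re, him, mul_zero, sub_zero] at h1
    exact neg_of_mul_neg_right h1 (hμ μ hμf).le
  have hbv0 : b v v ≠ 0 := fun h => by simp [h] at hbv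
  have hbv' (y : V) (hy : b v y = 0) : b y v = 0 := by rw [← hb, hy, star_zero]
  let W : Submodule ℂ V := LinearMap.ker (b v)
  let g : V →ₗ[ℂ] V := LinearMap.id - (b v).smulRight ((b v v)⁻¹ • v)
  have hg (y : V) : g y = y - (b v y * (b v v)⁻¹) • v := by simp [g, mul_smul]
  have hgW (y : V) : g y ∈ W := by
    simp [W, hg, hbv0]
  let fW : Module.End ℂ W :=
    LinearMap.codRestrict W (g ∘ₗ f ∘ₗ W.subtype) fun w => hgW _
  have hfW (w : W) : (fW w : V) = f w - (b v (f w) * (b v v)⁻¹) • v := hg _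
  have hWd : Module.finrank ℂ W < d := by
    rw [← hd]
    refine Submodule.finrank_lt fun h => hbv0 ?_
    have : v ∈ W := h ▸ Submodule.mem_top
    simpa [W] using this
  have hneg (w : V) (hw : w ∈ W) (hw0 : w ≠ 0) : (b w w).re < 0 := by
    refine ih _ hWd fW (b.domRestrict₁₂ W W) (fun y z => hb y z) (fun y hy => ?_) ?_ ⟨w, hw⟩
      (by simpa using hw0) rfl
    · have hy' : (y : V) ≠ 0 := by simpa using hy
      change (b y (fW y)).re < 0
      rw [hfW, map_sub, map_smul, hbv' y (LinearMap.mem_ker.mp y.2), smul_zero, sub_zero]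
      exact hf y hy'
    · intro ν hν
      obtain ⟨y, hy⟩ := hν.exists_hasEigenvector
      by_cases hνμ : ν = μ
      · exact hνμ ▸ hμ μ hμf
      have hd0 : ν - μ ≠ 0 := sub_ne_zero.mpr hνμ
      have hfy : f y = ν • (y : V) + (b v (f y) * (b v v)⁻¹) • v := by
        have := congrArg (Subtype.val) hy.apply_eq_smul
        rw [hfW, Submodule.coe_smul] at this
        rw [← this, sub_add_cancel]
      set c := b v (f y) * (b v v)⁻¹
      refine hμ ν (Module.End.hasEigenvalue_of_hasEigenvector
        (x := (y : V) + (c / (ν - μ)) • v) ⟨Module.End.mem_eigenspace_iff.mpr ?_, fun h => ?_⟩)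
      · rw [map_add, map_smul, hfy, hfv, smul_add, smul_smul, smul_smul, add_assoc, ← add_smul]
        congr 2
        field_simp
        ring
      · have h1 : b v (y + (c / (ν - μ)) • v) = 0 := by rw [h, map_zero]
        rw [map_add, LinearMap.mem_ker.mp y.2, zero_add, map_smul, smul_eq_mul] at h1
        rw [(mul_eq_zero.mp h1).resolve_right hbv0, zero_smul, add_zero] at h
        exact hy.2 (Subtype.ext h)
  set α := b v x * (b v v)⁻¹
  have hxg : x = g x + α • v := by rw [hg]; simp [α]
  have hxx : b x x = b (g x) (g x) + star α * α * b v v := by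
    have h1 : b v (g x) = 0 := hgW x
    conv_lhs => rw [hxg]
    simp only [map_add, LinearMap.add_apply, map_smul, LinearMap.map_smulₛₗ, LinearMap.smul_apply,
      h1, hbv' _ h1, smul_eq_mul, starRingEnd_apply]
    ring
  have hre : (star α * α * b v v).re = ‖α‖ ^ 2 * (b v v).re := by
    rw [Complex.star_def, Complex.conj_mul', ← Complex.ofReal_pow, Complex.re_ofReal_mul]
  rw [hxx, Complex.add_re, hre]
  by_cases hgx : g x = 0
  · have hα : α ≠ 0 := by
      rintro h
      rw [hgx, h, zero_smul, add_zero] at hxg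
      exact hx hxg
    rw [hgx, map_zero, Complex.zero_re, zero_add]
    have : 0 < ‖α‖ := norm_pos_iff.mpr hα
    exact mul_neg_of_pos_of_neg (by positivity) hbv
  · have h1 := hneg _ (hgW x) hgx
    nlinarith [sq_nonneg ‖α‖]

theorem exists_invariant_submodule_finrank_eq {V : Type*} [AddCommGroup V] [Module ℂ V]
    [FiniteDimensional ℂ V] (f : Module.End ℂ V) (q : ℂ → Prop) [DecidablePred q] :
    ∃ W : Submodule ℂ V, (∀ x ∈ W, f x ∈ W) ∧
      Module.finrank ℂ W = (f.charpoly.roots.filter q).card ∧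
      ∀ μ, ∀ x ∈ W, x ≠ 0 → f x = μ • x → q μ := by
  classical
  have hdisj (s : Finset ℂ) (μ : ℂ) (hμ : μ ∉ s) :
      Disjoint (f.maxGenEigenspace μ) (⨆ ν ∈ s, f.maxGenEigenspace ν) :=
    f.independent_maxGenEigenspace.disjoint_biSup (y := (s : Set ℂ)) (by simpa using hμ)
  have hrank (s : Finset ℂ) : Module.finrank ℂ (⨆ ν ∈ s, f.maxGenEigenspace ν : Submodule ℂ V) =
      ∑ μ ∈ s, f.charpoly.rootMultiplicity μ := by
    induction s using Finset.induction_on with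
    | empty => simp
    | insert μ s hμ ih =>
      have h1 := Submodule.finrank_sup_add_finrank_inf_eq (f.maxGenEigenspace μ)
        (⨆ ν ∈ s, f.maxGenEigenspace ν)
      rw [(hdisj s μ hμ).eq_bot, finrank_bot, add_zero, ih,
        LinearMap.finrank_maxGenEigenspace_eq] at h1
      rw [Finset.iSup_insert, Finset.sum_insert hμ, h1]
  let s := (f.charpoly.roots.filter q).toFinset
  refine ⟨⨆ ν ∈ s, f.maxGenEigenspace ν, fun x hx => ?_, ?_, fun μ x hx hx0 hfx => ?_⟩
  · have h1 : (⨆ ν ∈ s, f.maxGenEigenspace ν) ≤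
        (⨆ ν ∈ s, f.maxGenEigenspace ν).comap f :=
      iSup₂_le fun ν hν y hy => Submodule.mem_comap.mpr <|
        Submodule.mem_iSup_of_mem ν <| Submodule.mem_iSup_of_mem hν <|
          f.mapsTo_maxGenEigenspace_of_comm (Commute.refl f) ν hy
    exact h1 hx
  · rw [hrank, ← Multiset.toFinset_sum_count_eq]
    refine Finset.sum_congr rfl fun μ hμ => ?_
    rw [Multiset.count_filter, if_pos (Multiset.of_mem_filter (Multiset.mem_toFinset.mp hμ)),
      Polynomial.count_roots]
  · by_contra hq
    have hμs : μ ∉ s := fun h => hq (Multiset.of_mem_filter (Multiset.mem_toFinset.mp h))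
    refine hx0 (Submodule.disjoint_def.mp (hdisj s μ hμs) x ?_ hx)
    exact Module.End.genEigenspace_le_maximal f μ 1 (Module.End.mem_eigenspace_iff.mpr hfx)

theorem Matrix.IsHermitian.re_star_dotProduct_mulVec {ι : Type*} [Fintype ι] [DecidableEq ι]
    {P : Matrix ι ι ℝ} (hP : P.IsHermitian) (x : ι → ℂ) :
    (star x ⬝ᵥ (P.map Complex.ofReal *ᵥ x)).re =
      ∑ i, hP.eigenvalues i *
        ‖(((hP.eigenvectorUnitary : Matrix ι ι ℝ)ᵀ).map Complex.ofReal *ᵥ x) i‖ ^ 2 := by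
  set U : Matrix ι ι ℝ := (hP.eigenvectorUnitary : Matrix ι ι ℝ)
  have hP' : P = U * diagonal hP.eigenvalues * Uᵀ := by
    conv_lhs => rw [hP.spectral_theorem, Unitary.conjStarAlgAut_apply]
    rfl
  have hmap : P.map Complex.ofReal = (Uᵀ.map Complex.ofReal)ᴴ *
      diagonal (fun i => (hP.eigenvalues i : ℂ)) * Uᵀ.map Complex.ofReal := by
    conv_lhs => rw [hP']
    change Complex.ofRealHom.mapMatrix _ = _
    rw [map_mul, map_mul]
    have h1 : Complex.ofRealHom.mapMatrix U = (Uᵀ.map Complex.ofReal)ᴴ := by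
      ext i j
      simp
    have h2 : Complex.ofRealHom.mapMatrix (diagonal hP.eigenvalues) =
        diagonal fun i => (hP.eigenvalues i : ℂ) := by
      ext i j
      by_cases hij : i = j <;> simp [hij]
    rw [h1, h2]
    rfl
  rw [hmap, ← mulVec_mulVec, ← mulVec_mulVec, dotProduct_mulVec, vecMul_conjTranspose, star_star,
    dotProduct, Complex.re_sum]
  refine Finset.sum_congr rfl fun i _ => ?_
  rw [mulVec_diagonal, Pi.star_apply, mul_left_comm, Complex.star_def, Complex.conj_mul',
    ← Complex.ofReal_pow, ← Complex.ofReal_mul, Complex.ofReal_re]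

theorem card_filter_roots_le_card_filter_eigenvalues {ι : Type*} [Fintype ι] [DecidableEq ι]
    (A : Matrix ι ι ℂ) (l : ℝ) {P : Matrix ι ι ℝ} (hP : P.IsHermitian)
    (hA : ∀ x, x ≠ 0 → (star x ⬝ᵥ (P.map Complex.ofReal *ᵥ (A *ᵥ x + (l : ℂ) • x))).re < 0)
    {σ : ℝ} (hσ : σ ≠ 0) :
    (A.charpoly.roots.filter fun μ => 0 < σ * (μ.re + l)).card ≤
      (Finset.univ.filter fun i => σ * hP.eigenvalues i < 0).card := by
  obtain ⟨W, hW, hWr, hWe⟩ :=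
    exists_invariant_submodule_finrank_eq A.mulVecLin fun μ => 0 < σ * (μ.re + l)
  rw [charpoly_mulVecLin] at hWr
  rw [← hWr]
  have hW' (x : ι → ℂ) (hx : x ∈ W) :
      ((σ : ℂ) • (A.mulVecLin + (l : ℂ) • LinearMap.id) : Module.End ℂ (ι → ℂ)) x ∈ W :=
    W.smul_mem _ (W.add_mem (hW x hx) (W.smul_mem _ hx))
  let f : Module.End ℂ W :=
    ((σ : ℂ) • (A.mulVecLin + (l : ℂ) • LinearMap.id) : Module.End ℂ (ι → ℂ)).restrict hW'
  let b : (ι → ℂ) →ₗ⋆[ℂ] (ι → ℂ) →ₗ[ℂ] ℂ := LinearMap.mk₂'ₛₗ (starRingEnd ℂ) (RingHom.id ℂ)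
    (fun x y => (σ : ℂ) * (star x ⬝ᵥ (P.map Complex.ofReal *ᵥ y)))
    (fun x y z => by simp [add_dotProduct, mul_add])
    (fun c x y => by simp [smul_dotProduct]; ring)
    (fun x y z => by simp [mulVec_add, dotProduct_add, mul_add])
    (fun c x y => by simp [mulVec_smul, dotProduct_smul]; ring)
  have hPc : (P.map Complex.ofReal)ᴴ = P.map Complex.ofReal := by
    ext i j
    simpa using congrFun₂ hP i j
  have hneg (x : ι → ℂ) (hx : x ∈ W) (hx0 : x ≠ 0) : (b x x).re < 0 := by
    refine re_sesquilinear_self_neg_of_lyapunov f (b.domRestrict₁₂ W W) (fun y z => ?_)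
      (fun y hy => ?_) (fun μ hμ => ?_) ⟨x, hx⟩ (by simpa using hx0)
    · change star ((σ : ℂ) * (star y.1 ⬝ᵥ (P.map Complex.ofReal *ᵥ z.1))) =
        (σ : ℂ) * (star z.1 ⬝ᵥ (P.map Complex.ofReal *ᵥ y.1))
      rw [star_mul', ← star_dotProduct_star, star_star, star_mulVec, hPc, ← dotProduct_mulVec]
      simp
    · have h1 := hA y (by simpa using hy)
      change ((σ : ℂ) * (star y.1 ⬝ᵥ (P.map Complex.ofReal *ᵥ
        ((σ : ℂ) • (A *ᵥ y.1 + (l : ℂ) • y.1))))).re < 0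
      rw [mulVec_smul, dotProduct_smul, smul_eq_mul, Complex.re_ofReal_mul, Complex.re_ofReal_mul]
      nlinarith [mul_self_pos.mpr hσ]
    · obtain ⟨y, hy⟩ := hμ.exists_hasEigenvector
      have hy0 : (y : ι → ℂ) ≠ 0 := by simpa using hy.2
      have h1 : (σ : ℂ) • (A *ᵥ y.1 + (l : ℂ) • y.1) = μ • y.1 :=
        congrArg Subtype.val hy.apply_eq_smul
      have hσc : (σ : ℂ) ≠ 0 := by exact_mod_cast hσ
      have h2 := hWe (μ / σ - l) y y.2 hy0 (by
        rw [mulVecLin_apply, sub_smul, div_eq_inv_mul, mul_smul, ← h1, inv_smul_smul₀ hσc,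
          add_sub_cancel_right])
      rwa [Complex.sub_re, Complex.ofReal_re, sub_add_cancel, Complex.div_ofReal_re,
        mul_div_cancel₀ _ hσ] at h2
  let g : (ι → ℂ) →ₗ[ℂ] ({i // σ * hP.eigenvalues i < 0} → ℂ) :=
    LinearMap.funLeft ℂ ℂ Subtype.val ∘ₗ
      (((hP.eigenvectorUnitary : Matrix ι ι ℝ)ᵀ).map Complex.ofReal).mulVecLin
  have hg : Function.Injective (g ∘ₗ W.subtype) := by
    rw [← LinearMap.ker_eq_bot, LinearMap.ker_eq_bot']
    intro x hx
    by_contra hx0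
    have h1 := hneg x x.2 (by simpa using hx0)
    refine absurd h1 (not_lt.mpr ?_)
    change 0 ≤ ((σ : ℂ) * (star x.1 ⬝ᵥ (P.map Complex.ofReal *ᵥ x.1))).re
    rw [Complex.re_ofReal_mul, hP.re_star_dotProduct_mulVec, Finset.mul_sum]
    refine Finset.sum_nonneg fun i _ => ?_
    rw [← mul_assoc]
    by_cases hi : σ * hP.eigenvalues i < 0
    · have h2 : (((hP.eigenvectorUnitary : Matrix ι ι ℝ)ᵀ).map Complex.ofReal *ᵥ x.1) i = 0 :=
        congrFun hx ⟨i, hi⟩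
      rw [h2, norm_zero]
      simp
    · exact mul_nonneg (not_lt.mp hi) (by positivity)
  have h3 := LinearMap.finrank_le_finrank_of_injective hg
  rwa [Module.finrank_fintype_fun_eq_card, Fintype.card_subtype] at h3

theorem isUnit_smul_one_sub_of_not_mem_roots {ι : Type*} [Fintype ι] [DecidableEq ι]
    {A : Matrix ι ι ℂ} {s : ℂ} (hs : s ∉ A.charpoly.roots) :
    IsUnit (s • (1 : Matrix ι ι ℂ) - A) := by
  rw [Matrix.isUnit_iff_isUnit_det, isUnit_iff_ne_zero, smul_one_eq_diagonal,
    ← Matrix.scalar_apply, ← Matrix.eval_charpoly]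
  exact fun h => hs ((Polynomial.mem_roots A.charpoly_monic.ne_zero).mpr h)

theorem Matrix.continuousAt_inv_of_isUnit {ι X : Type*} [Fintype ι] [DecidableEq ι]
    [TopologicalSpace X] {M : X → Matrix ι ι ℂ} (hM : Continuous M) {a : X} (ha : IsUnit (M a)) :
    ContinuousAt (fun x => (M x)⁻¹) a := by
  simp_rw [Matrix.inv_def, Ring.inverse_eq_inv']
  exact (hM.matrix_det.continuousAt.inv₀ ((Matrix.isUnit_iff_isUnit_det _).mp ha).ne_zero).smul
    hM.matrix_adjugate.continuousAt

theorem tendsto_resolvent_cobounded {ι : Type*} [Fintype ι] [DecidableEq ι] (A : Matrix ι ι ℂ) :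
    Filter.Tendsto (fun s : ℂ => (s • (1 : Matrix ι ι ℂ) - A)⁻¹) (Bornology.cobounded ℂ)
      (nhds 0) := by
  have h1 : ContinuousAt (fun w : ℂ => w • ((1 : Matrix ι ι ℂ) - w • A)⁻¹) 0 :=
    continuousAt_id.smul (Matrix.continuousAt_inv_of_isUnit (by fun_prop) (by simp))
  have h2 := h1.tendsto.comp Filter.tendsto_inv₀_cobounded
  rw [zero_smul] at h2
  refine h2.congr' ?_
  filter_upwards [Bornology.eventually_ne_cobounded (0 : ℂ)] with s hs
  have h3 : s • (1 : Matrix ι ι ℂ) - A = s • (1 - s⁻¹ • A) := by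
    rw [smul_sub, smul_inv_smul₀ hs]
  rw [h3, Function.comp_apply]
  by_cases hd : IsUnit (1 - s⁻¹ • A).det
  · exact (Matrix.inv_smul' _ (Units.mk0 s hs) hd).symm
  · rw [nonsing_inv_apply_not_isUnit _ hd, nonsing_inv_apply_not_isUnit, smul_zero]
    rw [det_smul, IsUnit.mul_iff]
    exact fun h => hd h.2

section Transfer

variable {n : ℕ} (A : Matrix (Fin n) (Fin n) ℝ) (B : Matrix (Fin n) (Fin 1) ℝ)
  (C : Matrix (Fin 1) (Fin n) ℝ) (D : ℝ)

/-- The transfer function `s ↦ C (s I - A)⁻¹ B + D` of a real state-space realization. -/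
noncomputable def transfer (s : ℂ) : ℂ :=
  (C.map (Complex.ofReal) *
    (s • (1 : Matrix (Fin n) (Fin n) ℂ) - A.map (Complex.ofReal))⁻¹ *
      B.map (Complex.ofReal)) 0 0 + (D : ℂ)

theorem continuous_mul_mul_apply_add : Continuous fun M : Matrix (Fin n) (Fin n) ℂ =>
    (C.map Complex.ofReal * M * B.map Complex.ofReal) 0 0 + (D : ℂ) :=
  ((((continuous_const.matrix_mul continuous_id).matrix_mul continuous_const).matrix_elem
    0 0)).add continuous_const

theorem tendsto_transfer_cobounded :
    Filter.Tendsto (transfer A B C D) (Bornology.cobounded ℂ) (nhds (D : ℂ)) := by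
  have h1 := ((continuous_mul_mul_apply_add B C D).tendsto 0).comp
    (tendsto_resolvent_cobounded (A.map Complex.ofReal))
  rwa [Matrix.mul_zero, Matrix.zero_mul, Matrix.zero_apply, zero_add] at h1

theorem continuousAt_transfer {s : ℂ}
    (hs : IsUnit (s • (1 : Matrix (Fin n) (Fin n) ℂ) - A.map Complex.ofReal)) :
    ContinuousAt (transfer A B C D) s := by
  exact (continuous_mul_mul_apply_add B C D).continuousAt.comp (f := fun s : ℂ =>
    (s • (1 : Matrix (Fin n) (Fin n) ℂ) - A.map Complex.ofReal)⁻¹)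
    (Matrix.continuousAt_inv_of_isUnit (by fun_prop) hs)

theorem exists_norm_transfer_le {K : Set ℂ} (hK : IsClosed K)
    (h : ∀ s ∈ K, IsUnit (s • (1 : Matrix (Fin n) (Fin n) ℂ) - A.map Complex.ofReal)) :
    ∃ M, ∀ s ∈ K, ‖transfer A B C D s‖ ≤ M := by
  have h1 : ∀ᶠ s in Bornology.cobounded ℂ, ‖transfer A B C D s‖ < ‖(D : ℂ)‖ + 1 :=
    (tendsto_transfer_cobounded A B C D).norm.eventually_lt_const (lt_add_one _)
  obtain ⟨R, -, hR⟩ :=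
    (Metric.hasBasis_cobounded_compl_closedBall (0 : ℂ)).eventually_iff.mp h1
  have h2 : ContinuousOn (transfer A B C D) (K ∩ Metric.closedBall 0 R) := fun s hs =>
    (continuousAt_transfer A B C D (h s hs.1)).continuousWithinAt
  obtain ⟨M, hM⟩ := (((isCompact_closedBall 0 R).inter_left hK).exists_bound_of_continuousOn h2)
  refine ⟨max M (‖(D : ℂ)‖ + 1), fun s hs => ?_⟩
  by_cases hsR : s ∈ Metric.closedBall 0 R
  · exact (hM s ⟨hs, hsR⟩).trans (le_max_left _ _)
  · exact (hR hsR).le.trans (le_max_right _ _)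

theorem abs_le_of_forall_norm_transfer_le {σ M : ℝ}
    (h : ∀ ω : ℝ, ‖transfer A B C D (Complex.I * ω - σ)‖ ≤ M) : |D| ≤ M := by
  have h1 : Filter.Tendsto (fun ω : ℝ => Complex.I * ω - σ) Filter.atTop
      (Bornology.cobounded ℂ) := by
    rw [← tendsto_norm_atTop_iff_cobounded]
    refine Filter.tendsto_atTop_mono (fun ω => ?_) Filter.tendsto_id
    refine le_trans (le_abs_self _) ((Complex.abs_im_le_norm (Complex.I * ω - σ)).trans' ?_)
    simp
  have h2 := ((tendsto_transfer_cobounded A B C D).comp h1).norm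
  rw [Complex.norm_real, Real.norm_eq_abs] at h2
  exact le_of_tendsto' h2 h

theorem posSemidef_neg_fromBlocks_iff {P : Matrix (Fin n) (Fin n) ℝ} (hP : P.IsHermitian)
    (l ε γ : ℝ) :
    (-(Matrix.fromBlocks
        (Aᵀ * P + P * A + (2 * l) • P + ε • (1 : Matrix (Fin n) (Fin n) ℝ) + Cᵀ * C)
        (P * B + D • Cᵀ)
        (Bᵀ * P + D • C)
        ((D ^ 2 - γ ^ 2) • (1 : Matrix (Fin 1) (Fin 1) ℝ)))).PosSemidef ↔
      ∀ (x : Fin n → ℝ) (u : ℝ),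
        2 * ((A *ᵥ x + u • B.col 0) ⬝ᵥ (P *ᵥ x)) + 2 * l * (x ⬝ᵥ (P *ᵥ x)) + ε * (x ⬝ᵥ x) +
          (C.row 0 ⬝ᵥ x + D * u) ^ 2 - γ ^ 2 * u ^ 2 ≤ 0 := by
  have hPt : Pᵀ = P := by simpa [IsHermitian] using hP
  have hform (x : Fin n → ℝ) (u : ℝ) :
      star (Sum.elim x fun _ : Fin 1 => u) ⬝ᵥ (-(Matrix.fromBlocks
        (Aᵀ * P + P * A + (2 * l) • P + ε • (1 : Matrix (Fin n) (Fin n) ℝ) + Cᵀ * C)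
        (P * B + D • Cᵀ)
        (Bᵀ * P + D • C)
        ((D ^ 2 - γ ^ 2) • (1 : Matrix (Fin 1) (Fin 1) ℝ))) *ᵥ (Sum.elim x fun _ => u)) =
      -(2 * ((A *ᵥ x + u • B.col 0) ⬝ᵥ (P *ᵥ x)) + 2 * l * (x ⬝ᵥ (P *ᵥ x)) + ε * (x ⬝ᵥ x) +
          (C.row 0 ⬝ᵥ x + D * u) ^ 2 - γ ^ 2 * u ^ 2) := by
    have hB : B *ᵥ (fun _ => u) = u • B.col 0 := by
      ext i
      simp [mulVec, dotProduct, mul_comm]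
    have hC (y : Fin n → ℝ) : C *ᵥ y = fun _ => C.row 0 ⬝ᵥ y := by
      ext i
      rw [Subsingleton.elim i 0]
      rfl
    have hD : Cᵀ *ᵥ (fun _ => u) = u • C.row 0 := by
      ext i
      simp [mulVec, dotProduct, mul_comm]
    have hxP (y : Fin n → ℝ) : x ⬝ᵥ (P *ᵥ y) = y ⬝ᵥ (P *ᵥ x) := by
      rw [dotProduct_mulVec, ← mulVec_transpose, hPt, dotProduct_comm]
    have hxA : x ⬝ᵥ (Aᵀ *ᵥ (P *ᵥ x)) = (A *ᵥ x) ⬝ᵥ (P *ᵥ x) := by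
      rw [dotProduct_mulVec, vecMul_transpose]
    have hxC : x ⬝ᵥ (Cᵀ *ᵥ (C *ᵥ x)) = (C.row 0 ⬝ᵥ x) ^ 2 := by
      rw [dotProduct_mulVec, vecMul_transpose, hC]
      simp [dotProduct, sq]
    have huB : (fun _ => u) ⬝ᵥ (Bᵀ *ᵥ (P *ᵥ x)) = u * (B.col 0 ⬝ᵥ (P *ᵥ x)) := by
      rw [dotProduct_mulVec, vecMul_transpose, hB, smul_dotProduct, smul_eq_mul]
    rw [star_trivial, neg_mulVec, dotProduct_neg, fromBlocks_mulVec, sumElim_dotProduct_sumElim,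
      Sum.elim_comp_inl, Sum.elim_comp_inr]
    simp only [add_mulVec, ← mulVec_mulVec, smul_mulVec, one_mulVec, dotProduct_add,
      dotProduct_smul, hB, hD, hxA, hxC, huB, hxP, smul_dotProduct, add_dotProduct, smul_eq_mul]
    rw [hC, dotProduct_comm x (C.row 0)]
    simp [dotProduct]
    ring
  rw [posSemidef_iff_dotProduct_mulVec]
  constructor
  · intro h x u
    have h1 := h.2 (Sum.elim x fun _ => u)
    rw [hform] at h1
    linarith
  · intro h
    refine ⟨?_, fun z => ?_⟩
    · refine IsHermitian.neg (IsHermitian.fromBlocks ?_ ?_ ?_)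
      · simp [IsHermitian, hPt, transpose_add, transpose_mul, add_comm]
      · simp [hPt, transpose_mul]
      · simp [IsHermitian]
    · have h1 := h (z ∘ Sum.inl) (z (Sum.inr 0))
      have hz : z = Sum.elim (z ∘ Sum.inl) fun _ => z (Sum.inr 0) := by
        ext i
        rcases i with i | i
        · rfl
        · simp [Subsingleton.elim i 0]
      rw [hz, hform]
      linarith

theorem re_map_ofReal_mulVec (z : Fin n → ℂ) (i : Fin n) :
    ((A.map Complex.ofReal *ᵥ z) i).re = (A *ᵥ fun j => (z j).re) i := by
  simp [mulVec, dotProduct]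

theorem im_map_ofReal_mulVec (z : Fin n → ℂ) (i : Fin n) :
    ((A.map Complex.ofReal *ᵥ z) i).im = (A *ᵥ fun j => (z j).im) i := by
  simp [mulVec, dotProduct]

theorem transfer_eq_dotProduct (s : ℂ) :
    transfer A B C D s = (Complex.ofReal ∘ C.row 0) ⬝ᵥ
      ((s • (1 : Matrix (Fin n) (Fin n) ℂ) - A.map Complex.ofReal)⁻¹ *ᵥ
        (Complex.ofReal ∘ B.col 0)) + D := by
  rw [transfer, Matrix.mul_assoc]
  rfl

theorem norm_transfer_le_of_forall_quadratic_le {P : Matrix (Fin n) (Fin n) ℝ}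
    (hP : P.IsHermitian) {l ε γ ω : ℝ} (hε : 0 ≤ ε) (hγ : 0 < γ)
    (h : ∀ (x : Fin n → ℝ) (u : ℝ),
      2 * ((A *ᵥ x + u • B.col 0) ⬝ᵥ (P *ᵥ x)) + 2 * l * (x ⬝ᵥ (P *ᵥ x)) + ε * (x ⬝ᵥ x) +
        (C.row 0 ⬝ᵥ x + D * u) ^ 2 - γ ^ 2 * u ^ 2 ≤ 0)
    (hs : IsUnit ((Complex.I * ω - l) • (1 : Matrix (Fin n) (Fin n) ℂ) - A.map Complex.ofReal)) :
    ‖transfer A B C D (Complex.I * ω - l)‖ ≤ γ := by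
  rw [transfer_eq_dotProduct]
  set z := ((Complex.I * ω - l) • (1 : Matrix (Fin n) (Fin n) ℂ) - A.map Complex.ofReal)⁻¹ *ᵥ
    (Complex.ofReal ∘ B.col 0) with hz
  have hz' : (Complex.I * ω - l) • z - A.map Complex.ofReal *ᵥ z = Complex.ofReal ∘ B.col 0 := by
    have h1 : ((Complex.I * ω - l) • (1 : Matrix (Fin n) (Fin n) ℂ) - A.map Complex.ofReal) *ᵥ z =
        Complex.ofReal ∘ B.col 0 := by
      rw [hz, mulVec_mulVec, mul_nonsing_inv _ ((Matrix.isUnit_iff_isUnit_det _).mp hs),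
        one_mulVec]
    rwa [sub_mulVec, smul_mulVec, one_mulVec] at h1
  set x : Fin n → ℝ := fun i => (z i).re
  set y : Fin n → ℝ := fun i => (z i).im
  have hx : A *ᵥ x + (1 : ℝ) • B.col 0 = -l • x - ω • y := by
    ext i
    have h1 := congrArg Complex.re (congrFun hz' i)
    simp only [Pi.sub_apply, Complex.sub_re, re_map_ofReal_mulVec] at h1
    simp at h1
    simp only [Pi.add_apply, Pi.sub_apply, Pi.smul_apply, smul_eq_mul, col_apply, x, y]
    linarith
  have hy : A *ᵥ y + (0 : ℝ) • B.col 0 = ω • x - l • y := by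
    ext i
    have h1 := congrArg Complex.im (congrFun hz' i)
    simp only [Pi.sub_apply, Complex.sub_im, im_map_ofReal_mulVec] at h1
    simp at h1
    simp only [Pi.add_apply, Pi.sub_apply, Pi.smul_apply, smul_eq_mul, x, y]
    linarith
  have hxy : x ⬝ᵥ (P *ᵥ y) = y ⬝ᵥ (P *ᵥ x) := by
    have hPt : Pᵀ = P := by simpa [IsHermitian] using hP
    rw [dotProduct_mulVec, ← mulVec_transpose, hPt, dotProduct_comm]
  have h1 := h x 1
  have h2 := h y 0
  rw [hx, sub_dotProduct, smul_dotProduct, smul_dotProduct, smul_eq_mul, smul_eq_mul] at h1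
  rw [hy, sub_dotProduct, smul_dotProduct, smul_dotProduct, smul_eq_mul, smul_eq_mul, hxy] at h2
  have hxx : 0 ≤ x ⬝ᵥ x := Finset.sum_nonneg fun i _ => mul_self_nonneg (x i)
  have hyy : 0 ≤ y ⬝ᵥ y := Finset.sum_nonneg fun i _ => mul_self_nonneg (y i)
  have hsq : ‖(Complex.ofReal ∘ C.row 0) ⬝ᵥ z + D‖ ^ 2 =
      (C.row 0 ⬝ᵥ x + D * 1) ^ 2 + (C.row 0 ⬝ᵥ y + D * 0) ^ 2 := by
    rw [Complex.sq_norm, Complex.normSq_apply, ← sq, ← sq]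
    congr 2 <;> simp [dotProduct, x, y]
  refine le_of_sq_le_sq ?_ hγ.le
  rw [hsq]
  nlinarith [mul_nonneg hε hxx, mul_nonneg hε hyy]

theorem re_star_dotProduct_map_mulVec_lt_zero {P : Matrix (Fin n) (Fin n) ℝ} {l : ℝ}
    (h : ∀ x : Fin n → ℝ, x ≠ 0 → (A *ᵥ x + l • x) ⬝ᵥ (P *ᵥ x) < 0) (hP : P.IsHermitian)
    (z : Fin n → ℂ) (hz : z ≠ 0) :
    (star z ⬝ᵥ (P.map Complex.ofReal *ᵥ
      (A.map Complex.ofReal *ᵥ z + (l : ℂ) • z))).re < 0 := by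
  have hPt : Pᵀ = P := by simpa [IsHermitian] using hP
  set x : Fin n → ℝ := fun i => (z i).re with hx
  set y : Fin n → ℝ := fun i => (z i).im with hy
  have h1 : (star z ⬝ᵥ (P.map Complex.ofReal *ᵥ
      (A.map Complex.ofReal *ᵥ z + (l : ℂ) • z))).re =
      (A *ᵥ x + l • x) ⬝ᵥ (P *ᵥ x) + (A *ᵥ y + l • y) ⬝ᵥ (P *ᵥ y) := by
    have hsymm (v w : Fin n → ℝ) : v ⬝ᵥ (P *ᵥ w) = w ⬝ᵥ (P *ᵥ v) := by
      rw [dotProduct_mulVec, ← mulVec_transpose, hPt, dotProduct_comm]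
    rw [hsymm _ x, hsymm _ y]
    have hre : (fun i => ((A.map Complex.ofReal *ᵥ z + (l : ℂ) • z) i).re) = A *ᵥ x + l • x := by
      ext i
      simp [re_map_ofReal_mulVec, x]
    have him : (fun i => ((A.map Complex.ofReal *ᵥ z + (l : ℂ) • z) i).im) = A *ᵥ y + l • y := by
      ext i
      simp [im_map_ofReal_mulVec, y]
    rw [← hre, ← him]
    simp only [dotProduct, Complex.re_sum, ← Finset.sum_add_distrib]
    refine Finset.sum_congr rfl fun i _ => ?_
    rw [← re_map_ofReal_mulVec, ← im_map_ofReal_mulVec, Complex.mul_re]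
    simp [x, y]
  have h0 : ∀ v : Fin n → ℝ, (A *ᵥ v + l • v) ⬝ᵥ (P *ᵥ v) ≤ 0 := fun v => by
    by_cases hv : v = 0
    · simp [hv]
    · exact (h v hv).le
  rw [h1]
  by_cases hx0 : x = 0
  · have hy0 : y ≠ 0 := fun hy0 => hz (by
      ext i
      exact Complex.ext (congrFun hx0 i) (congrFun hy0 i))
    linarith [h0 x, h y hy0]
  · linarith [h0 y, h x hx0]

theorem mem_roots_re_dichotomy {p : ℕ} {llo lhi : ℝ} (hl : llo < lhi)
    (hsplit₁ : ((A.map (Complex.ofReal)).charpoly.roots.filter fun μ => -llo < μ.re).card = p)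
    (hsplit₂ : ((A.map (Complex.ofReal)).charpoly.roots.filter
      fun μ => μ.re < -lhi).card = n - p) {μ : ℂ}
    (hμ : μ ∈ (A.map Complex.ofReal).charpoly.roots) : -llo < μ.re ∨ μ.re < -lhi := by
  set R := (A.map Complex.ofReal).charpoly.roots
  have hR : R.card = n := by
    rw [IsAlgClosed.card_roots_eq_natDegree, charpoly_natDegree_eq_dim, Fintype.card_fin]
  by_contra! hcon
  have h1 := congrArg Multiset.card (Multiset.filter_add_not (fun μ : ℂ => -llo < μ.re) R)
  rw [Multiset.card_add, hR, hsplit₁] at h1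
  have h2 : R.filter (fun μ : ℂ => μ.re < -lhi) ≤ R.filter (fun μ : ℂ => ¬ -llo < μ.re) :=
    Multiset.monotone_filter_right _ fun ν hν => by linarith
  have h3 := Multiset.eq_of_le_of_card_le h2 (by omega)
  have h4 : μ ∈ R.filter (fun μ : ℂ => ¬ -llo < μ.re) :=
    Multiset.mem_filter.mpr ⟨hμ, not_lt.mpr hcon.1⟩
  rw [← h3] at h4
  exact absurd (Multiset.of_mem_filter h4) (not_lt.mpr hcon.2)

theorem exists_lmi_of_forall_norm_transfer_le {p : ℕ} {llo lhi : ℝ}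
    (hsplit₁ : ((A.map (Complex.ofReal)).charpoly.roots.filter fun μ => -llo < μ.re).card = p)
    (hsplit₂ : ((A.map (Complex.ofReal)).charpoly.roots.filter
      fun μ => μ.re < -lhi).card = n - p) {l M γ : ℝ} (hl : l ∈ Set.Ioo llo lhi)
    (hM : ∀ ω : ℝ, ‖transfer A B C D (Complex.I * ω - l)‖ ≤ M) (hγ : M < γ) :
    0 < γ ∧ ∃ ε : ℝ, 0 ≤ ε ∧ ∃ P : Matrix (Fin n) (Fin n) ℝ, ∃ hP : P.IsHermitian,
      (Finset.univ.filter fun i => hP.eigenvalues i < 0).card = p ∧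
      (Finset.univ.filter fun i => 0 < hP.eigenvalues i).card = n - p ∧
      (∀ i, hP.eigenvalues i ≠ 0) ∧
      (-(Matrix.fromBlocks
          (Aᵀ * P + P * A + (2 * l) • P + ε • (1 : Matrix (Fin n) (Fin n) ℝ) + Cᵀ * C)
          (P * B + D • Cᵀ)
          (Bᵀ * P + D • C)
          ((D ^ 2 - γ ^ 2) • (1 : Matrix (Fin 1) (Fin 1) ℝ)))).PosSemidef := by
  have hroots {μ : ℂ} (hμ : μ ∈ (A.map Complex.ofReal).charpoly.roots) :
      -llo < μ.re ∨ μ.re < -lhi :=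
    mem_roots_re_dichotomy A (hl.1.trans hl.2) hsplit₁ hsplit₂ hμ
  have hD : |D| < γ := (abs_le_of_forall_norm_transfer_le A B C D hM).trans_lt hγ
  have hmap : (A + l • (1 : Matrix (Fin n) (Fin n) ℝ)).map Complex.ofReal =
      A.map Complex.ofReal + (l : ℂ) • (1 : Matrix (Fin n) (Fin n) ℂ) := by
    ext i j
    by_cases hij : i = j <;> simp [hij]
  have hshift (ω : ℝ) : (Complex.I * ω) • (1 : Matrix (Fin n) (Fin n) ℂ) -
      (A + l • (1 : Matrix (Fin n) (Fin n) ℝ)).map Complex.ofReal =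
      (Complex.I * ω - l) • (1 : Matrix (Fin n) (Fin n) ℂ) - A.map Complex.ofReal := by
    rw [hmap, sub_smul]
    abel
  obtain ⟨P, hPs, ε, hε, hq⟩ := exists_symm_of_norm_transfer_lt
    (A + l • (1 : Matrix (Fin n) (Fin n) ℝ)) (B.col 0) (C.row 0) D γ
    (fun ω => by
      rw [hshift]
      refine isUnit_smul_one_sub_of_not_mem_roots fun h => ?_
      have h1 := hroots h
      simp at h1
      rcases h1 with h1 | h1 <;> linarith [hl.1, hl.2])
    (fun ω => by
      rw [hshift, ← transfer_eq_dotProduct]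
      exact (hM ω).trans_lt hγ) hD
  have hP : P.IsHermitian := hPs.eq
  have hA (x : Fin n → ℝ) : (A + l • (1 : Matrix (Fin n) (Fin n) ℝ)) *ᵥ x = A *ᵥ x + l • x := by
    rw [add_mulVec, smul_mulVec, one_mulVec]
  have hneg (x : Fin n → ℝ) (hx : x ≠ 0) : (A *ᵥ x + l • x) ⬝ᵥ (P *ᵥ x) < 0 := by
    have h1 := hq x 0
    have h2 : 0 < x ⬝ᵥ x :=
      lt_of_le_of_ne (Finset.sum_nonneg fun i _ => mul_self_nonneg (x i))
        fun h => hx (dotProduct_self_eq_zero.mp h.symm)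
    rw [hA, zero_smul, add_zero] at h1
    nlinarith [mul_pos hε h2, sq_nonneg (C.row 0 ⬝ᵥ x + D * 0)]
  have hcount {σ : ℝ} (hσ : σ ≠ 0) := card_filter_roots_le_card_filter_eigenvalues
    (A.map Complex.ofReal) l hP (re_star_dotProduct_map_mulVec_lt_zero A hneg hP) hσ
  have hp : p ≤ (Finset.univ.filter fun i => hP.eigenvalues i < 0).card := by
    have h1 := hcount one_ne_zero
    simp only [one_mul] at h1
    refine le_trans (le_of_eq ?_) h1
    rw [← hsplit₁]
    congr 1
    refine Multiset.filter_congr fun μ hμ => ⟨fun h => by linarith [hl.1], fun h => ?_⟩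
    rcases hroots hμ with h2 | h2
    · exact h2
    · linarith [hl.2]
  have hnp : n - p ≤ (Finset.univ.filter fun i => 0 < hP.eigenvalues i).card := by
    have h1 := hcount (neg_ne_zero.mpr one_ne_zero)
    simp only [neg_mul, one_mul, Left.neg_neg_iff] at h1
    refine le_trans (le_of_eq ?_) h1
    rw [← hsplit₂]
    congr 1
    refine Multiset.filter_congr fun μ hμ => ⟨fun h => by linarith [hl.2], fun h => ?_⟩
    rcases hroots hμ with h2 | h2
    · linarith [hl.1]
    · exact h2
  have hdisj : Disjoint (Finset.univ.filter fun i => hP.eigenvalues i < 0)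
      (Finset.univ.filter fun i => 0 < hP.eigenvalues i) :=
    Finset.disjoint_filter.mpr fun i _ h => h.le.not_gt
  have hcard : (Finset.univ.filter fun i => hP.eigenvalues i < 0).card +
      (Finset.univ.filter fun i => 0 < hP.eigenvalues i).card ≤ n := by
    rw [← Finset.card_union_of_disjoint hdisj]
    exact (Finset.card_le_univ _).trans_eq (Fintype.card_fin n)
  refine ⟨(abs_nonneg D).trans_lt hD, ε, hε.le, P, hP, by omega, by omega, fun i hi => ?_,
    (posSemidef_neg_fromBlocks_iff A B C D hP l ε γ).mpr fun x u => ?_⟩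
  · have h1 : (Finset.univ.filter fun i => hP.eigenvalues i < 0) ∪
        (Finset.univ.filter fun i => 0 < hP.eigenvalues i) = Finset.univ := by
      rw [← Finset.card_eq_iff_eq_univ, Finset.card_union_of_disjoint hdisj, Fintype.card_fin]
      omega
    have h2 := h1 ▸ Finset.mem_univ i
    simp [hi] at h2
  · have h1 := hq x u
    rw [hA, add_right_comm, add_dotProduct, smul_dotProduct, smul_eq_mul] at h1
    nlinarith [mul_nonneg hε.le (sq_nonneg u)]

end Transfer

theorem Real.le_biSup_of_forall_le {α : Type*} {S : Set α} {f : α → ℝ} {K : ℝ} (hK : 0 ≤ K)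
    (hf : ∀ i ∈ S, f i ≤ K) {i : α} (hi : i ∈ S) : f i ≤ ⨆ j ∈ S, f j := by
  have h1 : BddAbove (Set.range fun j => ⨆ _ : j ∈ S, f j) :=
    ⟨K, Set.forall_mem_range.mpr fun j => Real.iSup_le (hf j) hK⟩
  refine le_trans (le_of_eq ?_) (le_ciSup h1 i)
  rw [ciSup_pos hi]

/-- Theorem 10 of the paper: the `L_{2,p}(ℝ_Λ)`-gain `sup_{λ∈(λ̲,λ̄)} γ_λ` equals the
`H_{∞,p}` norm `sup_{s∈S} |C(sI-A)⁻¹B + D|` of the transfer function on the strip. -/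
theorem gain_eq_Hinf_norm (n p : ℕ) (llo lhi : ℝ) (hl : llo < lhi)
    (A : Matrix (Fin n) (Fin n) ℝ) (B : Matrix (Fin n) (Fin 1) ℝ)
    (C : Matrix (Fin 1) (Fin n) ℝ) (D : ℝ)
    (hsplit₁ : ((A.map (Complex.ofReal)).charpoly.roots.filter
        fun μ => -llo < μ.re).card = p)
    (hsplit₂ : ((A.map (Complex.ofReal)).charpoly.roots.filter
        fun μ => μ.re < -lhi).card = n - p) :
    (⨆ l ∈ Set.Ioo llo lhi, gainRate n p A B C D l) =
      ⨆ s ∈ strip llo lhi,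
        ‖(C.map (Complex.ofReal) *
            (s • (1 : Matrix (Fin n) (Fin n) ℂ) - A.map (Complex.ofReal))⁻¹ *
          B.map (Complex.ofReal)) 0 0 + (D : ℂ)‖ := by
  change _ = ⨆ s ∈ strip llo lhi, ‖transfer A B C D s‖
  have hK : IsClosed {s : ℂ | -lhi ≤ s.re ∧ s.re ≤ -llo} :=
    (isClosed_le continuous_const Complex.continuous_re).inter
      (isClosed_le Complex.continuous_re continuous_const)
  have hunit (s : ℂ) (hs : -lhi ≤ s.re ∧ s.re ≤ -llo) :
      IsUnit (s • (1 : Matrix (Fin n) (Fin n) ℂ) - A.map Complex.ofReal) := by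
    refine isUnit_smul_one_sub_of_not_mem_roots fun h => ?_
    rcases mem_roots_re_dichotomy A hl hsplit₁ hsplit₂ h with h1 | h1
    · exact absurd hs.2 (not_le.mpr h1)
    · exact absurd hs.1 (not_le.mpr h1)
  obtain ⟨K, hK⟩ := exists_norm_transfer_le A B C D hK hunit
  have hK0 : 0 ≤ K := by
    refine (norm_nonneg _).trans (hK ((-llo : ℝ) : ℂ) ?_)
    simp [hl.le]
  set M := ⨆ s ∈ strip llo lhi, ‖transfer A B C D s‖
  have hM0 : 0 ≤ M := Real.iSup_nonneg fun s => Real.iSup_nonneg fun _ => norm_nonneg _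
  have hM (s : ℂ) (hs : s ∈ strip llo lhi) : ‖transfer A B C D s‖ ≤ M :=
    Real.le_biSup_of_forall_le (f := fun s => ‖transfer A B C D s‖) hK0
      (fun s hs => hK s ⟨hs.1.le, hs.2.le⟩) hs
  have hmem (l : ℝ) (hl : l ∈ Set.Ioo llo lhi) (ω : ℝ) :
      Complex.I * ω - l ∈ strip llo lhi := by
    simpa [strip] using And.intro hl.2 hl.1
  have hfeas (l : ℝ) (hl : l ∈ Set.Ioo llo lhi) {γ : ℝ} (hγ : M < γ) :=
    exists_lmi_of_forall_norm_transfer_le A B C D hsplit₁ hsplit₂ hl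
      (fun ω => hM _ (hmem l hl ω)) hγ
  have hle (l : ℝ) (hl : l ∈ Set.Ioo llo lhi) : gainRate n p A B C D l ≤ M :=
    le_of_forall_gt_imp_ge_of_dense fun γ hγ =>
      csInf_le ⟨0, fun _ h => h.1.le⟩ (hfeas l hl hγ)
  refine le_antisymm (Real.iSup_le (fun l => Real.iSup_le (hle l) hM0) hM0) ?_
  have hgain0 (l : ℝ) : 0 ≤ gainRate n p A B C D l := Real.sInf_nonneg fun _ h => h.1.le
  have hL0 : 0 ≤ ⨆ l ∈ Set.Ioo llo lhi, gainRate n p A B C D l :=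
    Real.iSup_nonneg fun l => Real.iSup_nonneg fun _ => hgain0 l
  refine Real.iSup_le (fun s => Real.iSup_le (fun hs => ?_) hL0) hL0
  have hsl : -s.re ∈ Set.Ioo llo lhi := ⟨by linarith [hs.2], by linarith [hs.1]⟩
  refine le_trans ?_ (Real.le_biSup_of_forall_le hM0 hle hsl)
  refine le_csInf ⟨M + 1, hfeas _ hsl (lt_add_one M)⟩ ?_
  rintro γ ⟨hγ, ε, hε, P, hP, -, -, -, hPos⟩
  have hs' : Complex.I * (s.im : ℂ) - ((-s.re : ℝ) : ℂ) = s := by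
    apply Complex.ext <;> simp
  have h1 := norm_transfer_le_of_forall_quadratic_le A B C D hP (ω := s.im) hε hγ
    ((posSemidef_neg_fromBlocks_iff A B C D hP _ _ _).mp hPos)
    (by rw [hs']; exact hunit s ⟨hs.1.le, hs.2.le⟩)
  rwa [hs'] at h1
end

section
/- Let f : ℝ → ℂ be measurable and integrable on every bounded interval, and let λ ∈ ℝ be such that t ↦ f(t)e^{λt} is integrable on ℝ, so that F(s) = ∫_{-∞}^{∞} f(τ)e^{-sτ} dτ is defined for all s with Re(s) = -λ. Let t₀ ∈ ℝ and suppose f has bounded variation on some open interval containing t₀ and is continuous at t₀. Then f(t₀) = lim_{Ω→∞} (1/2π) ∫_{-Ω}^{Ω} F(-λ + iω) e^{(-λ + iω)t₀} dω. -/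
open MeasureTheory Filter

section LaplaceInversion

open Set Topology

open scoped Real

theorem abs_integral_sinc_le_div {a b : ℝ} (ha : 0 < a) (hab : a ≤ b) :
    |∫ x in a..b, Real.sinc x| ≤ 2 / a := by
  have hb : 0 < b := ha.trans_le hab
  have hpos : ∀ x ∈ uIcc a b, x ≠ 0 := fun x hx => by
    rw [uIcc_of_le hab] at hx
    exact (ha.trans_le hx.1).ne'
  have key : ∀ c : ℝ, (∫ x in a..b, (Real.sin x / x + (Real.cos x + c) / x ^ 2)) =
      (Real.cos a + c) / a - (Real.cos b + c) / b ∧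
      IntervalIntegrable (fun x => Real.sin x / x + (Real.cos x + c) / x ^ 2) volume a b := by
    intro c
    have hcont : IntervalIntegrable (fun x => Real.sin x / x + (Real.cos x + c) / x ^ 2)
        volume a b := by
      apply ContinuousOn.intervalIntegrable
      apply ContinuousOn.add
      · exact Real.continuous_sin.continuousOn.div continuousOn_id hpos
      · exact (by fun_prop : Continuous fun x => Real.cos x + c).continuousOn.div
          (by fun_prop) fun x hx => pow_ne_zero 2 (hpos x hx)
    refine ⟨?_, hcont⟩
    rw [intervalIntegral.integral_eq_sub_of_hasDerivAt
      (f := fun x => -((Real.cos x + c) / x)) (fun x hx => ?_) hcont]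
    · ring
    · have hx0 := hpos x hx
      refine ((((Real.hasDerivAt_cos x).add_const c).div (hasDerivAt_id' x) hx0).neg).congr_deriv ?_
      field
  have hint : IntervalIntegrable Real.sinc volume a b :=
    Real.continuous_sinc.intervalIntegrable a b
  have hsinc : ∀ x ∈ Icc a b, Real.sinc x = Real.sin x / x := fun x hx =>
    Real.sinc_of_ne_zero (ha.trans_le hx.1).ne'
  have hinv : 0 < a⁻¹ := inv_pos.2 ha
  have hinv' : 0 < b⁻¹ := inv_pos.2 hb
  rw [abs_le]
  constructor
  · have h := intervalIntegral.integral_mono_on hab (key (-1)).2 hint fun x hx => by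
      rw [hsinc x hx, add_le_iff_nonpos_right]
      exact div_nonpos_of_nonpos_of_nonneg (by linarith [Real.cos_le_one x]) (sq_nonneg x)
    rw [(key (-1)).1] at h
    simp only [div_eq_mul_inv] at h ⊢
    nlinarith [Real.cos_le_one b, Real.neg_one_le_cos a]
  · have h := intervalIntegral.integral_mono_on hab hint (key 1).2 fun x hx => by
      rw [hsinc x hx, le_add_iff_nonneg_right]
      exact div_nonneg (by linarith [Real.neg_one_le_cos x]) (sq_nonneg x)
    rw [(key 1).1] at h
    simp only [div_eq_mul_inv] at h ⊢
    nlinarith [Real.neg_one_le_cos b, Real.cos_le_one a]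

theorem abs_integral_sinc_le {a b : ℝ} (ha : 0 ≤ a) (hab : a ≤ b) :
    |∫ x in a..b, Real.sinc x| ≤ 3 := by
  have hunit : ∀ {c d : ℝ}, 0 ≤ c → c ≤ d → d ≤ 1 → |∫ x in c..d, Real.sinc x| ≤ 1 := by
    intro c d hc hcd hd
    have h := intervalIntegral.norm_integral_le_of_norm_le_const (a := c) (b := d) (C := 1)
      (f := Real.sinc) fun x _ => Real.abs_sinc_le_one x
    rw [Real.norm_eq_abs, abs_of_nonneg (sub_nonneg.2 hcd)] at h
    linarith
  rcases le_total b 1 with hb | hb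
  · linarith [hunit ha hab hb]
  rcases le_total 1 a with h1 | h1
  · have h := abs_integral_sinc_le_div (by linarith) hab
    have : 2 / a ≤ 2 := div_le_self (by norm_num) h1
    linarith
  · rw [← intervalIntegral.integral_add_adjacent_intervals (b := 1)
      (Real.continuous_sinc.intervalIntegrable _ _) (Real.continuous_sinc.intervalIntegrable _ _)]
    have h := abs_integral_sinc_le_div one_pos hb
    have h' := hunit ha h1 le_rfl
    have := abs_add_le (∫ x in a..1, Real.sinc x) (∫ x in 1..b, Real.sinc x)
    linarith

theorem continuous_mul_sinc_mul (W : ℝ) : Continuous fun u => W * Real.sinc (W * u) :=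
  continuous_const.mul (Real.continuous_sinc.comp (continuous_const.mul continuous_id))

theorem integral_mul_sinc_mul (W a b : ℝ) :
    ∫ u in a..b, W * Real.sinc (W * u) = ∫ x in (W * a)..(W * b), Real.sinc x := by
  rw [intervalIntegral.integral_const_mul, intervalIntegral.mul_integral_comp_mul_left]

/-- Layer-cake formula for the integral of a monotone weight against a continuous function. -/
theorem integral_monotone_mul_eq_integral_superlevel {Q φ : ℝ → ℝ} (hQ : Monotone Q) {δ : ℝ}
    (hQ0 : ∀ u, 0 < u → 0 ≤ Q u) (hφ : Continuous φ) :
    ∫ u in Ioc 0 δ, Q u * φ u =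
      ∫ s in Ioo 0 (Q δ), ∫ u in Ioc 0 δ, {u | s < Q u}.indicator φ u := by
  have hmeas : MeasurableSet {z : ℝ × ℝ | z.2 < Q z.1} :=
    measurableSet_lt measurable_snd (hQ.measurable.comp measurable_fst)
  have hint : Integrable (Function.uncurry fun u s => {u | s < Q u}.indicator φ u)
      ((volume.restrict (Ioc 0 δ)).prod (volume.restrict (Ioo 0 (Q δ)))) := by
    have h1 : Integrable φ (volume.restrict (Ioc 0 δ)) :=
      (hφ.integrableOn_Icc (a := 0) (b := δ)).mono_set Ioc_subset_Icc_self
    have h2 : Integrable (fun _ : ℝ => (1 : ℝ)) (volume.restrict (Ioo 0 (Q δ))) :=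
      integrable_const 1
    refine ((h1.mul_prod h2).indicator hmeas).congr (Eventually.of_forall ?_)
    rintro ⟨u, s⟩
    simp [Function.uncurry, indicator]
  rw [← integral_integral_swap hint]
  refine setIntegral_congr_fun measurableSet_Ioc fun u hu => ?_
  have h0 := hQ0 u hu.1
  have h1 := hQ hu.2
  have : ∀ s, {u | s < Q u}.indicator φ u = (Iio (Q u)).indicator (fun _ => φ u) s := by
    intro s
    simp [indicator]
  simp only [this]
  rw [setIntegral_indicator measurableSet_Iio, setIntegral_const]
  have : Ioo 0 (Q δ) ∩ Iio (Q u) = Ioo 0 (Q u) := by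
    ext s
    simp only [mem_inter_iff, mem_Ioo, mem_Iio]
    grind
  rw [this]
  simp [Measure.real, h0]

theorem exists_setIntegral_superlevel_eq {Q : ℝ → ℝ} (hQ : Monotone Q) {δ s η : ℝ}
    (hη : 0 < η) (hsη : Q η ≤ s) (hsδ : s < Q δ) :
    ∃ x, 0 < x ∧ x ≤ δ ∧ ∀ φ : ℝ → ℝ,
      ∫ u in Ioc 0 δ, {u | s < Q u}.indicator φ u = ∫ u in x..δ, φ u := by
  set A := {u | s < Q u} with hA
  have hlow : ∀ u ∈ A, η ≤ u := fun u hu => by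
    by_contra! h
    exact absurd (hQ h.le) (not_le.2 (hsη.trans_lt hu))
  have hbdd : BddBelow A := ⟨η, hlow⟩
  have hmeas : MeasurableSet A := measurableSet_lt measurable_const hQ.measurable
  have hx : η ≤ sInf A := le_csInf ⟨δ, hsδ⟩ hlow
  have hxδ : sInf A ≤ δ := csInf_le hbdd hsδ
  refine ⟨sInf A, hη.trans_le hx, hxδ, fun φ => ?_⟩
  rw [setIntegral_indicator hmeas, intervalIntegral.integral_of_le hxδ]
  apply setIntegral_congr_set
  have hsub1 : Ioc (sInf A) δ ⊆ Ioc 0 δ ∩ A := fun u hu => by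
    obtain ⟨v, hv, hvu⟩ := (csInf_lt_iff hbdd ⟨δ, hsδ⟩).1 hu.1
    exact ⟨⟨hη.trans_le (hx.trans hu.1.le), hu.2⟩, lt_of_lt_of_le hv (hQ hvu.le)⟩
  have hsub2 : Ioc 0 δ ∩ A ⊆ Icc (sInf A) δ := fun u hu => ⟨csInf_le hbdd hu.2, hu.1.2⟩
  have h1 : (Ioc 0 δ ∩ A : Set ℝ) ≤ᵐ[volume] Ioc (sInf A) δ :=
    hsub2.eventuallyLE.trans (Ioc_ae_eq_Icc (μ := volume)).symm.le
  exact h1.antisymm hsub1.eventuallyLE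

/-- Dirichlet's lemma: the Dirichlet kernel annihilates, in the limit, a monotone function
vanishing at `0⁺`. -/
theorem tendsto_integral_monotone_mul_sinc {Q : ℝ → ℝ} (hQ : Monotone Q)
    (hQ0 : Tendsto Q (𝓝[>] 0) (𝓝 0)) {δ : ℝ} (hδ : 0 < δ) :
    Tendsto (fun W : ℝ => ∫ u in 0..δ, Q u * (W * Real.sinc (W * u))) atTop (𝓝 0) := by
  have hnn : ∀ u, 0 < u → 0 ≤ Q u := fun u hu =>
    le_of_tendsto hQ0 (by filter_upwards [Ioo_mem_nhdsGT hu] with v hv using hQ hv.2.le)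
  have hrep : ∀ s ∈ Ioo 0 (Q δ), ∃ x, 0 < x ∧ x ≤ δ ∧ ∀ φ : ℝ → ℝ,
      ∫ u in Ioc 0 δ, {u | s < Q u}.indicator φ u = ∫ u in x..δ, φ u := by
    intro s hs
    obtain ⟨η, hη, hη'⟩ := ((hQ0.eventually_lt_const hs.1).and self_mem_nhdsWithin).exists
    exact exists_setIntegral_superlevel_eq hQ hη' hη.le hs.2
  simp_rw [intervalIntegral.integral_of_le hδ.le]
  simp_rw [fun W => integral_monotone_mul_eq_integral_superlevel hQ (δ := δ) hnn
    (continuous_mul_sinc_mul W)]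
  rw [show 𝓝 (0 : ℝ) = 𝓝 (∫ s in Ioo 0 (Q δ), (0 : ℝ)) by simp]
  refine tendsto_integral_filter_of_dominated_convergence (fun _ => 3) ?_ ?_
    (integrable_const 3) ?_
  · refine Eventually.of_forall fun W => ?_
    have hmeas : MeasurableSet {z : ℝ × ℝ | z.1 < Q z.2} :=
      measurableSet_lt measurable_fst (hQ.measurable.comp measurable_snd)
    have : StronglyMeasurable (Function.uncurry fun s u : ℝ =>
        {u | s < Q u}.indicator (fun u => W * Real.sinc (W * u)) u) := by
      convert (((continuous_mul_sinc_mul W).comp continuous_snd).stronglyMeasurable.indicator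
        hmeas : StronglyMeasurable _) using 1
      ext ⟨s, u⟩
      simp [Function.uncurry, indicator]
    exact this.integral_prod_right.aestronglyMeasurable
  · filter_upwards [eventually_ge_atTop 0] with W hW
    filter_upwards [ae_restrict_mem measurableSet_Ioo] with s hs
    obtain ⟨x, hx, hxδ, h⟩ := hrep s hs
    rw [h, integral_mul_sinc_mul]
    exact abs_integral_sinc_le (by positivity) (by gcongr)
  · filter_upwards [ae_restrict_mem measurableSet_Ioo] with s hs
    obtain ⟨x, hx, hxδ, h⟩ := hrep s hs
    simp_rw [h, integral_mul_sinc_mul]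
    have hlim : Tendsto (fun W : ℝ => 2 / (W * x)) atTop (𝓝 0) :=
      tendsto_const_nhds.div_atTop (tendsto_id.atTop_mul_const hx)
    refine squeeze_zero_norm' ?_ hlim
    filter_upwards [eventually_gt_atTop 0] with W hW
    exact abs_integral_sinc_le_div (by positivity) (by gcongr)

/-- Dirichlet's lemma for real functions of bounded variation vanishing at `0⁺`. -/
theorem tendsto_integral_boundedVariationOn_mul_sinc {b : ℝ → ℝ} {δ : ℝ} (hδ : 0 < δ)
    (hb : BoundedVariationOn b (Icc 0 δ)) (hb0 : Tendsto b (𝓝[>] 0) (𝓝 0)) :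
    Tendsto (fun W : ℝ => ∫ u in 0..δ, b u * (W * Real.sinc (W * u))) atTop (𝓝 0) := by
  obtain ⟨p, q, hp, hq, hpq⟩ :=
    hb.locallyBoundedVariationOn.exists_monotoneOn_sub_monotoneOn
  have hext : ∀ {r : ℝ → ℝ}, MonotoneOn r (Icc 0 δ) → ∃ R, Monotone R ∧ EqOn r R (Icc 0 δ) :=
    fun {r} hr => hr.exists_monotone_extension
      (hr.map_bddBelow subset_rfl ⟨0, fun _ hx => hx.1, left_mem_Icc.2 hδ.le⟩)
      (hr.map_bddAbove subset_rfl ⟨δ, fun _ hx => hx.2, right_mem_Icc.2 hδ.le⟩)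
  obtain ⟨P, hP, hpP⟩ := hext hp
  obtain ⟨Q, hQ, hqQ⟩ := hext hq
  have heq : ∀ u ∈ Icc 0 δ, b u = P u - Q u := fun u hu => by
    rw [hpq, Pi.sub_apply, hpP hu, hqQ hu]
  have hPlim := hP.tendsto_rightLim 0
  have hQlim := hQ.tendsto_rightLim 0
  have hL : P.rightLim 0 - Q.rightLim 0 = 0 := by
    refine tendsto_nhds_unique ((hPlim.sub hQlim).congr' ?_) hb0
    filter_upwards [Ioc_mem_nhdsGT hδ] with u hu
    exact (heq u (Ioc_subset_Icc_self hu)).symm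
  have hzero : ∀ {R : ℝ → ℝ}, Monotone R → Tendsto
      (fun W : ℝ => ∫ u in 0..δ, (R u - R.rightLim 0) * (W * Real.sinc (W * u))) atTop (𝓝 0) := by
    intro R hR
    refine tendsto_integral_monotone_mul_sinc (Q := fun u => R u - R.rightLim 0)
      (fun x y hxy => sub_le_sub_right (hR hxy) _) ?_ hδ
    simpa using (hR.tendsto_rightLim 0).sub_const (R.rightLim 0)
  have hint : ∀ {R : ℝ → ℝ}, Monotone R → ∀ W : ℝ, IntervalIntegrable
      (fun u => (R u - R.rightLim 0) * (W * Real.sinc (W * u))) volume 0 δ := fun hR W =>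
    (hR.intervalIntegrable.sub intervalIntegrable_const).mul_continuousOn
      (continuous_mul_sinc_mul W).continuousOn
  have := (hzero hP).sub (hzero hQ)
  rw [sub_zero] at this
  refine this.congr fun W => ?_
  rw [← intervalIntegral.integral_sub (hint hP W) (hint hQ W)]
  refine intervalIntegral.integral_congr fun u hu => ?_
  rw [uIcc_of_le hδ.le] at hu
  simp only [heq u hu]
  linear_combination (-(W * Real.sinc (W * u))) * hL

/-- Dirichlet's lemma for complex functions of bounded variation vanishing at `0⁺`. -/
theorem tendsto_integral_complex_boundedVariationOn_mul_sinc {b : ℝ → ℂ} {δ : ℝ} (hδ : 0 < δ)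
    (hb : BoundedVariationOn b (Icc 0 δ)) (hb0 : Tendsto b (𝓝[>] 0) (𝓝 0))
    (hbint : IntervalIntegrable b volume 0 δ) :
    Tendsto (fun W : ℝ => ∫ u in 0..δ, b u * ((W * Real.sinc (W * u) : ℝ) : ℂ)) atTop (𝓝 0) := by
  have hre := tendsto_integral_boundedVariationOn_mul_sinc hδ
    (b := fun u => (b u).re)
    ((Complex.reCLM.lipschitz.comp_boundedVariationOn hb))
    ((Complex.continuous_re.tendsto 0).comp hb0)
  have him := tendsto_integral_boundedVariationOn_mul_sinc hδ
    (b := fun u => (b u).im)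
    ((Complex.imCLM.lipschitz.comp_boundedVariationOn hb))
    ((Complex.continuous_im.tendsto 0).comp hb0)
  have hlim := ((Complex.continuous_ofReal.tendsto 0).comp hre).add
    (((Complex.continuous_ofReal.tendsto 0).comp him).mul_const Complex.I)
  simp only [Complex.ofReal_zero, zero_mul, add_zero] at hlim
  refine hlim.congr fun W => ?_
  have hK := (continuous_mul_sinc_mul W).continuousOn (s := uIcc 0 δ)
  have hofReal : ∀ {k : ℝ → ℝ}, IntervalIntegrable k volume 0 δ →
      IntervalIntegrable (fun u => (k u : ℂ)) volume 0 δ := fun hk => ⟨hk.1.ofReal, hk.2.ofReal⟩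
  have hre_int : IntervalIntegrable (fun u => (b u).re * (W * Real.sinc (W * u))) volume 0 δ :=
    IntervalIntegrable.mul_continuousOn ⟨hbint.1.re, hbint.2.re⟩ hK
  have him_int : IntervalIntegrable (fun u => (b u).im * (W * Real.sinc (W * u))) volume 0 δ :=
    IntervalIntegrable.mul_continuousOn ⟨hbint.1.im, hbint.2.im⟩ hK
  simp only [Function.comp_apply]
  rw [← intervalIntegral.integral_ofReal, ← intervalIntegral.integral_ofReal,
    ← intervalIntegral.integral_mul_const, ← intervalIntegral.integral_add
      (hofReal hre_int) ((hofReal him_int).mul_const _)]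
  refine intervalIntegral.integral_congr fun u _ => ?_
  simp only [Complex.ofReal_mul]
  conv_rhs => rw [← Complex.re_add_im (b u)]
  ring

/-- The Riemann–Lebesgue lemma for the sine transform. -/
theorem tendsto_integral_mul_sin {k : ℝ → ℂ} (hk : Integrable k) :
    Tendsto (fun W : ℝ => ∫ u, k u * (Real.sin (W * u) : ℂ)) atTop (𝓝 0) := by
  have h := Real.tendsto_integral_exp_smul_cocompact k
  have hw : Tendsto (fun W : ℝ => W / (2 * π)) atTop atTop :=
    tendsto_id.atTop_div_const (by positivity)
  have h1 := (h.mono_left atTop_le_cocompact).comp hw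
  have h2 := (h.mono_left atBot_le_cocompact).comp (tendsto_neg_atTop_atBot.comp hw)
  have h3 := (h1.sub h2).mul_const (Complex.I / 2)
  rw [sub_zero, zero_mul] at h3
  refine h3.congr fun W => ?_
  have hint : ∀ w : ℝ, Integrable fun v => Real.fourierChar (-(v * w)) • k v := fun w =>
    (VectorFourier.fourierIntegral_convergent_iff Real.continuous_fourierChar
      (L := LinearMap.mul ℝ ℝ) continuous_mul w).2 hk
  simp only [Function.comp_apply]
  rw [← integral_sub (hint _) (hint _), ← integral_mul_const]
  congr 1 with u
  simp only [Circle.smul_def, Real.fourierChar_apply, smul_eq_mul, Complex.ofReal_sin,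
    Complex.sin]
  have e1 : ((2 * π * -(u * (W / (2 * π))) : ℝ) : ℂ) * Complex.I =
      -((W * u : ℝ) : ℂ) * Complex.I := by
    congr 1
    norm_cast
    field
  have e2 : ((2 * π * -(u * -(W / (2 * π))) : ℝ) : ℂ) * Complex.I =
      ((W * u : ℝ) : ℂ) * Complex.I := by
    congr 1
    norm_cast
    field
  rw [e1, e2]
  ring

theorem tendsto_integral_mul_sinc_of_integrable_div {r : ℝ → ℂ}
    (hr : Integrable fun u : ℝ => r u / u) :
    Tendsto (fun W : ℝ => ∫ u, r u * ((W * Real.sinc (W * u) : ℝ) : ℂ)) atTop (𝓝 0) := by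
  refine (tendsto_integral_mul_sin hr).congr' ?_
  filter_upwards [eventually_gt_atTop 0] with W hW
  refine integral_congr_ae ?_
  filter_upwards [compl_mem_ae_iff.2 (measure_singleton (0 : ℝ))] with u hu
  have hu0 : u ≠ 0 := hu
  rw [Real.sinc_of_ne_zero (mul_ne_zero hW.ne' hu0)]
  have hW' : (W : ℂ) ≠ 0 := by exact_mod_cast hW.ne'
  have hu' : (u : ℂ) ≠ 0 := by exact_mod_cast hu0
  push_cast
  field

/-- The truncated inverse Fourier integral at `0` is an integral against the Dirichlet kernel. -/
theorem integral_integral_mul_exp_eq_sinc {g : ℝ → ℂ} (hg : Integrable g) (W : ℝ) :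
    ∫ ω in (-W)..W, ∫ u, g u * Complex.exp (-(ω * u * Complex.I)) =
      2 * ∫ u, g u * ((W * Real.sinc (W * u) : ℝ) : ℂ) := by
  have hint : Integrable (Function.uncurry fun (ω u : ℝ) =>
      g u * Complex.exp (-(ω * u * Complex.I)))
      ((volume.restrict (uIoc (-W) W)).prod volume) := by
    have h1 : Integrable (fun _ : ℝ => (1 : ℂ)) (volume.restrict (uIoc (-W) W)) :=
      intervalIntegrable_iff.1 intervalIntegrable_const
    have h2 := h1.mul_prod hg
    refine (h2.bdd_mul (c := 1)
      (f := fun z : ℝ × ℝ => Complex.exp (-(z.1 * z.2 * Complex.I))) ?_ ?_).congr ?_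
    · exact (by fun_prop : Continuous fun z : ℝ × ℝ =>
        Complex.exp (-(z.1 * z.2 * Complex.I))).aestronglyMeasurable
    · refine Eventually.of_forall fun z => ?_
      simp [Complex.norm_exp]
    · refine Eventually.of_forall fun z => ?_
      simp [Function.uncurry, mul_comm]
  rw [intervalIntegral_integral_swap hint, ← integral_const_mul]
  congr 1 with u
  rw [intervalIntegral.integral_const_mul]
  have hker : ∫ ω in (-W)..W, Complex.exp (-(ω * u * Complex.I)) =
      2 * ((W * Real.sinc (W * u) : ℝ) : ℂ) := by
    rcases eq_or_ne u 0 with rfl | hu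
    · simp
      ring
    have h := intervalIntegral.integral_comp_mul_right (a := -W) (b := W)
      (fun t : ℝ => Complex.exp (t * Complex.I)) (neg_ne_zero.2 hu)
    rw [neg_mul, integral_exp_mul_I_eq_sinc, mul_neg, Real.sinc_neg] at h
    have hu' : (u : ℂ) ≠ 0 := by exact_mod_cast hu
    convert h using 1
    · congr 1 with ω
      push_cast
      congr 1
      ring
    · rw [Complex.real_smul]
      push_cast
      field
  rw [hker]
  ring

theorem tendsto_integral_gaussian_mul_sinc :
    Tendsto (fun W : ℝ => ∫ u : ℝ, Complex.exp (-π * u ^ 2) *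
      ((W * Real.sinc (W * u) : ℝ) : ℂ)) atTop (𝓝 π) := by
  have hg : Integrable fun u : ℝ => Complex.exp (-π * (u : ℂ) ^ 2) :=
    integrable_cexp_neg_mul_sq (by simp [Real.pi_pos])
  have hF : ∀ ω : ℝ, ∫ u : ℝ, Complex.exp (-π * (u : ℂ) ^ 2) *
      Complex.exp (-(ω * u * Complex.I)) = (Real.exp (-(1 / (4 * π)) * ω ^ 2) : ℂ) := by
    intro ω
    have h := fourierIntegral_gaussian (b := π) (by simp [Real.pi_pos]) (-ω)
    have hpi : (π : ℂ) ≠ 0 := by exact_mod_cast Real.pi_ne_zero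
    rw [div_self hpi, Complex.one_cpow, one_mul] at h
    rw [Complex.ofReal_exp]
    convert h using 1
    · congr 1 with u
      rw [mul_comm]
      congr 2
      ring
    · congr 1
      push_cast
      field
  have hlim := intervalIntegral_tendsto_integral (μ := volume)
    ((integrable_exp_neg_mul_sq (b := 1 / (4 * π)) (by positivity)).ofReal (𝕜 := ℂ))
    tendsto_neg_atTop_atBot tendsto_id
  have hval : ∫ ω : ℝ, ((Real.exp (-(1 / (4 * π)) * ω ^ 2) : ℝ) : ℂ) = 2 * π := by
    rw [integral_complex_ofReal, integral_gaussian]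
    have : π / (1 / (4 * π)) = (2 * π) ^ 2 := by field
    rw [this, Real.sqrt_sq (by positivity)]
    push_cast
    ring
  have := hlim.const_mul (1 / 2 : ℂ)
  simp only [RCLike.ofReal_eq_complex_ofReal] at this
  rw [hval] at this
  convert this.congr fun W => ?_ using 2
  · ring
  · simp_rw [← hF]
    rw [id, integral_integral_mul_exp_eq_sinc hg]
    ring

theorem tendsto_integral_symm_boundedVariationOn_mul_sinc {b : ℝ → ℂ} {δ : ℝ} (hδ : 0 < δ)
    (hpos : BoundedVariationOn b (Icc 0 δ))
    (hneg : BoundedVariationOn (fun u => b (-u)) (Icc 0 δ)) (hb0 : Tendsto b (𝓝 0) (𝓝 0))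
    (hbint : IntegrableOn b (Icc (-δ) δ)) :
    Tendsto (fun W : ℝ => ∫ u in Icc (-δ) δ, b u * ((W * Real.sinc (W * u) : ℝ) : ℂ))
      atTop (𝓝 0) := by
  have hint1 : IntervalIntegrable b volume 0 δ := by
    rw [intervalIntegrable_iff_integrableOn_Icc_of_le hδ.le]
    exact hbint.mono_set (Icc_subset_Icc_left (by linarith))
  have hint2 : IntervalIntegrable b volume (-δ) 0 := by
    rw [intervalIntegrable_iff_integrableOn_Icc_of_le (by linarith)]
    exact hbint.mono_set (Icc_subset_Icc_right hδ.le)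
  have hb0' : Tendsto (fun u => b (-u)) (𝓝 0) (𝓝 0) :=
    hb0.comp (by simpa using (continuous_neg (G := ℝ)).tendsto 0)
  have h1 := tendsto_integral_complex_boundedVariationOn_mul_sinc hδ hpos
    (hb0.mono_left nhdsWithin_le_nhds) hint1
  have h2 := tendsto_integral_complex_boundedVariationOn_mul_sinc hδ hneg
    (hb0'.mono_left nhdsWithin_le_nhds) (by simpa using hint2.comp_sub_left 0 |>.symm)
  have := h2.add h1
  rw [add_zero] at this
  refine this.congr fun W => ?_
  have hK : Continuous fun u => ((W * Real.sinc (W * u) : ℝ) : ℂ) :=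
    Complex.continuous_ofReal.comp (continuous_mul_sinc_mul W)
  rw [integral_Icc_eq_integral_Ioc, ← intervalIntegral.integral_of_le (by linarith),
    ← intervalIntegral.integral_add_adjacent_intervals
      (hint2.mul_continuousOn hK.continuousOn) (hint1.mul_continuousOn hK.continuousOn)]
  congr 1
  have := intervalIntegral.integral_comp_neg (a := 0) (b := δ)
    (fun u => b u * ((W * Real.sinc (W * u) : ℝ) : ℂ))
  simpa using this

theorem continuous_dslope_of_differentiable {E : ℝ → ℂ} (hE : Differentiable ℝ E) (a : ℝ) :
    Continuous (dslope E a) := by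
  rw [← continuousOn_univ, continuousOn_dslope univ_mem]
  exact ⟨hE.continuous.continuousOn, hE a⟩

theorem dslope_zero_eq_div {E : ℝ → ℂ} {u : ℝ} (hu : u ≠ 0) :
    dslope E 0 u = (E u - E 0) / u := by
  rw [dslope_of_ne _ hu, slope_def_module, Complex.real_smul]
  push_cast
  rw [sub_zero]
  ring

theorem integrable_div_of_integrable_of_integrableOn {r : ℝ → ℂ} (hr : Integrable r) {δ : ℝ}
    (hδ : 0 < δ) (hloc : IntegrableOn (fun u : ℝ => r u / u) (Icc (-δ) δ)) :
    Integrable fun u : ℝ => r u / u := by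
  rw [← integrableOn_univ, ← union_compl_self (Icc (-δ) δ)]
  refine hloc.union ?_
  refine Integrable.mono' (hr.norm.const_mul δ⁻¹).integrableOn
    (hr.aestronglyMeasurable.restrict.div₀
      (Complex.continuous_ofReal.aestronglyMeasurable)) ?_
  filter_upwards [ae_restrict_mem measurableSet_Icc.compl] with u hu
  have hu' : δ ≤ |u| := by
    by_contra! h
    exact hu ⟨(abs_lt.1 h).1.le, (abs_lt.1 h).2.le⟩
  rw [norm_div, Complex.norm_real, Real.norm_eq_abs, div_eq_inv_mul]
  gcongr

/-- The Dirichlet–Jordan theorem on `ℝ` at a point of continuity, with a differentiable weight `E`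
normalised by `E 0 = 1` that makes the function integrable. -/
theorem tendsto_integral_mul_sinc_of_boundedVariationOn {f : ℝ → ℂ} {E : ℝ → ℂ} {t₀ : ℝ}
    (hf_loc : ∀ a b : ℝ, IntegrableOn f (Icc a b)) (hE : Differentiable ℝ E) (hE0 : E 0 = 1)
    (hfE : Integrable fun u => f (t₀ + u) * E u)
    (hBV : ∃ a b : ℝ, a < t₀ ∧ t₀ < b ∧ BoundedVariationOn f (Ioo a b))
    (hcont : ContinuousAt f t₀) :
    Tendsto (fun W : ℝ => ∫ u, f (t₀ + u) * E u * ((W * Real.sinc (W * u) : ℝ) : ℂ))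
      atTop (𝓝 (π * f t₀)) := by
  obtain ⟨a, b, ha, hb, hBV⟩ := hBV
  obtain ⟨δ, hδ, hδa, hδb⟩ : ∃ δ, 0 < δ ∧ δ < t₀ - a ∧ δ < b - t₀ := by
    obtain ⟨δ, h0, h⟩ := exists_between (lt_min (sub_pos.2 ha) (sub_pos.2 hb))
    exact ⟨δ, h0, h.trans_le (min_le_left _ _), h.trans_le (min_le_right _ _)⟩
  set d : ℝ → ℂ := fun u => f (t₀ + u) - f t₀ with hd
  set G : ℝ → ℂ := fun u => Complex.exp (-π * u ^ 2) with hG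
  have hG0 : G 0 = 1 := by simp [hG]
  have hGd : Differentiable ℝ G := by
    have : Differentiable ℝ fun u : ℝ => (u : ℂ) := Complex.ofRealCLM.differentiable
    simp only [hG]
    fun_prop
  have hGint : Integrable G := integrable_cexp_neg_mul_sq (by simp [Real.pi_pos])
  have hsub : LipschitzWith 1 fun z : ℂ => z - f t₀ := LipschitzWith.of_dist_le_mul (by simp)
  have hpos : BoundedVariationOn d (Icc 0 δ) := by
    refine hsub.comp_boundedVariationOn (g := fun u => f (t₀ + u)) (ne_top_of_le_ne_top hBV
      (eVariationOn.comp_le_of_monotoneOn f (fun u => t₀ + u) ?_ ?_))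
    · exact fun x _ y _ hxy => by simpa using hxy
    · exact fun x hx => ⟨by linarith [hx.1], by linarith [hx.2]⟩
  have hneg : BoundedVariationOn (fun u => d (-u)) (Icc 0 δ) := by
    refine hsub.comp_boundedVariationOn (g := fun u => f (t₀ + -u)) (ne_top_of_le_ne_top hBV
      (eVariationOn.comp_le_of_antitoneOn f (fun u => t₀ + -u) ?_ ?_))
    · exact fun x _ y _ hxy => add_le_add_right (neg_le_neg hxy) t₀
    · exact fun x hx => ⟨by linarith [hx.2], by linarith [hx.1]⟩
  have hd0 : Tendsto d (𝓝 0) (𝓝 0) := by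
    have h1 : Tendsto (fun u : ℝ => t₀ + u) (𝓝 0) (𝓝 t₀) := by
      simpa using (continuous_const_add t₀).tendsto 0
    simpa [hd] using (hcont.tendsto.comp h1).sub_const (f t₀)
  have hfloc : IntegrableOn (fun u => f (t₀ + u)) (Icc (-δ) δ) := by
    have := (measurePreserving_add_left volume t₀).integrableOn_comp_preimage
      (measurableEmbedding_addLeft t₀) (f := f) (s := Icc (t₀ - δ) (t₀ + δ))
    have h2 := this.2 (hf_loc _ _)
    rwa [preimage_const_add_Icc, sub_sub_cancel_left, add_sub_cancel_left] at h2
  have hdint : IntegrableOn d (Icc (-δ) δ) :=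
    hfloc.sub (integrableOn_const (by simp) (by simp))
  have hdind := hdint.integrable_indicator measurableSet_Icc
  set r : ℝ → ℂ := fun u => f (t₀ + u) * E u - f t₀ * G u - (Icc (-δ) δ).indicator d u with hr
  have hrint : Integrable r := (hfE.sub (hGint.const_mul _)).sub hdind
  have hrdiv : Integrable fun u : ℝ => r u / u := by
    refine integrable_div_of_integrable_of_integrableOn hrint hδ ?_
    have h1 : IntegrableOn (fun u => dslope E 0 u * f (t₀ + u) - f t₀ * dslope G 0 u)
        (Icc (-δ) δ) :=
      (hfloc.continuousOn_mul (continuous_dslope_of_differentiable hE 0).continuousOn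
        isCompact_Icc).sub
        (((continuous_dslope_of_differentiable hGd 0).integrableOn_Icc).const_mul _)
    refine h1.congr ?_
    filter_upwards [ae_restrict_mem measurableSet_Icc,
      ae_restrict_of_ae (compl_mem_ae_iff.2 (measure_singleton (0 : ℝ)))] with u hu hu0
    have hu0' : u ≠ 0 := hu0
    simp only [hr, indicator_of_mem hu, dslope_zero_eq_div hu0', hE0, hG0, hd]
    ring
  have hlim := ((tendsto_integral_mul_sinc_of_integrable_div hrdiv).add
    (tendsto_integral_symm_boundedVariationOn_mul_sinc hδ hpos hneg hd0 hdint)).add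
    (tendsto_integral_gaussian_mul_sinc.mul_const (f t₀))
  rw [add_zero, zero_add] at hlim
  refine hlim.congr fun W => ?_
  have hmul : ∀ {k : ℝ → ℂ}, Integrable k →
      Integrable fun u => k u * ((W * Real.sinc (W * u) : ℝ) : ℂ) := by
    intro k hk
    refine hk.mul_bdd (c := |W|)
      (Complex.continuous_ofReal.comp (continuous_mul_sinc_mul W)).aestronglyMeasurable
      (Eventually.of_forall fun u => ?_)
    rw [Complex.norm_real, Real.norm_eq_abs, abs_mul]
    exact mul_le_of_le_one_right (abs_nonneg _) (Real.abs_sinc_le_one _)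
  have hind : ∫ u in Icc (-δ) δ, d u * ((W * Real.sinc (W * u) : ℝ) : ℂ) =
      ∫ u, (Icc (-δ) δ).indicator d u * ((W * Real.sinc (W * u) : ℝ) : ℂ) := by
    rw [← integral_indicator measurableSet_Icc]
    simp only [indicator_mul_left]
  have hsum : Integrable fun u => r u * ((W * Real.sinc (W * u) : ℝ) : ℂ) +
      (Icc (-δ) δ).indicator d u * ((W * Real.sinc (W * u) : ℝ) : ℂ) :=
    (hmul hrint).add (hmul hdind)
  rw [hind, ← integral_add (hmul hrint) (hmul hdind), ← integral_mul_const,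
    ← integral_add hsum ((hmul hGint).mul_const _)]
  congr 1 with u
  simp only [hr, hG]
  ring

end LaplaceInversion

/-- Lemma 3 of the paper's appendix (Laplace inversion along a vertical line of
absolute convergence, at a point of continuity): if `f e^{λ·}` is integrable, `f` has
bounded variation near `t₀` and is continuous at `t₀`, then
`f(t₀) = lim_{Ω→∞} (1/2π) ∫_{-Ω}^{Ω} F(-λ+iω) e^{(-λ+iω)t₀} dω`, where
`F(s) = ∫ f(τ) e^{-sτ} dτ`. -/
theorem bilateral_laplace_inversion (f : ℝ → ℂ) (lam : ℝ)
    (hf_meas : Measurable f)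
    (hf_loc : ∀ a b : ℝ, IntegrableOn f (Set.Icc a b))
    (hf_int : Integrable (fun t : ℝ => f t * Real.exp (lam * t)))
    (t₀ : ℝ)
    (hBV : ∃ a b : ℝ, a < t₀ ∧ t₀ < b ∧ BoundedVariationOn f (Set.Ioo a b))
    (hcont : ContinuousAt f t₀) :
    Tendsto (fun Ω : ℝ => (1 / (2 * Real.pi) : ℂ) *
        ∫ ω in (-Ω)..Ω,
          (∫ τ : ℝ, f τ * Complex.exp (-(-lam + ω * Complex.I) * τ)) *
            Complex.exp ((-lam + ω * Complex.I) * t₀))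
      atTop (nhds (f t₀)) := by
  have hlam : Differentiable ℝ fun u : ℝ => Complex.exp (lam * u) := by
    have : Differentiable ℝ fun u : ℝ => (u : ℂ) := Complex.ofRealCLM.differentiable
    fun_prop
  have hfE : Integrable fun u : ℝ => f (t₀ + u) * Complex.exp (lam * u) := by
    refine ((hf_int.comp_add_left t₀).mul_const (Complex.exp (-(lam * t₀)))).congr
      (Eventually.of_forall fun u => ?_)
    push_cast
    rw [mul_assoc, ← Complex.exp_add]
    congr 2
    ring
  have hlim := (tendsto_integral_mul_sinc_of_boundedVariationOn hf_loc hlam (by simp) hfE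
    hBV hcont).const_mul (1 / Real.pi : ℂ)
  have hpi : (Real.pi : ℂ) ≠ 0 := by exact_mod_cast Real.pi_ne_zero
  rw [show (1 / Real.pi : ℂ) * (Real.pi * f t₀) = f t₀ by field] at hlim
  refine hlim.congr fun W => ?_
  have hinner : ∀ ω : ℝ,
      (∫ τ : ℝ, f τ * Complex.exp (-(-lam + ω * Complex.I) * τ)) *
          Complex.exp ((-lam + ω * Complex.I) * t₀) =
        ∫ u : ℝ, f (t₀ + u) * Complex.exp (lam * u) * Complex.exp (-(ω * u * Complex.I)) := by
    intro ω
    rw [← integral_mul_const, ← integral_add_left_eq_self _ t₀]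
    congr 1 with u
    rw [mul_assoc, mul_assoc, ← Complex.exp_add, ← Complex.exp_add]
    congr 2
    push_cast
    ring
  simp_rw [hinner]
  rw [integral_integral_mul_exp_eq_sinc hfE]
  field
end
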